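/- Let k be an algebraically closed field of characteristic zero, (H,R) a finite-dimensional semisimple quasi-triangular Hopf algebra over k, D a minimal H-adjoint-stable subcoalgebra of H_R, and W a finite-dimensional nonzero left D-comodule. Then for every irreducible right module U over the R-adjoint-stable algebra N_W = W* □_D (H⊗W), the product dim_k U · dim_k W divides dim_k N_W. In particular, the dimension of every irreducible right N_W-module divides dim_k N_W. -/

import Mathlib

open TensorProduct LinearMap

variable (K : Type) [Field K] (H : Type) [Ring H] [HopfAlgebra K H]

/-- The left adjoint action as a linear map `H ⊗ H →ₗ H`, `h ⊗ a ↦ Σ h₍₁₎ * a * S(h₍₂₎)`. -/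
noncomputable def adMap : H ⊗[K] H →ₗ[K] H :=
  (LinearMap.mul' K H) ∘ₗ
    (LinearMap.lTensor H ((LinearMap.mul' K H) ∘ₗ
      (LinearMap.lTensor H (HopfAlgebra.antipode (R := K))) ∘ₗ
      (TensorProduct.comm K H H).toLinearMap)) ∘ₗ
    (TensorProduct.assoc K H H H).toLinearMap ∘ₗ
    (LinearMap.rTensor H (Coalgebra.comul (R := K)))

/-- `h ·_ad a = Σ h₍₁₎ a S(h₍₂₎)`. -/
noncomputable def adAct (h a : H) : H := adMap K H (h ⊗ₜ a)

/-- `R¹² = Σ r¹ ⊗ r² ⊗ 1` in `H ⊗ (H ⊗ H)`. -/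
noncomputable def r12 (R : H ⊗[K] H) : H ⊗[K] (H ⊗[K] H) :=
  TensorProduct.map LinearMap.id ((TensorProduct.mk K H H).flip 1) R

/-- `R¹³ = Σ r¹ ⊗ 1 ⊗ r²` in `H ⊗ (H ⊗ H)`. -/
noncomputable def r13 (R : H ⊗[K] H) : H ⊗[K] (H ⊗[K] H) :=
  TensorProduct.map LinearMap.id (TensorProduct.mk K H H 1) R

/-- `R²³ = 1 ⊗ R` in `H ⊗ (H ⊗ H)`. -/
noncomputable def r23 (R : H ⊗[K] H) : H ⊗[K] (H ⊗[K] H) := (1 : H) ⊗ₜ R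

/-- `(H,R)` is a quasi-triangular Hopf algebra: `R` is invertible,
`R Δ(h) = Δᶜᵒᵖ(h) R`, `(Δ⊗id)(R) = R¹³R²³` and `(id⊗Δ)(R) = R¹³R¹²`. -/
structure IsQuasiTriangular (R : H ⊗[K] H) : Prop where
  isUnit : IsUnit R
  intertwine : ∀ h : H, R * Coalgebra.comul h =
    (TensorProduct.comm K H H) (Coalgebra.comul h) * R
  comul_rTensor : (TensorProduct.assoc K H H H)
      ((LinearMap.rTensor H (Coalgebra.comul (R := K))) R) = r13 K H R * r23 K H R
  comul_lTensor : (LinearMap.lTensor H (Coalgebra.comul (R := K))) R = r13 K H R * r12 K H R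

/-- The comultiplication `Δ_R` of the transmuted braided group `H_R`:
`Δ_R(h) = Σ h₍₁₎ S(R²) ⊗ R¹ ·_ad h₍₂₎`. -/
noncomputable def deltaR (R : H ⊗[K] H) : H →ₗ[K] H ⊗[K] H :=
  (TensorProduct.map
      ((LinearMap.mul' K H) ∘ₗ (LinearMap.lTensor H (HopfAlgebra.antipode (R := K))))
      ((adMap K H) ∘ₗ (TensorProduct.comm K H H).toLinearMap)) ∘ₗ
    (TensorProduct.tensorTensorTensorComm K H H H H).toLinearMap ∘ₗ
    (LinearMap.lTensor (H ⊗[K] H) (TensorProduct.comm K H H).toLinearMap) ∘ₗ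
    ((TensorProduct.mk K (H ⊗[K] H) (H ⊗[K] H)).flip R) ∘ₗ
    (Coalgebra.comul (R := K))

/-- A subcoalgebra of `(H, Δ)`. -/
def IsSubcoalgebra (D : Submodule K H) : Prop :=
  ∀ a ∈ D, Coalgebra.comul (R := K) a ∈ Submodule.map₂ (TensorProduct.mk K H H) D D

/-- A simple (nonzero, minimal) subcoalgebra of `(H, Δ)`. -/
def IsSimpleSubcoalgebra (D : Submodule K H) : Prop :=
  D ≠ ⊥ ∧ IsSubcoalgebra K H D ∧
    ∀ D' : Submodule K H, D' ≤ D → IsSubcoalgebra K H D' → D' = ⊥ ∨ D' = D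

/-- `H` is a cosemisimple coalgebra: the sum of its simple subcoalgebras is everything. -/
def IsCosemisimpleCoalgebra : Prop :=
  sSup {D : Submodule K H | IsSimpleSubcoalgebra K H D} = ⊤

/-- A subcoalgebra of the transmuted braided group `(H, Δ_R)`. -/
def IsSubcoalgebraR (R : H ⊗[K] H) (D : Submodule K H) : Prop :=
  ∀ a ∈ D, deltaR K H R a ∈ Submodule.map₂ (TensorProduct.mk K H H) D D

/-- A simple (nonzero, minimal) subcoalgebra of `(H, Δ_R)`. -/
def IsSimpleSubcoalgebraR (R : H ⊗[K] H) (D : Submodule K H) : Prop :=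
  D ≠ ⊥ ∧ IsSubcoalgebraR K H R D ∧
    ∀ D' : Submodule K H, D' ≤ D → IsSubcoalgebraR K H R D' → D' = ⊥ ∨ D' = D

/-- The coalgebra `(H, Δ_R)` is cosemisimple: it is the sum of its simple subcoalgebras. -/
def IsCosemisimpleR (R : H ⊗[K] H) : Prop :=
  sSup {D : Submodule K H | IsSimpleSubcoalgebraR K H R D} = ⊤

/-- A Yetter–Drinfeld submodule of `H` (with the adjoint action and the coproduct):
a subspace stable under `·_ad` and a left subcomodule for `Δ`, i.e. `Δ(D) ⊆ H ⊗ D`. -/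
def IsYDSubmodule (D : Submodule K H) : Prop :=
  (∀ (h : H), ∀ a ∈ D, adAct K H h a ∈ D) ∧
  (∀ a ∈ D, Coalgebra.comul (R := K) a ∈ Submodule.map₂ (TensorProduct.mk K H H) ⊤ D)

/-- A minimal (irreducible) Yetter–Drinfeld submodule of `H`. -/
def IsMinimalYDSubmodule (D : Submodule K H) : Prop :=
  D ≠ ⊥ ∧ IsYDSubmodule K H D ∧
    ∀ D' : Submodule K H, D' ≤ D → IsYDSubmodule K H D' → D' = ⊥ ∨ D' = D

/-- An `H`-adjoint-stable subcoalgebra of the transmuted braided group `H_R`: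
a subcoalgebra of `(H, Δ_R)` which is stable under the left adjoint action. -/
def IsAdjointStableSubcoalgebra (R : H ⊗[K] H) (D : Submodule K H) : Prop :=
  (∀ (h : H), ∀ a ∈ D, adAct K H h a ∈ D) ∧
  (∀ a ∈ D, deltaR K H R a ∈ Submodule.map₂ (TensorProduct.mk K H H) D D)

/-- A minimal (nonzero) `H`-adjoint-stable subcoalgebra of `H_R`. -/
def IsMinimalAdjointStableSubcoalgebra (R : H ⊗[K] H) (D : Submodule K H) : Prop :=
  D ≠ ⊥ ∧ IsAdjointStableSubcoalgebra K H R D ∧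
    ∀ D' : Submodule K H, D' ≤ D → IsAdjointStableSubcoalgebra K H R D' → D' = ⊥ ∨ D' = D

/-- An object of `_H^{H_R}M`: a left `H`-module `V` together with a left comodule
structure `ρ_R` over the transmuted braided group `(H, Δ_R)`, satisfying the
compatibility `ρ_R(hv) = Σ h₍₁₎ ·_ad v⁽⁻¹⁾ ⊗ h₍₂₎ v⁽⁰⁾`.  By Zhu's lemma, this
category is the Yetter–Drinfeld category `_H^H YD`. -/
structure RModStr (R : H ⊗[K] H) (V : Type*) [AddCommGroup V] [Module K V] where
  act : H →ₐ[K] Module.End K V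
  coact : V →ₗ[K] H ⊗[K] V
  counit_coact : ∀ v : V,
    (TensorProduct.lid K V)
      ((LinearMap.rTensor V (Coalgebra.counit (R := K))) (coact v)) = v
  coassocR : (LinearMap.rTensor V (deltaR K H R)) ∘ₗ coact
      = (TensorProduct.assoc K H H V).symm.toLinearMap ∘ₗ
        (LinearMap.lTensor H coact) ∘ₗ coact
  compat : coact ∘ₗ (TensorProduct.lift act.toLinearMap)
      = (TensorProduct.map (adMap K H) (TensorProduct.lift act.toLinearMap)) ∘ₗ
        (TensorProduct.tensorTensorTensorComm K H H H V).toLinearMap ∘ₗ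
        (TensorProduct.map (Coalgebra.comul (R := K)) coact)

/-- The object lies in the subcategory `_H^D M`: its coaction takes values in `D ⊗ V`. -/
def memDCat (R : H ⊗[K] H) (D : Submodule K H) {V : Type*} [AddCommGroup V]
    [Module K V] (s : RModStr K H R V) : Prop :=
  ∀ v : V, s.coact v ∈ Submodule.map₂ (TensorProduct.mk K H V) D ⊤

/-- Irreducibility of an object of `_H^{H_R}M = _H^H YD`: it is nonzero and has no
nontrivial subspace stable under the action and the coaction. -/
def RModIrreducible (R : H ⊗[K] H) {V : Type*} [AddCommGroup V] [Module K V]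
    (s : RModStr K H R V) : Prop :=
  (⊥ : Submodule K V) ≠ ⊤ ∧
    ∀ W : Submodule K V, (∀ h : H, ∀ w ∈ W, s.act h w ∈ W) →
      (∀ w ∈ W, s.coact w ∈ Submodule.map₂ (TensorProduct.mk K H V) ⊤ W) →
      W = ⊥ ∨ W = ⊤

/-- A left comodule structure over a subcoalgebra `D` of the transmuted braided
group `(H, Δ_R)`. -/
structure DComodStr (R : H ⊗[K] H) (D : Submodule K H) (W : Type*) [AddCommGroup W]
    [Module K W] where
  coact : W →ₗ[K] H ⊗[K] W
  mem : ∀ w : W, coact w ∈ Submodule.map₂ (TensorProduct.mk K H W) D ⊤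
  counit_coact : ∀ w : W,
    (TensorProduct.lid K W)
      ((LinearMap.rTensor W (Coalgebra.counit (R := K))) (coact w)) = w
  coassocR : (LinearMap.rTensor W (deltaR K H R)) ∘ₗ coact
      = (TensorProduct.assoc K H H W).symm.toLinearMap ∘ₗ
        (LinearMap.lTensor H coact) ∘ₗ coact

/-- The coaction `ρ_R(h ⊗ w) = Σ h₍₁₎ ·_ad w₍₋₁₎ ⊗ (h₍₂₎ ⊗ w₍₀₎)` on `H ⊗ W`. -/
noncomputable def rhoHW (R : H ⊗[K] H) {D : Submodule K H} {W : Type*} [AddCommGroup W]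
    [Module K W] (sW : DComodStr K H R D W) :
    H ⊗[K] W →ₗ[K] H ⊗[K] (H ⊗[K] W) :=
  (TensorProduct.map (adMap K H) LinearMap.id) ∘ₗ
    (TensorProduct.tensorTensorTensorComm K H H H W).toLinearMap ∘ₗ
    (TensorProduct.map (Coalgebra.comul (R := K)) sW.coact)

/-- The cotensor product `X □ Y ⊆ X ⊗ Y` of a right `H`-comodule `(X, ρX)` and a left
`H`-comodule `(Y, ρY)`. -/
noncomputable def cotensor {X Y : Type*} [AddCommGroup X] [Module K X] [AddCommGroup Y]
    [Module K Y] (ρX : X →ₗ[K] X ⊗[K] H) (ρY : Y →ₗ[K] H ⊗[K] Y) :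
    Submodule K (X ⊗[K] Y) :=
  LinearMap.ker ((TensorProduct.assoc K X H Y).toLinearMap ∘ₗ
    (LinearMap.rTensor Y ρX) - (LinearMap.lTensor X ρY))

/-- `ρ*` is the right comodule structure on `W*` dual to the left comodule structure
`coactW` on `W`:  `Σ ⟨f⁽⁰⁾, w⟩ f⁽¹⁾ = Σ w₍₋₁₎ ⟨f, w₍₀₎⟩`. -/
def IsDualCoaction {W : Type*} [AddCommGroup W] [Module K W]
    (coactW : W →ₗ[K] H ⊗[K] W)
    (ρstar : Module.Dual K W →ₗ[K] (Module.Dual K W) ⊗[K] H) : Prop :=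
  ∀ (f : Module.Dual K W) (w : W),
    (TensorProduct.lid K H) ((LinearMap.rTensor H ((Module.Dual.eval K W) w)) (ρstar f))
      = (TensorProduct.rid K H) ((LinearMap.lTensor H f) (coactW w))

/-- The space `Hom_H^D(V₁, V₂)` of maps which are simultaneously left `H`-module and
left comodule morphisms. -/
def homHD (R : H ⊗[K] H) {V₁ V₂ : Type*} [AddCommGroup V₁] [Module K V₁]
    [AddCommGroup V₂] [Module K V₂] (s : RModStr K H R V₁) (t : RModStr K H R V₂) :
    Submodule K (V₁ →ₗ[K] V₂) where
  carrier := {f | (∀ h : H, (t.act h : V₂ →ₗ[K] V₂) ∘ₗ f = f ∘ₗ (s.act h : V₁ →ₗ[K] V₁)) ∧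
    (LinearMap.lTensor H f) ∘ₗ s.coact = t.coact ∘ₗ f}
  add_mem' := by
    rintro f g ⟨hf1, hf2⟩ ⟨hg1, hg2⟩
    refine ⟨fun h => ?_, ?_⟩
    · rw [LinearMap.comp_add, LinearMap.add_comp, hf1 h, hg1 h]
    · rw [LinearMap.lTensor_add, LinearMap.add_comp, LinearMap.comp_add, hf2, hg2]
  zero_mem' := by
    refine ⟨fun h => ?_, ?_⟩ <;> simp
  smul_mem' := by
    rintro c f ⟨hf1, hf2⟩
    refine ⟨fun h => ?_, ?_⟩
    · rw [LinearMap.comp_smul, LinearMap.smul_comp, hf1 h]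
    · rw [LinearMap.lTensor_smul, LinearMap.smul_comp, LinearMap.comp_smul, hf2]

/-- The algebra `Hom_H^D(V, V)` of endomorphisms of `V` which are simultaneously left
`H`-module and left comodule morphisms. -/
def endHD (R : H ⊗[K] H) {V : Type*} [AddCommGroup V] [Module K V]
    (s : RModStr K H R V) : Subalgebra K (Module.End K V) where
  carrier := {f | (∀ h : H, (s.act h : V →ₗ[K] V) ∘ₗ f = f ∘ₗ (s.act h : V →ₗ[K] V)) ∧
    (LinearMap.lTensor H f) ∘ₗ s.coact = s.coact ∘ₗ f}
  add_mem' := by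
    rintro f g ⟨hf1, hf2⟩ ⟨hg1, hg2⟩
    refine ⟨fun h => ?_, ?_⟩
    · rw [LinearMap.comp_add, LinearMap.add_comp, hf1 h, hg1 h]
    · rw [LinearMap.lTensor_add, LinearMap.add_comp, LinearMap.comp_add, hf2, hg2]
  mul_mem' := by
    rintro f g ⟨hf1, hf2⟩ ⟨hg1, hg2⟩
    refine ⟨fun h => ?_, ?_⟩
    · show (s.act h : V →ₗ[K] V) ∘ₗ (f ∘ₗ g) = (f ∘ₗ g) ∘ₗ (s.act h : V →ₗ[K] V)
      rw [← LinearMap.comp_assoc, hf1 h, LinearMap.comp_assoc, hg1 h, LinearMap.comp_assoc]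
    · show (LinearMap.lTensor H (f ∘ₗ g)) ∘ₗ s.coact = s.coact ∘ₗ (f ∘ₗ g)
      rw [LinearMap.lTensor_comp, LinearMap.comp_assoc, hg2, ← LinearMap.comp_assoc, hf2,
        LinearMap.comp_assoc]
  algebraMap_mem' := by
    intro c
    refine ⟨fun h => ?_, ?_⟩
    · ext v
      simp [Module.algebraMap_end_apply]
    · ext v
      have : ((algebraMap K (Module.End K V)) c) = c • (LinearMap.id (M := V)) := by
        ext w; simp [Module.algebraMap_end_apply]
      simp [this, Module.algebraMap_end_apply]

set_option linter.unusedSectionVars false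

namespace HopfDim

open Coalgebra Bialgebra HopfAlgebra WithConv

local notation "𝐛" => Module.finBasis K H

section Antipode

variable {K H}

/-- `Δ` is the convolution product of the two inclusions of `H` into `H ⊗ H`. -/
theorem incl_conv_incl :
    toConv (Algebra.TensorProduct.includeLeft (R := K) (S := K) (A := H) (B := H)).toLinearMap *
      toConv (Algebra.TensorProduct.includeRight (R := K) (A := H) (B := H)).toLinearMap =
      toConv (comul (R := K) (A := H)) := by
  ext c
  rw [(ℛ K c).convMul_apply]
  simp [Coalgebra.Repr.eq]

theorem algHom_conv_antipode {A : Type*} [Ring A] [Algebra K A] (f : H →ₐ[K] A) :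
    toConv f.toLinearMap * toConv (f.toLinearMap ∘ₗ antipode K) = 1 := by
  have := algHom_comp_convMul_distrib f (toConv LinearMap.id) (toConv (antipode K (A := H)))
  rw [id_mul_antipode] at this
  simp only [LinearMap.comp_id] at this
  apply WithConv.ofConv_injective
  rw [← this]
  ext; simp [LinearMap.convOne_def]

theorem antipode_conv_algHom {A : Type*} [Ring A] [Algebra K A] (f : H →ₐ[K] A) :
    toConv (f.toLinearMap ∘ₗ antipode K) * toConv f.toLinearMap = 1 := by
  have := algHom_comp_convMul_distrib f (toConv (antipode K (A := H))) (toConv LinearMap.id)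
  rw [antipode_mul_id] at this
  simp only [LinearMap.comp_id] at this
  apply WithConv.ofConv_injective
  rw [← this]
  ext; simp [LinearMap.convOne_def]

theorem comul_comp_antipode :
    comul (R := K) ∘ₗ antipode K (A := H) =
      TensorProduct.map (antipode K) (antipode K) ∘ₗ (TensorProduct.comm K H H).toLinearMap ∘ₗ
        comul (R := K) := by
  set i₁ := Algebra.TensorProduct.includeLeft (R := K) (S := K) (A := H) (B := H)
  set i₂ := Algebra.TensorProduct.includeRight (R := K) (A := H) (B := H)
  have h1 := antipode_conv_algHom (K := K) (H := H) (comulAlgHom K H)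
  have h2 : toConv (comulAlgHom K H).toLinearMap *
      (toConv (i₂.toLinearMap ∘ₗ antipode K) * toConv (i₁.toLinearMap ∘ₗ antipode K)) = 1 := by
    have : toConv (comulAlgHom K H).toLinearMap = toConv i₁.toLinearMap * toConv i₂.toLinearMap :=
      incl_conv_incl.symm
    rw [this, mul_assoc, ← mul_assoc (toConv i₂.toLinearMap), algHom_conv_antipode, one_mul,
      algHom_conv_antipode]
  have h3 := left_inv_eq_right_inv h1 h2
  have h4 := congrArg WithConv.ofConv h3
  change comul (R := K) ∘ₗ antipode K (A := H) = _ at h4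
  rw [h4]
  ext c
  rw [(ℛ K c).convMul_apply]
  conv_rhs => simp only [LinearMap.comp_apply]; rw [← (ℛ K c).eq]
  simp [i₁, i₂]

theorem comul_antipode (h : H) : comul (R := K) (antipode K h) =
    TensorProduct.map (antipode K) (antipode K) ((TensorProduct.comm K H H) (comul (R := K) h)) :=
  LinearMap.congr_fun comul_comp_antipode h

end Antipode

section

section Slices

variable {K}

/-- Contract the left tensor factor with a functional. -/
noncomputable def sliceL {V A : Type*} [AddCommGroup V] [Module K V] [AddCommGroup A] [Module K A]
    (f : V →ₗ[K] K) : V ⊗[K] A →ₗ[K] A :=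
  (TensorProduct.lid K A).toLinearMap ∘ₗ LinearMap.rTensor A f

/-- Contract the right tensor factor with a functional. -/
noncomputable def sliceR {V A : Type*} [AddCommGroup V] [Module K V] [AddCommGroup A] [Module K A]
    (f : V →ₗ[K] K) : A ⊗[K] V →ₗ[K] A :=
  (TensorProduct.rid K A).toLinearMap ∘ₗ LinearMap.lTensor A f

section

variable {V A B : Type*} [AddCommGroup V] [Module K V] [AddCommGroup A] [Module K A]
  [AddCommGroup B] [Module K B] (f : V →ₗ[K] K)

@[simp] theorem sliceL_tmul (v : V) (a : A) : sliceL f (v ⊗ₜ[K] a) = f v • a := by simp [sliceL]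

@[simp] theorem sliceR_tmul (v : V) (a : A) : sliceR f (a ⊗ₜ[K] v) = f v • a := by simp [sliceR]

theorem sliceR_sum {ι : Type*} [Fintype ι] (F : ι → V →ₗ[K] K) (t : A ⊗[K] V) :
    sliceR (∑ i, F i) t = ∑ i, sliceR (F i) t := by
  induction t with
  | zero => simp
  | tmul v a => simp [Finset.sum_smul]
  | add x y hx hy => simp [hx, hy, Finset.sum_add_distrib]

theorem sliceR_smul (c : K) (t : A ⊗[K] V) : sliceR (c • f) t = c • sliceR f t := by
  induction t with
  | zero => simp
  | tmul v a => simp [smul_smul]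
  | add x y hx hy => simp [hx, hy]

theorem sliceL_smul (c : K) (t : V ⊗[K] A) : sliceL (c • f) t = c • sliceL f t := by
  induction t with
  | zero => simp
  | tmul v a => simp [smul_smul]
  | add x y hx hy => simp [hx, hy]

theorem map_sliceL (g : A →ₗ[K] B) (t : V ⊗[K] A) : g (sliceL f t) = sliceL f (lTensor V g t) := by
  induction t with
  | zero => simp
  | tmul v a => simp
  | add x y hx hy => simp [hx, hy]

theorem map_sliceR (g : A →ₗ[K] B) (t : A ⊗[K] V) : g (sliceR f t) = sliceR f (rTensor V g t) := by
  induction t with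
  | zero => simp
  | tmul v a => simp
  | add x y hx hy => simp [hx, hy]

end

variable {V A : Type*} [Ring V] [Algebra K V] [Ring A] [Algebra K A] (f : V →ₗ[K] K)

theorem sliceL_mul_right (a : A) (t : V ⊗[K] A) : sliceL f (t * (1 ⊗ₜ a)) = sliceL f t * a := by
  induction t with
  | zero => simp
  | tmul v a => simp
  | add x y hx hy => simp [hx, hy, add_mul]

theorem sliceR_mul_left (a : A) (t : A ⊗[K] V) : sliceR f ((a ⊗ₜ 1) * t) = a * sliceR f t := by
  induction t with
  | zero => simp
  | tmul v a => simp
  | add x y hx hy => simp [hx, hy, mul_add]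

theorem sliceR_mul_right (a : A) (t : A ⊗[K] V) : sliceR f (t * (a ⊗ₜ 1)) = sliceR f t * a := by
  induction t with
  | zero => simp
  | tmul v a => simp
  | add x y hx hy => simp [hx, hy, add_mul]

theorem sliceL_mul_tmul_one (v : V) (t : V ⊗[K] A) :
    sliceL f (t * (v ⊗ₜ 1)) = sliceL (f ∘ₗ mulRight K v) t := by
  induction t with
  | zero => simp
  | tmul v a => simp
  | add x y hx hy => simp [hx, hy, add_mul]

theorem sliceR_mul_one_tmul (v : V) (t : A ⊗[K] V) :
    sliceR f (t * (1 ⊗ₜ v)) = sliceR (f ∘ₗ mulRight K v) t := by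
  induction t with
  | zero => simp
  | tmul v a => simp
  | add x y hx hy => simp [hx, hy, add_mul]

theorem sliceR_one_tmul_mul (v : V) (t : A ⊗[K] V) :
    sliceR f ((1 ⊗ₜ v) * t) = sliceR (f ∘ₗ mulLeft K v) t := by
  induction t with
  | zero => simp
  | tmul v a => simp
  | add x y hx hy => simp [hx, hy, mul_add]

end Slices

section Hits

variable {K H}

/-- `h ↦ Σ h₍₁₎ f(h₍₂₎)`. -/
noncomputable def hitL (f : H →ₗ[K] K) : H →ₗ[K] H := sliceR f ∘ₗ comul (R := K)

/-- `h ↦ Σ f(h₍₁₎) h₍₂₎`. -/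
noncomputable def hitR (f : H →ₗ[K] K) : H →ₗ[K] H := sliceL f ∘ₗ comul (R := K)

theorem hitL_apply (f : H →ₗ[K] K) (h : H) : hitL f h = sliceR f (comul (R := K) h) := rfl

theorem hitR_apply (f : H →ₗ[K] K) (h : H) : hitR f h = sliceL f (comul (R := K) h) := rfl

@[simp] theorem hitL_counit : hitL (counit (R := K) (A := H)) = LinearMap.id := by
  ext h; simp [hitL, sliceR]

@[simp] theorem hitR_counit : hitR (counit (R := K) (A := H)) = LinearMap.id := by
  ext h; simp [hitR, sliceL]

/-- Convolution product of functionals. -/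
noncomputable def convF (f g : H →ₗ[K] K) : H →ₗ[K] K := f ∘ₗ hitL g

theorem sliceR_sliceR {A B C : Type*} [AddCommGroup A] [Module K A] [AddCommGroup B] [Module K B]
    [AddCommGroup C] [Module K C] (f : C →ₗ[K] K) (g : B →ₗ[K] K) (u : (A ⊗[K] B) ⊗[K] C) :
    sliceR g (sliceR f u) = sliceR g (lTensor A (sliceR f) (TensorProduct.assoc K A B C u)) := by
  induction u with
  | zero => simp
  | tmul v c =>
    induction v with
    | zero => simp
    | tmul v a => simp [smul_smul]
    | add x y hx hy => simp_all [add_tmul]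
  | add x y hx hy => simp [hx, hy]

theorem sliceR_lTensor {A B C : Type*} [AddCommGroup A] [Module K A] [AddCommGroup B] [Module K B]
    [AddCommGroup C] [Module K C] (f : C →ₗ[K] K) (g : B →ₗ[K] C) (u : A ⊗[K] B) :
    sliceR f (lTensor A g u) = sliceR (f ∘ₗ g) u := by
  induction u with
  | zero => simp
  | tmul v c => simp
  | add x y hx hy => simp [hx, hy]

theorem sliceL_rTensor {A B C : Type*} [AddCommGroup A] [Module K A] [AddCommGroup B] [Module K B]
    [AddCommGroup C] [Module K C] (f : C →ₗ[K] K) (g : B →ₗ[K] C) (u : B ⊗[K] A) :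
    sliceL f (rTensor A g u) = sliceL (f ∘ₗ g) u := by
  induction u with
  | zero => simp
  | tmul v c => simp
  | add x y hx hy => simp [hx, hy]

theorem apply_hitR (f g : H →ₗ[K] K) (h : H) : f (hitR g h) = g (hitL f h) := by
  rw [hitR_apply, hitL_apply, map_sliceL, map_sliceR]
  generalize comul (R := K) h = t
  induction t with
  | zero => simp
  | tmul v a => simp [mul_comm]
  | add x y hx hy => simp [hx, hy]

theorem hitL_hitL (f g : H →ₗ[K] K) (h : H) : hitL f (hitL g h) = hitL (convF f g) h := by
  rw [hitL_apply, hitL_apply, hitL_apply, map_sliceR, sliceR_sliceR, Coalgebra.coassoc_apply,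
    sliceR_lTensor, sliceR_lTensor, convF, hitL, LinearMap.comp_assoc]

theorem convF_eq (f g : H →ₗ[K] K) : convF f g = g ∘ₗ hitR f := by
  ext h; simp [convF, apply_hitR]

theorem hitR_hitR (f g : H →ₗ[K] K) (h : H) : hitR f (hitR g h) = hitR (convF g f) h := by
  have key : ∀ u : (H ⊗[K] H) ⊗[K] H, sliceL f (sliceL g (TensorProduct.assoc K H H H u)) =
      sliceL f (rTensor H (sliceL g) u) := by
    intro u
    induction u with
    | zero => simp
    | tmul v c =>
      induction v with
      | zero => simp
      | tmul v a => simp [smul_smul, mul_comm]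
      | add x y hx hy => simp_all [add_tmul]
    | add x y hx hy => simp [hx, hy]
  rw [hitR_apply, hitR_apply, hitR_apply, map_sliceL, ← Coalgebra.coassoc_apply, key,
    sliceL_rTensor, sliceL_rTensor, convF_eq, hitR, LinearMap.comp_assoc]

end Hits

end

section Radford

variable {K H}

theorem comul_antipode_mul_conv : ∀ y : H,
    ∀ {ι : Type*} (r : Coalgebra.Repr K y ι),
    ∑ j ∈ r.index, comul (R := K) (antipode K (r.left j)) * (r.right j ⊗ₜ[K] 1) =
      1 ⊗ₜ antipode K y := by
  intro y ι r
  set i₁ := Algebra.TensorProduct.includeLeft (R := K) (S := K) (A := H) (B := H) with hi₁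
  set i₂ := Algebra.TensorProduct.includeRight (R := K) (A := H) (B := H) with hi₂
  have h1 : toConv i₁.toLinearMap = toConv (comul (R := K) (A := H)) *
      toConv (i₂.toLinearMap ∘ₗ antipode K) := by
    rw [← incl_conv_incl, mul_assoc, algHom_conv_antipode, mul_one]
  have h2 := antipode_conv_algHom (K := K) (H := H) (comulAlgHom K H)
  have h3 : toConv (comul (R := K) ∘ₗ antipode K (A := H)) * toConv i₁.toLinearMap =
      toConv (i₂.toLinearMap ∘ₗ antipode K) := by
    rw [h1, ← mul_assoc]
    exact (congrArg (· * _) h2).trans (one_mul _)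
  have h4 := congrArg (fun f => f.ofConv y) h3
  simp only [r.convMul_apply] at h4
  simpa [hi₁, hi₂] using h4

/-- `Σ (1 ⊗ S(y₍₂₎)) Δ(S²(y₍₁₎)) = S²(y) ⊗ 1`. -/
theorem sum_one_tmul_antipode_mul_comul (y : H) {ι : Type*} (r : Coalgebra.Repr K y ι) :
    ∑ j ∈ r.index, (1 ⊗ₜ[K] antipode K (r.right j)) *
      comul (R := K) (antipode K (antipode K (r.left j))) =
      antipode K (antipode K y) ⊗ₜ[K] 1 := by
  let A : H ⊗[K] H →ₗ[K] H ⊗[K] H :=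
    TensorProduct.map (antipode K) (antipode K) ∘ₗ (TensorProduct.comm K H H).toLinearMap
  have hA : ∀ u v : H ⊗[K] H, A (u * v) = A v * A u := by
    intro u v
    induction u with
    | zero => simp
    | add x y hx hy => simp only [add_mul, mul_add, map_add, hx, hy]
    | tmul a b =>
      induction v with
      | zero => simp
      | add x y hx hy => simp only [add_mul, mul_add, map_add, hx, hy]
      | tmul c d => simp [A, antipode_mul_antidistrib]
  have h := congrArg A (comul_antipode_mul_conv y r)
  simp only [map_sum, hA] at h
  have h5 : ∀ x : H, A (comul (R := K) x) = comul (R := K) (antipode K x) :=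
    fun x => (comul_antipode x).symm
  simpa [h5, A] using h

/-- `y ⊗ 1 = Σ Δ(y₍₁₎) (1 ⊗ S(y₍₂₎))`. -/
theorem tmul_one_eq_sum (y : H) {ι : Type*} (r : Coalgebra.Repr K y ι) :
    y ⊗ₜ[K] (1 : H) = ∑ j ∈ r.index, comul (R := K) (r.left j) * (1 ⊗ₜ antipode K (r.right j)) := by
  set i₁ := Algebra.TensorProduct.includeLeft (R := K) (S := K) (A := H) (B := H) with hi₁
  set i₂ := Algebra.TensorProduct.includeRight (R := K) (A := H) (B := H) with hi₂
  have h1 : toConv i₁.toLinearMap = toConv (comul (R := K) (A := H)) *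
      toConv (i₂.toLinearMap ∘ₗ antipode K) := by
    rw [← incl_conv_incl, mul_assoc, algHom_conv_antipode, mul_one]
  have h4 := congrArg (fun f => f.ofConv y) h1
  simp only [r.convMul_apply] at h4
  simpa [hi₁, hi₂] using h4

variable (K H)

/-- The square of the antipode. -/
noncomputable def sqS : H →ₗ[K] H := antipode K ∘ₗ antipode K

/-- The functional `h ↦ tr (y ↦ S²(y) h)`. -/
noncomputable def trS : H →ₗ[K] K :=
  LinearMap.trace K H ∘ₗ LinearMap.lcomp K H (sqS K H) ∘ₗ (LinearMap.mul K H).flip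

variable {K H}

theorem sqS_mul (a b : H) : sqS K H (a * b) = sqS K H a * sqS K H b := by
  simp [sqS, antipode_mul_antidistrib]

@[simp] theorem sqS_one : sqS K H 1 = 1 := by simp [sqS]

theorem comul_sqS (a : H) :
    comul (R := K) (sqS K H a) = TensorProduct.map (sqS K H) (sqS K H) (comul (R := K) a) := by
  simp only [sqS, LinearMap.comp_apply, comul_antipode]
  generalize comul (R := K) a = t
  induction t with
  | zero => simp
  | tmul v a => simp
  | add x y hx hy => simp only [map_add, hx, hy]

theorem trS_apply (h : H) : trS K H h = LinearMap.trace K H (mulRight K h ∘ₗ sqS K H) := rfl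

theorem trS_one : trS K H 1 = LinearMap.trace K H (sqS K H) := by
  rw [trS_apply]; congr 1; ext; simp

theorem trS_mul (a b : H) : trS K H (a * b) = trS K H (sqS K H b * a) := by
  rw [trS_apply, trS_apply]
  have h1 : mulRight K (a * b) ∘ₗ sqS K H = mulRight K b ∘ₗ (mulRight K a ∘ₗ sqS K H) := by
    ext; simp [mul_assoc]
  have h2 : mulRight K (sqS K H b * a) ∘ₗ sqS K H = (mulRight K a ∘ₗ sqS K H) ∘ₗ mulRight K b := by
    ext; simp [mul_assoc, sqS_mul]
  rw [h1, h2]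
  exact LinearMap.trace_mul_comm K _ _

variable [FiniteDimensional K H]

theorem sum_dual_smul {V W : Type*} [AddCommGroup V] [Module K V] [AddCommGroup W] [Module K W]
    {ι : Type*} [Fintype ι] (b : Module.Basis ι K V) (F : V →ₗ[K] W) (v : V) :
    ∑ i, b.coord i v • F (b i) = F v := by
  simp_rw [← map_smul, ← map_sum]
  congr 1
  exact b.sum_repr v

/-- `Σ T(h₍₁₎) f(h₍₂₎) = T(h) f(1)` for `T = trS`. -/
theorem trS_hitL (f : H →ₗ[K] K) (h : H) : trS K H (hitL f h) = trS K H h * f 1 := by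
  let b := Module.finBasis K H
  have h1 : mulRight K (hitL f h) ∘ₗ sqS K H =
      ∑ i, hitL (f ∘ₗ mulLeft K (antipode K (b i))) ∘ₗ
        ((mulRight K h ∘ₗ sqS K H) ∘ₗ hitL (b.coord i)) := by
    ext y
    let r := ℛ K y
    have e1 : ∀ i, hitL (b.coord i) y = ∑ j ∈ r.index, b.coord i (r.right j) • r.left j := by
      intro i
      rw [hitL_apply, ← r.eq]; simp
    let F : H → (H →ₗ[K] H) := fun z =>
      { toFun := fun v => sliceR f ((1 ⊗ₜ antipode K v) * comul (R := K) z)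
        map_add' := fun u v => by simp [tmul_add, add_mul]
        map_smul' := fun c v => by simp }
    have e2 : ∀ (i) (z : H), hitL (f ∘ₗ mulLeft K (antipode K (b i))) z = F z (b i) := by
      intro i z
      simp [F, hitL_apply, sliceR_one_tmul_mul]
    simp only [LinearMap.coe_sum, Finset.sum_apply, LinearMap.comp_apply, e2, e1, map_sum, map_smul]
    have e3 : ∀ z, F z =
      sliceR f ∘ₗ (LinearMap.mul K (H ⊗[K] H)).flip (comul (R := K) z) ∘ₗ
        (TensorProduct.mk K H H 1) ∘ₗ antipode K := by
      intro z; ext v; simp [F]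
    have e4 : ∀ i, F (∑ j ∈ r.index, b.coord i (r.right j) • (mulRight K h) (sqS K H (r.left j))) (b i) =
        ∑ j ∈ r.index, b.coord i (r.right j) • F (mulRight K h (sqS K H (r.left j))) (b i) := by
      intro i
      simp only [e3]
      simp only [LinearMap.comp_apply, map_sum, map_smul, LinearMap.sum_apply, LinearMap.smul_apply]
    simp only [e4]
    rw [Finset.sum_comm]
    simp only [sum_dual_smul]
    have e5 := sum_one_tmul_antipode_mul_comul y r
    have e6 := congrArg (fun t => sliceR f (t * comul (R := K) h)) e5
    simp only [sliceR_mul_left, Finset.sum_mul, map_sum] at e6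
    rw [mulRight_apply]
    refine e6.symm.trans (Finset.sum_congr rfl fun j _ => ?_)
    simp [F, mul_assoc, sqS]
  have h2 : ∑ i, (mulRight K h ∘ₗ sqS K H) ∘ₗ (hitL (b.coord i) ∘ₗ
      hitL (f ∘ₗ mulLeft K (antipode K (b i)))) = f 1 • (mulRight K h ∘ₗ sqS K H) := by
    have e1 : ∀ u, ∑ i, convF (b.coord i) (f ∘ₗ mulLeft K (antipode K (b i))) u =
        counit (R := K) u * f 1 := by
      intro u
      let r := ℛ K u
      have e2 : ∀ i, convF (b.coord i) (f ∘ₗ mulLeft K (antipode K (b i))) u =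
          ∑ j ∈ r.index, b.coord i (r.left j) • f (antipode K (b i) * r.right j) := by
        intro i
        rw [convF, LinearMap.comp_apply, hitL_apply, ← r.eq]
        simp [mul_comm]
      simp only [e2]
      rw [Finset.sum_comm]
      have e3 : ∀ j, ∑ i, b.coord i (r.left j) • f (antipode K (b i) * r.right j) =
          f (antipode K (r.left j) * r.right j) := by
        intro j
        exact sum_dual_smul b (f ∘ₗ mulRight K (r.right j) ∘ₗ antipode K) (r.left j)
      simp only [e3]
      rw [← map_sum, sum_antipode_mul_eq_smul r, map_smul, smul_eq_mul]
    ext y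
    simp only [LinearMap.coe_sum, Finset.sum_apply, LinearMap.comp_apply, hitL_hitL,
      LinearMap.smul_apply]
    rw [← map_sum, ← map_sum, ← map_smul, ← map_smul]
    congr 2
    have e4 := sliceR_sum (A := H) (fun i => convF (b.coord i) (f ∘ₗ mulLeft K (antipode K (b i))))
      (comul (R := K) y)
    simp only [hitL_apply]
    rw [← e4]
    have e5 : ∑ i, convF (b.coord i) (f ∘ₗ mulLeft K (antipode K (b i))) =
        f 1 • counit (R := K) (A := H) := by
      ext u; rw [LinearMap.sum_apply, e1]; simp [mul_comm]
    rw [e5]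
    have := congrArg (fun g => f 1 • g y) (hitL_counit (K := K) (H := H))
    simp only [hitL_apply, LinearMap.id_apply] at this
    rw [← this, sliceR_smul]
  rw [trS_apply, h1, map_sum, trS_apply, mul_comm, ← smul_eq_mul, ← map_smul, ← h2, map_sum]
  refine Finset.sum_congr rfl fun i _ => ?_
  exact LinearMap.trace_mul_comm K _ ((mulRight K h ∘ₗ sqS K H) ∘ₗ hitL (b.coord i))

theorem eq_of_dual_eq {V : Type*} [AddCommGroup V] [Module K V] {x y : V}
    (hxy : ∀ f : V →ₗ[K] K, f x = f y) : x = y := by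
  rw [← sub_eq_zero, ← Module.forall_dual_apply_eq_zero_iff K]
  intro f
  rw [map_sub, hxy, sub_self]

/-- `Σ T(h₍₁₎) h₍₂₎ = T(h) 1` for `T = trS`. -/
theorem hitR_trS (h : H) : hitR (trS K H) h = trS K H h • 1 := by
  apply eq_of_dual_eq (K := K)
  intro f
  rw [apply_hitR, trS_hitL, map_smul, smul_eq_mul]

omit [FiniteDimensional K H] in
theorem exists_left_integral (hss : IsSemisimpleRing H) :
    ∃ Λ : H, (∀ h : H, h * Λ = counit (R := K) h • Λ) ∧ counit (R := K) Λ = 1 := by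
  let I : Submodule H H := RingHom.ker (counitAlgHom K H)
  obtain ⟨J, hJ⟩ := exists_isCompl I
  obtain ⟨i, hi, j, hj, hij⟩ := Submodule.mem_sup.1
    (show (1 : H) ∈ I ⊔ J by rw [hJ.sup_eq_top]; trivial)
  have hi' : counit (R := K) i = 0 := hi
  have hcj : counit (R := K) j = 1 := by
    have := congrArg (counit (R := K)) hij
    simpa [hi'] using this
  refine ⟨j, fun h => ?_, hcj⟩
  rw [← sub_eq_zero]
  have h1 : h * j - counit (R := K) h • j ∈ J := by
    refine J.sub_mem (J.smul_mem h hj) ?_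
    rw [Algebra.smul_def]
    exact J.smul_mem _ hj
  have h2 : h * j - counit (R := K) h • j ∈ I := by
    change counit (R := K) (h * j - counit (R := K) h • j) = 0
    simp [hcj]
  have := hJ.disjoint.le_bot ⟨h2, h1⟩
  simpa using this

section Integral

variable {Λ : H} (hΛ : ∀ h : H, h * Λ = counit (R := K) h • Λ) (hε : counit (R := K) Λ = 1)

include hΛ hε

theorem trS_integral : trS K H Λ = 1 := by
  rw [trS_apply]
  have : mulRight K Λ ∘ₗ sqS K H = (counit (R := K) (A := H)).smulRight Λ := by
    ext h; simp [hΛ, sqS]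
  rw [this]
  simpa using hε

omit hΛ hε [FiniteDimensional K H] in
/-- Twisting an identity `Σ τ(h₍₁₎) h₍₂₎ = τ(h) 1` by right multiplication. -/
theorem hitR_comp_mulRight {τ : H →ₗ[K] K} (hτ : ∀ h, hitR τ h = τ h • 1) (h y : H) :
    hitR (τ ∘ₗ mulRight K y) h =
      antipode K (sliceL (τ ∘ₗ mulLeft K h) (comul (R := K) y)) := by
  let r := ℛ K y
  have e1 := congrArg (fun t => sliceL τ (comul (R := K) h * t)) (tmul_one_eq_sum y r)
  simp only [sliceL_mul_tmul_one, Finset.mul_sum, ← mul_assoc, sliceL_mul_right, map_sum] at e1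
  rw [hitR_apply, e1, ← r.eq]
  simp only [map_sum, sliceL_tmul, map_smul]
  refine Finset.sum_congr rfl fun j _ => ?_
  rw [← Bialgebra.comul_mul, ← hitR_apply, hτ]
  simp

omit hε [FiniteDimensional K H] in
theorem smul_eq_antipode_slice {τ : H →ₗ[K] K} (hτ : ∀ h, hitR τ h = τ h • 1) (h : H) :
    τ Λ • h = antipode K (sliceL (τ ∘ₗ mulLeft K h) (comul (R := K) Λ)) := by
  rw [← hitR_comp_mulRight hτ]
  have : τ ∘ₗ mulRight K Λ = τ Λ • counit (R := K) := by
    ext x; simp [hΛ, mul_comm]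
  rw [this, hitR_apply, sliceL_smul, ← hitR_apply]
  simp

theorem antipode_surjective : Function.Surjective (antipode K (A := H)) := fun h =>
  ⟨_, by rw [← smul_eq_antipode_slice hΛ hitR_trS h, trS_integral hΛ hε, one_smul]⟩

theorem antipode_bijective : Function.Bijective (antipode K (A := H)) :=
  ⟨LinearMap.injective_iff_surjective.2 (antipode_surjective hΛ hε), antipode_surjective hΛ hε⟩

theorem trS_nondegenerate {h : H} (hh : ∀ x, trS K H (h * x) = 0) : h = 0 := by
  have h1 := smul_eq_antipode_slice hΛ hitR_trS h
  have : trS K H ∘ₗ mulLeft K h = 0 := by ext x; simp [hh]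
  rw [this, trS_integral hΛ hε, one_smul] at h1
  rw [h1]
  have : ∀ t : H ⊗[K] H, sliceL (0 : H →ₗ[K] K) t = 0 := by
    intro t
    rw [← zero_smul K (0 : H →ₗ[K] K), sliceL_smul, zero_smul]
  rw [this, map_zero]

theorem antipode_integral : antipode K Λ = Λ := by
  have h1 : ∀ h, antipode K Λ * h = counit (R := K) h • antipode K Λ := by
    intro h
    obtain ⟨h, rfl⟩ := antipode_surjective hΛ hε h
    rw [← antipode_mul_antidistrib, hΛ]
    simp
  have h2 := h1 Λ
  rw [hΛ, counit_antipode, hε, one_smul, one_smul] at h2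
  exact h2.symm

theorem integral_mul (h : H) : Λ * h = counit (R := K) h • Λ := by
  obtain ⟨h, rfl⟩ := antipode_surjective hΛ hε h
  conv_lhs => rw [← antipode_integral hΛ hε, ← antipode_mul_antidistrib, hΛ]
  simp [antipode_integral hΛ hε]

end Integral
end Radford

section RadfordFormula

variable {K H}

theorem apply_sliceL {V A : Type*} [AddCommGroup V] [Module K V] [AddCommGroup A] [Module K A]
    (f : A →ₗ[K] K) (g : V →ₗ[K] K) (t : V ⊗[K] A) : f (sliceL g t) = g (sliceR f t) := by
  induction t with
  | zero => simp
  | tmul v a => simp [mul_comm]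
  | add x y hx hy => simp [hx, hy]

theorem antipode_hitL (f : H →ₗ[K] K) (h : H) :
    antipode K (hitL (f ∘ₗ antipode K) h) = hitR f (antipode K h) := by
  rw [hitL_apply, hitR_apply, comul_antipode]
  generalize comul (R := K) h = t
  induction t with
  | zero => simp
  | tmul v a => simp
  | add x y hx hy => simp only [map_add, hx, hy]

theorem antipode_hitR (f : H →ₗ[K] K) (h : H) :
    antipode K (hitR (f ∘ₗ antipode K) h) = hitL f (antipode K h) := by
  rw [hitL_apply, hitR_apply, comul_antipode]
  generalize comul (R := K) h = t
  induction t with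
  | zero => simp
  | tmul v a => simp
  | add x y hx hy => simp only [map_add, hx, hy]

variable [FiniteDimensional K H] {Λ : H} (hΛ : ∀ h : H, h * Λ = counit (R := K) h • Λ)
  (hε : counit (R := K) Λ = 1)

include hΛ hε

theorem hitL_antipode {τ : H →ₗ[K] K} (hτ : ∀ h, hitR τ h = τ h • 1) (h : H) :
    hitL (τ ∘ₗ antipode K) h = τ (antipode K h) • 1 := by
  apply (antipode_bijective hΛ hε).1
  rw [antipode_hitL, hτ]
  simp

theorem hitR_antipode {τ : H →ₗ[K] K} (hτ : ∀ h, hitL τ h = τ h • 1) (h : H) :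
    hitR (τ ∘ₗ antipode K) h = τ (antipode K h) • 1 := by
  apply (antipode_bijective hΛ hε).1
  rw [antipode_hitR, hτ]
  simp

theorem eq_smul_trS {τ : H →ₗ[K] K} (hτ : ∀ h, hitR τ h = τ h • 1) : τ = τ Λ • trS K H := by
  ext h
  have h1 := congrArg (trS K H) (smul_eq_antipode_slice hΛ hτ h)
  have h2 := apply_sliceL (trS K H ∘ₗ antipode K) (τ ∘ₗ mulLeft K h) (comul (R := K) Λ)
  rw [← hitL_apply, hitL_antipode hΛ hε hitR_trS, antipode_integral hΛ hε, trS_integral hΛ hε] at h2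
  simp only [LinearMap.comp_apply, one_smul, mulLeft_apply, mul_one] at h2
  rw [h2, map_smul] at h1
  simpa using h1.symm

theorem hitL_trS (h : H) : hitL (trS K H) h = trS K H h • hitL (trS K H) Λ := by
  apply eq_of_dual_eq (K := K)
  intro f
  have h1 : ∀ x, hitR (convF f (trS K H)) x = convF f (trS K H) x • 1 := by
    intro x
    rw [← hitR_hitR, hitR_trS, convF_eq]
    rfl
  have h2 := LinearMap.congr_fun (eq_smul_trS hΛ hε h1) h
  simp only [convF, LinearMap.comp_apply, LinearMap.smul_apply] at h2
  rw [h2, map_smul, smul_eq_mul, smul_eq_mul, mul_comm]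

theorem isGroupLikeElem_hitL_trS : IsGroupLikeElem K (hitL (trS K H) Λ) where
  counit_eq_one := by
    rw [← LinearMap.comp_apply]
    change convF counit (trS K H) Λ = 1
    rw [convF_eq]
    simpa using trS_integral hΛ hε
  comul_eq_tmul_self := by
    have key : ∀ u : (H ⊗[K] H) ⊗[K] H, sliceR (trS K H) u =
        lTensor H (sliceR (trS K H)) (TensorProduct.assoc K H H H u) := by
      intro u
      induction u with
      | zero => simp
      | tmul v c =>
        induction v with
        | zero => simp
        | tmul v a => simp
        | add x y hx hy => simp_all [add_tmul]
      | add x y hx hy => simp [hx, hy]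
    conv_lhs => rw [hitL_apply, map_sliceR, key, Coalgebra.coassoc_apply]
    rw [← LinearMap.comp_apply, ← LinearMap.lTensor_comp]
    change lTensor H (hitL (trS K H)) (comul (R := K) Λ) = _
    have key2 : ∀ u : H ⊗[K] H, lTensor H (hitL (trS K H)) u =
        sliceR (trS K H) u ⊗ₜ hitL (trS K H) Λ := by
      intro u
      induction u with
      | zero => simp
      | tmul v a => rw [lTensor_tmul, hitL_trS hΛ hε]; simp [smul_tmul]
      | add x y hx hy => simp only [map_add, hx, hy, add_tmul]
    rw [key2, ← hitL_apply]

theorem trS_antipode_mul (h : H) :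
    trS K H (antipode K h * hitL (trS K H) Λ) = trS K H h := by
  set g := hitL (trS K H) Λ with hg
  have hgl : IsGroupLikeElem K g := isGroupLikeElem_hitL_trS hΛ hε
  have h1 : ∀ x, hitL (trS K H ∘ₗ mulRight K g) x = (trS K H ∘ₗ mulRight K g) x • 1 := by
    intro x
    have e : comul (R := K) x * (1 ⊗ₜ g) = comul (R := K) (x * g) * (antipode K g ⊗ₜ 1) := by
      rw [Bialgebra.comul_mul, hgl.comul_eq_tmul_self, mul_assoc]
      simp [hgl.mul_antipode_cancel]
    rw [hitL_apply, ← sliceR_mul_one_tmul, e, sliceR_mul_right, ← hitL_apply, hitL_trS hΛ hε,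
      ← hg]
    simp [hgl.mul_antipode_cancel]
  have h2 := eq_smul_trS hΛ hε (hitR_antipode hΛ hε h1)
  have h3 := LinearMap.congr_fun h2 h
  simpa [antipode_integral hΛ hε, integral_mul hΛ hε, hgl.counit_eq_one, trS_integral hΛ hε]
    using h3

theorem sqS_sqS_mul (c : H) :
    sqS K H (sqS K H c) * hitL (trS K H) Λ = hitL (trS K H) Λ * c := by
  set g := hitL (trS K H) Λ with hg
  rw [← sub_eq_zero]
  set z := sqS K H (sqS K H c) * g - g * c with hz
  have hbij := antipode_bijective hΛ hε
  have h1 : ∀ x, trS K H (x * z) = 0 := by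
    intro x
    obtain ⟨a, rfl⟩ := hbij.2 x
    have e1 : trS K H (antipode K a * g * c) = trS K H (a * antipode K c) := by
      rw [trS_mul, ← trS_antipode_mul hΛ hε (a * antipode K c), antipode_mul_antidistrib,
        ← hg, mul_assoc]
      rfl
    have e2 : trS K H (antipode K a * (sqS K H (sqS K H c) * g)) = trS K H (a * antipode K c) := by
      rw [trS_mul a, ← trS_antipode_mul hΛ hε (sqS K H (antipode K c) * a),
        antipode_mul_antidistrib, ← hg, mul_assoc]
      rfl
    rw [hz, mul_sub, map_sub, e2, ← mul_assoc, e1, sub_self]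
  have h2 : sqS K H z = 0 := trS_nondegenerate hΛ hε fun x => by rw [← trS_mul, h1]
  exact (map_eq_zero_iff _ hbij.1).1 ((map_eq_zero_iff _ hbij.1).1 h2)

theorem exists_pow_hitL_trS_eq_one : ∃ m : ℕ, 0 < m ∧ hitL (trS K H) Λ ^ m = 1 := by
  have hfin : Finite (GroupLike K H) := by
    have := linearIndep_groupLikeVal (R := K) (A := H)
    exact this.finite
  let g : GroupLike K H := ⟨hitL (trS K H) Λ, isGroupLikeElem_hitL_trS hΛ hε⟩
  obtain ⟨m, hm, h⟩ := isOfFinOrder_iff_pow_eq_one.1 (isOfFinOrder_of_finite g)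
  refine ⟨m, hm, ?_⟩
  have := congrArg GroupLike.val h
  simpa [g] using this

theorem exists_sqS_pow_eq_one : ∃ m : ℕ, 0 < m ∧ sqS K H ^ m = 1 := by
  obtain ⟨m, hm, h⟩ := exists_pow_hitL_trS_eq_one hΛ hε
  set g := hitL (trS K H) Λ with hg
  refine ⟨2 * m, by omega, ?_⟩
  have h1 : ∀ (k : ℕ) (c : H), (sqS K H ^ (2 * k)) c * g ^ k = g ^ k * c := by
    intro k
    induction k with
    | zero => simp
    | succ k ih =>
      intro c
      have e : (sqS K H ^ (2 * (k + 1))) c = (sqS K H ^ (2 * k)) (sqS K H (sqS K H c)) := by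
        rw [mul_add, pow_add]; rfl
      rw [e, pow_succ g k, ← mul_assoc, ih, mul_assoc, sqS_sqS_mul hΛ hε, mul_assoc]
  ext c
  have := h1 m c
  simpa [h] using this

end RadfordFormula

section RootsOfUnity

variable {K} [IsAlgClosed K]
open Module.End Polynomial
open scoped Classical

theorem trace_pow_eq_sum_roots {V : Type*} [AddCommGroup V] [Module K V] [FiniteDimensional K V]
    {A : Module.End K V} {p : K[X]} (hp : Squarefree p) (hA : aeval A p = 0) (k : ℕ) :
    LinearMap.trace K V (A ^ k) =
      ∑ μ ∈ p.roots.toFinset, (Module.finrank K (A.eigenspace μ) : K) * μ ^ k := by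
  have hss := isSemisimple_of_squarefree_aeval_eq_zero hp hA
  have hint := DirectSum.isInternal_submodule_of_iSupIndep_of_iSup_eq_top
    A.eigenspaces_iSupIndep hss.iSup_eigenspace_eq_top
  have hN : {μ | A.eigenspace μ ≠ ⊥}.Finite :=
    WellFoundedGT.finite_ne_bot_of_iSupIndep A.eigenspaces_iSupIndep
  have hpow : ∀ (μ : K) (v : V), v ∈ A.eigenspace μ → (A ^ k) v = μ ^ k • v := by
    intro μ v hv
    induction k with
    | zero => simp
    | succ k ih => rw [pow_succ, Module.End.mul_apply, mem_eigenspace_iff.1 hv, map_smul, ih,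
        smul_smul, pow_succ, mul_comm]
  have hmaps : ∀ μ, Set.MapsTo (A ^ k) (A.eigenspace μ) (A.eigenspace μ) := fun μ v hv => by
    rw [hpow μ v hv]
    exact Submodule.smul_mem _ _ hv
  rw [LinearMap.trace_eq_sum_trace_restrict' hint hN hmaps]
  have hsub : hN.toFinset ⊆ p.roots.toFinset := by
    intro μ hμ
    simp only [Set.Finite.mem_toFinset, Set.mem_ofPred_eq] at hμ
    rw [Multiset.mem_toFinset, mem_roots hp.ne_zero]
    obtain ⟨v, hv, hv0⟩ := (Submodule.ne_bot_iff _).1 hμ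
    have h1 := aeval_apply_of_hasEigenvector (p := p) ⟨hv, hv0⟩
    rw [hA, LinearMap.zero_apply] at h1
    exact (smul_eq_zero.1 h1.symm).resolve_right hv0
  rw [← Finset.sum_subset hsub]
  · refine Finset.sum_congr rfl fun μ _ => ?_
    have : (A ^ k).restrict (hmaps μ) = μ ^ k • LinearMap.id := by
      ext v
      exact hpow μ v v.2
    rw [this, map_smul, LinearMap.trace_id, smul_eq_mul, mul_comm]
  · intro μ _ hμ
    simp only [Set.Finite.mem_toFinset, Set.mem_ofPred_eq, not_not] at hμ
    rw [hμ]
    simp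

variable [CharZero K]

theorem squarefree_X_pow_sub_one {M : ℕ} (hM : 0 < M) : Squarefree (X ^ M - 1 : K[X]) :=
  (X_pow_sub_one_separable_iff.2 (by exact_mod_cast hM.ne')).squarefree

theorem trace_pow_of_pow_eq_one {V : Type*} [AddCommGroup V] [Module K V] [FiniteDimensional K V]
    {A : Module.End K V} {M : ℕ} (hM : 0 < M) (hA : A ^ M = 1) (k : ℕ) :
    LinearMap.trace K V (A ^ k) =
      ∑ μ ∈ (X ^ M - 1 : K[X]).roots.toFinset,
        (Module.finrank K (A.eigenspace μ) : K) * μ ^ k :=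
  trace_pow_eq_sum_roots (squarefree_X_pow_sub_one hM) (by simp [hA]) k

theorem pow_eq_one_of_mem_roots {M : ℕ} {μ : K} (h : μ ∈ (X ^ M - 1 : K[X]).roots.toFinset) :
    μ ^ M = 1 := by
  have := isRoot_of_mem_roots (Multiset.mem_toFinset.1 h)
  simpa [sub_eq_zero] using this

theorem isIntegral_trace_of_pow_succ_eq {V : Type*} [AddCommGroup V] [Module K V]
    [FiniteDimensional K V] {A : Module.End K V} {N : ℕ} (hN : 0 < N) (hA : A ^ (N + 1) = A) :
    IsIntegral ℤ (LinearMap.trace K V A) := by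
  have hsq : Squarefree (X * (X ^ N - 1) : K[X]) := by
    rw [squarefree_mul_iff]
    refine ⟨?_, irreducible_X.squarefree, squarefree_X_pow_sub_one hN⟩
    apply IsCoprime.isRelPrime
    refine ⟨X ^ (N - 1), -1, ?_⟩
    rw [← pow_succ, Nat.sub_add_cancel hN]
    ring
  have h := trace_pow_eq_sum_roots hsq (A := A) (by simp [mul_sub, ← pow_succ', hA]) 1
  rw [pow_one] at h
  rw [h]
  refine IsIntegral.sum _ fun μ hμ => ?_
  have hroot := isRoot_of_mem_roots (Multiset.mem_toFinset.1 hμ)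
  have hμ : μ = 0 ∨ μ ^ N = 1 := by simpa [sub_eq_zero] using hroot
  have hm : IsIntegral ℤ (Module.finrank K (A.eigenspace μ) : K) := by
    simpa using isIntegral_algebraMap (R := ℤ) (A := K)
      (x := (Module.finrank K (A.eigenspace μ) : ℤ))
  refine hm.mul ?_
  rw [pow_one]
  rcases hμ with rfl | hμ
  · exact isIntegral_zero
  · exact IsIntegral.of_pow hN (hμ ▸ isIntegral_one)

variable (K) in
/-- The number field generated by the `M`-th roots of unity. -/
noncomputable def rootField (M : ℕ) : IntermediateField ℚ K :=
  IntermediateField.adjoin ℚ {μ : K | μ ^ M = 1}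

theorem numberField_rootField {M : ℕ} (hM : 0 < M) : NumberField (rootField K M) where
  to_charZero := inferInstance
  to_finiteDimensional := by
    have : Finite {μ : K | μ ^ M = 1} := by
      have h : {μ : K | μ ^ M = 1} ⊆ (X ^ M - 1 : K[X]).roots.toFinset := by
        intro μ hμ
        simp only [Finset.mem_coe, Multiset.mem_toFinset]
        rw [mem_roots (squarefree_X_pow_sub_one hM).ne_zero]
        simpa [sub_eq_zero] using hμ
      exact ((Finset.finite_toSet _).subset h).to_subtype
    refine IntermediateField.finiteDimensional_adjoin fun μ hμ => ?_
    have hμ' : μ ^ M = 1 := hμ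
    exact IsIntegral.of_pow hM (hμ' ▸ isIntegral_one)

theorem mem_rootField {M : ℕ} {μ : K} (h : μ ^ M = 1) : μ ∈ rootField K M :=
  IntermediateField.subset_adjoin _ _ h

theorem norm_rootField {M : ℕ} (hM : 0 < M) (ψ : rootField K M →+* ℂ) {μ : K} (h : μ ^ M = 1) :
    ‖ψ ⟨μ, mem_rootField h⟩‖ = 1 := by
  have : (ψ ⟨μ, mem_rootField h⟩) ^ M = 1 := by
    rw [← map_pow, ← map_one ψ]
    congr 1
    ext
    simpa using h
  exact Complex.norm_eq_one_of_pow_eq_one this hM.ne'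

theorem trace_eq_zero_of_sum_eq_zero {ι : Type*} [Fintype ι] {V : ι → Type*}
    [∀ i, AddCommGroup (V i)] [∀ i, Module K (V i)] [∀ i, FiniteDimensional K (V i)]
    {A : ∀ i, Module.End K (V i)} {M : ℕ} (hM : 0 < M) (hA : ∀ i, A i ^ M = 1)
    (hs : ∑ i, LinearMap.trace K (V i) (A i) * LinearMap.trace K (V i) (A i ^ (M - 1)) = 0)
    (i : ι) : LinearMap.trace K (V i) (A i ^ (M - 1)) = 0 := by
  have := numberField_rootField (K := K) hM
  obtain ⟨ψ⟩ : Nonempty (rootField K M →+* ℂ) := inferInstance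
  let s := (X ^ M - 1 : K[X]).roots.toFinset
  let z : ∀ k : ℕ, ι → rootField K M := fun k i =>
    ∑ μ : s, (Module.finrank K ((A i).eigenspace (μ : K)) : rootField K M) *
      (⟨μ, mem_rootField (pow_eq_one_of_mem_roots μ.2)⟩ : rootField K M) ^ k
  have hz : ∀ k i, LinearMap.trace K (V i) (A i ^ k) = (z k i : K) := by
    intro k i
    rw [trace_pow_of_pow_eq_one hM (hA i), ← Finset.sum_coe_sort]
    simp [z, s]
  have hconj : ∀ i, ψ (z (M - 1) i) = starRingEnd ℂ (ψ (z 1 i)) := by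
    intro i
    simp only [z, map_sum, map_mul, map_natCast, map_pow, pow_one]
    refine Finset.sum_congr rfl fun μ _ => ?_
    congr 1
    set w := ψ ⟨μ, mem_rootField (pow_eq_one_of_mem_roots μ.2)⟩ with hw
    have h1 : ‖w‖ = 1 := norm_rootField hM ψ (pow_eq_one_of_mem_roots μ.2)
    have h2 : w * w ^ (M - 1) = 1 := by
      rw [← pow_succ', Nat.sub_add_cancel hM, hw, ← map_pow, ← map_one ψ]
      congr 1
      ext
      simpa using pow_eq_one_of_mem_roots μ.2
    have h3 : w * starRingEnd ℂ w = 1 := by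
      rw [Complex.mul_conj, Complex.normSq_eq_norm_sq, h1]; simp
    have h0 : w ≠ 0 := by intro h; rw [h] at h1; simp at h1
    exact mul_left_cancel₀ h0 (h2.trans h3.symm)
  have h1 : ∑ i, z 1 i * z (M - 1) i = 0 := by
    apply Subtype.ext
    simpa [← hz] using hs
  have h2 : ∑ i, Complex.normSq (ψ (z 1 i)) = 0 := by
    have := congrArg ψ h1
    simp only [map_sum, map_mul, hconj, Complex.mul_conj, map_zero] at this
    exact_mod_cast this
  have h3 := (Finset.sum_eq_zero_iff_of_nonneg (fun i _ => Complex.normSq_nonneg _)).1 h2 i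
    (Finset.mem_univ i)
  have h4 : ψ (z (M - 1) i) = 0 := by rw [hconj, Complex.normSq_eq_zero.1 h3, map_zero]
  rw [hz, (map_eq_zero ψ).1 h4]
  rfl

theorem eq_one_of_isIntegral_trace {V : Type*} [AddCommGroup V] [Module K V]
    [FiniteDimensional K V] {A : Module.End K V} {M : ℕ} (hM : 0 < M) (hA : A ^ M = 1)
    (h0 : LinearMap.trace K V A ≠ 0)
    (hint : IsIntegral ℤ (LinearMap.trace K V A / (Module.finrank K V : K)))
    {v : V} (hv : v ≠ 0) (hAv : A v = v) : A = 1 := by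
  have := numberField_rootField (K := K) hM
  obtain ⟨ψ⟩ : Nonempty (rootField K M →+* ℂ) := inferInstance
  let s := (X ^ M - 1 : K[X]).roots.toFinset
  let m : s → ℕ := fun μ => Module.finrank K (A.eigenspace (μ : K))
  let w : s → rootField K M := fun μ => ⟨μ, mem_rootField (pow_eq_one_of_mem_roots μ.2)⟩
  let n := Module.finrank K V
  have hn : 0 < n := Module.finrank_pos_iff_exists_ne_zero.2 ⟨v, hv⟩
  let x : rootField K M := (∑ μ, (m μ : rootField K M) * w μ) / (n : rootField K M)
  have hx : (x : K) = LinearMap.trace K V A / (n : K) := by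
    have := trace_pow_of_pow_eq_one hM hA 1
    rw [pow_one, ← Finset.sum_coe_sort] at this
    rw [this]
    simp [x, m, w, s]
  have hsum : ∑ μ, m μ = n := by
    have := trace_pow_of_pow_eq_one hM hA 0
    rw [pow_zero, LinearMap.trace_one, ← Finset.sum_coe_sort] at this
    simp only [pow_zero, mul_one] at this
    exact_mod_cast this.symm
  have hx0 : x ≠ 0 := by
    intro h
    rw [h] at hx
    have : LinearMap.trace K V A / (n : K) ≠ 0 := div_ne_zero h0 (by exact_mod_cast hn.ne')
    exact this hx.symm
  have hxi : IsIntegral ℤ x := by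
    rw [← isIntegral_algebraMap_iff (algebraMap (rootField K M) K).injective]
    change IsIntegral ℤ (x : K)
    rw [hx]
    exact hint
  have hw : ∀ (φ : rootField K M →+* ℂ) μ, ‖φ (w μ)‖ = 1 := fun φ μ =>
    norm_rootField hM φ (pow_eq_one_of_mem_roots μ.2)
  have hle : ∀ φ : rootField K M →+* ℂ, ‖φ x‖ ≤ 1 := by
    intro φ
    simp only [x, map_div₀, map_sum, map_mul, map_natCast, norm_div, Complex.norm_natCast]
    rw [div_le_one (by exact_mod_cast hn)]
    refine (norm_sum_le _ _).trans (le_of_eq ?_)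
    simp only [norm_mul, Complex.norm_natCast, hw, mul_one]
    exact_mod_cast hsum
  obtain ⟨k, hk, hxk⟩ := NumberField.Embeddings.pow_eq_one_of_norm_le_one _ ℂ hx0 hxi hle
  set u := ψ x with hu
  have hu1 : ‖u‖ = 1 := Complex.norm_eq_one_of_pow_eq_one (n := k)
    (by rw [hu, ← map_pow, hxk, map_one]) hk.ne'
  have huu : starRingEnd ℂ u * u = 1 := by
    rw [mul_comm, Complex.mul_conj, Complex.normSq_eq_norm_sq, hu1]; simp
  have hnorm : ∀ μ, ‖starRingEnd ℂ u * ψ (w μ)‖ = 1 := fun μ => by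
    rw [norm_mul, hw, Complex.norm_conj, hu1, one_mul]
  have hre : ∑ μ, (m μ : ℝ) * (1 - (starRingEnd ℂ u * ψ (w μ)).re) = 0 := by
    have h1 : ∑ μ, (m μ : ℂ) * ψ (w μ) = n * u := by
      have hn' : (n : ℂ) ≠ 0 := by exact_mod_cast hn.ne'
      rw [hu]
      simp only [x, map_div₀, map_sum, map_mul, map_natCast]
      field_simp
    have h2 : ∑ μ, (m μ : ℂ) * (starRingEnd ℂ u * ψ (w μ)) = n := by
      simp only [mul_left_comm _ (starRingEnd ℂ u), ← Finset.mul_sum, h1]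
      rw [mul_left_comm, huu, mul_one]
    have h3 := congrArg Complex.re h2
    simp only [Complex.re_sum, Complex.natCast_re, Complex.mul_re (Nat.cast _),
      Complex.natCast_im, zero_mul, sub_zero] at h3
    simp only [mul_sub, Finset.sum_sub_distrib, mul_one, h3]
    rw [sub_eq_zero]
    exact_mod_cast hsum
  have hterm := (Finset.sum_eq_zero_iff_of_nonneg (fun μ _ => mul_nonneg (Nat.cast_nonneg _)
    (sub_nonneg.2 ((Complex.re_le_norm _).trans (hnorm μ).le)))).1 hre
  have heq : ∀ μ, m μ ≠ 0 → ψ (w μ) = u := by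
    intro μ hμ
    have h1 : (starRingEnd ℂ u * ψ (w μ)).re = 1 := by
      have := (mul_eq_zero.1 (hterm μ (Finset.mem_univ _))).resolve_left (by exact_mod_cast hμ)
      linarith
    have h2 : starRingEnd ℂ u * ψ (w μ) = 1 := by
      have h3 := Complex.normSq_eq_norm_sq (starRingEnd ℂ u * ψ (w μ))
      rw [hnorm, Complex.normSq_apply, h1] at h3
      apply Complex.ext
      · simpa using h1
      · have : (starRingEnd ℂ u * ψ (w μ)).im * (starRingEnd ℂ u * ψ (w μ)).im = 0 := by linarith
        simpa using mul_self_eq_zero.1 this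
    have h0 : starRingEnd ℂ u ≠ 0 := by
      intro h
      rw [h, zero_mul] at huu
      exact zero_ne_one huu
    exact mul_left_cancel₀ h0 (h2.trans huu.symm)
  have hmem : ∀ μ : K, A.eigenspace μ ≠ ⊥ → μ ^ M = 1 := by
    intro μ hμ
    obtain ⟨y, hy, hy0⟩ := (Submodule.ne_bot_iff _).1 hμ
    have h1 := aeval_apply_of_hasEigenvector (p := (X ^ M - 1 : K[X])) ⟨hy, hy0⟩
    simp only [map_sub, map_pow, aeval_X, map_one, hA, sub_self, LinearMap.zero_apply] at h1
    have := (smul_eq_zero.1 h1.symm).resolve_right hy0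
    simpa [sub_eq_zero] using this
  have hroots : ∀ μ : K, A.eigenspace μ ≠ ⊥ → μ ∈ s := fun μ hμ => by
    rw [Multiset.mem_toFinset, mem_roots (squarefree_X_pow_sub_one hM).ne_zero]
    simpa [sub_eq_zero] using hmem μ hμ
  have hm : ∀ (μ : K) (h : A.eigenspace μ ≠ ⊥), m ⟨μ, hroots μ h⟩ ≠ 0 := fun μ h h' =>
    h (Submodule.finrank_eq_zero.1 h')
  have h1e : A.eigenspace 1 ≠ ⊥ :=
    (Submodule.ne_bot_iff _).2 ⟨v, mem_eigenspace_iff.2 (by simpa using hAv), hv⟩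
  have hall : ∀ μ : K, A.eigenspace μ ≠ ⊥ → μ = 1 := by
    intro μ h
    have h2 := (heq _ (hm μ h)).trans (heq _ (hm 1 h1e)).symm
    exact congrArg Subtype.val (ψ.injective h2)
  have htop : A.eigenspace 1 = ⊤ := by
    rw [eq_top_iff, ← (isSemisimple_of_squarefree_aeval_eq_zero (squarefree_X_pow_sub_one hM)
      (by simp [hA] : aeval A (X ^ M - 1 : K[X]) = 0)).iSup_eigenspace_eq_top]
    refine iSup_le fun μ => ?_
    by_cases h : A.eigenspace μ = ⊥
    · simp [h]
    · rw [hall μ h]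
  ext y
  simpa using mem_eigenspace_iff.1 (show y ∈ A.eigenspace 1 by rw [htop]; trivial)

end RootsOfUnity

section MatrixProducts

variable {K}

variable (K) in
/-- A finite product of full matrix algebras. -/
abbrev MatProd {r : ℕ} (d : Fin r → ℕ) : Type := ∀ i, Matrix (Fin (d i)) (Fin (d i)) K

variable {r : ℕ} {d : Fin r → ℕ}

variable (K d) in
/-- The standard basis of a product of matrix algebras. -/
noncomputable def matBasis : Module.Basis (Σ i, Fin (d i) × Fin (d i)) K (MatProd K d) :=
  Pi.basis fun i => Matrix.stdBasis K (Fin (d i)) (Fin (d i))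

theorem matBasis_apply (j : Σ i, Fin (d i) × Fin (d i)) :
    matBasis K d j = Pi.single j.1 (Matrix.single j.2.1 j.2.2 1) := by
  obtain ⟨i, p, q⟩ := j
  rw [matBasis, Pi.basis_apply, Matrix.stdBasis_eq_single]

theorem matBasis_repr (x : MatProd K d) (j : Σ i, Fin (d i) × Fin (d i)) :
    (matBasis K d).repr x j = x j.1 j.2.1 j.2.2 := by
  obtain ⟨i, p, q⟩ := j
  rw [matBasis, Pi.basis_repr]
  change (Matrix.stdBasis K _ _).repr (x i) (p, q) = x i p q
  rfl

theorem trace_matProd (f : MatProd K d →ₗ[K] MatProd K d) :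
    LinearMap.trace K _ f = ∑ i, ∑ p, ∑ q, f (Pi.single i (Matrix.single p q 1)) i p q := by
  rw [LinearMap.trace_eq_matrix_trace K (matBasis K d), Matrix.trace, Fintype.sum_sigma]
  refine Finset.sum_congr rfl fun i _ => ?_
  rw [Fintype.sum_prod_type]
  simp [LinearMap.toMatrix_apply, matBasis_apply, matBasis_repr]

theorem trace_matProd_mul (a c : MatProd K d) :
    LinearMap.trace K _ (mulLeft K a ∘ₗ mulRight K c) = ∑ i, (a i).trace * (c i).trace := by
  rw [trace_matProd]
  refine Finset.sum_congr rfl fun i _ => ?_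
  rw [Matrix.trace, Matrix.trace, Finset.sum_mul_sum]
  refine Finset.sum_congr rfl fun p _ => Finset.sum_congr rfl fun q _ => ?_
  simp [Pi.mul_apply, Matrix.mul_apply, Matrix.single_apply, ite_and]

theorem exists_matProd_trace_form (T : MatProd K d →ₗ[K] K) :
    ∃ y : MatProd K d, ∀ h, T h = ∑ i, (h i * y i).trace := by
  refine ⟨fun i => Matrix.of fun q p => T (Pi.single i (Matrix.single p q 1)), fun h => ?_⟩
  conv_lhs => rw [← (matBasis K d).sum_repr h]
  rw [map_sum, Fintype.sum_sigma]
  refine Finset.sum_congr rfl fun i _ => ?_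
  rw [Fintype.sum_prod_type, Matrix.trace]
  refine Finset.sum_congr rfl fun p _ => ?_
  simp [Matrix.mul_apply, matBasis_apply, matBasis_repr]

theorem matProd_eq_of_trace {a b : MatProd K d}
    (h : ∀ x : MatProd K d, ∑ i, (x i * a i).trace = ∑ i, (x i * b i).trace) : a = b := by
  funext i
  refine Matrix.ext_iff_trace_mul_left.2 fun x => ?_
  have := h (Pi.single i x)
  rwa [Finset.sum_eq_single i, Finset.sum_eq_single i, Pi.single_eq_same] at this
  all_goals simp +contextual

theorem matProd_central {z : MatProd K d} (hz : ∀ b, z * b = b * z) (i : Fin r) :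
    ∃ s : K, z i = s • 1 := by
  have : z i ∈ Set.range (Matrix.scalar (Fin (d i))) := by
    rw [Matrix.mem_range_scalar_iff_commute_single']
    intro p q
    have := congrFun (hz (Pi.single i (Matrix.single p q 1))) i
    exact (by simpa using this.symm : _ * _ = _ * _)
  obtain ⟨s, hs⟩ := this
  exact ⟨s, by rw [← hs, Matrix.smul_one_eq_diagonal]; rfl⟩

variable [IsAlgClosed K] [CharZero K]

theorem trace_ne_zero_of_finite_order {σ : MatProd K d →ₗ[K] MatProd K d} {T : MatProd K d →ₗ[K] K}
    (hT : ∀ a b, T (a * b) = T (σ b * a)) (hnd : ∀ h, (∀ x, T (h * x) = 0) → h = 0)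
    (htr : ∀ h, T h = LinearMap.trace K _ (mulRight K h ∘ₗ σ)) {M : ℕ} (hM : 0 < M)
    (hσ : σ ^ M = 1) (hT0 : T ≠ 0) : LinearMap.trace K _ σ ≠ 0 := by
  obtain ⟨y, hy⟩ := exists_matProd_trace_form T
  have hcyc : ∀ a b : MatProd K d, ∑ i, ((a * b) i).trace = ∑ i, ((b * a) i).trace := fun a b =>
    Finset.sum_congr rfl fun i _ => Matrix.trace_mul_comm _ _
  have hy' : ∀ h, T h = ∑ i, ((h * y) i).trace := hy
  have hinj : Function.Injective (mulLeft K y) := by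
    rw [← LinearMap.ker_eq_bot, LinearMap.ker_eq_bot']
    intro z hz
    refine hnd z fun x => ?_
    rw [hy', mul_assoc, hcyc, mul_assoc, show y * z = 0 from hz]
    simp
  obtain ⟨y', hy1⟩ := LinearMap.injective_iff_surjective.1 hinj 1
  replace hy1 : y * y' = 1 := hy1
  have hy2 : y' * y = 1 := hinj (by simp only [mulLeft_apply]; rw [← mul_assoc, hy1]; simp)
  have hσ1 : ∀ b, b * y = y * σ b := by
    intro b
    refine matProd_eq_of_trace fun a => ?_
    have h1 := hT a b
    rw [hy', hy', mul_assoc (σ b), hcyc (σ b)] at h1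
    rw [mul_assoc, mul_assoc] at h1
    exact h1
  have hσ2 : ∀ b, σ b = y' * b * y := fun b => by
    rw [mul_assoc, hσ1, ← mul_assoc, hy2, one_mul]
  have hσk : ∀ (k : ℕ) b, b * y ^ k = y ^ k * (σ ^ k) b := by
    intro k
    induction k with
    | zero => simp
    | succ k ih =>
      intro b
      rw [pow_succ y, ← mul_assoc, ih, mul_assoc, hσ1, ← mul_assoc, ← Module.End.mul_apply,
        ← pow_succ']
  have hcen : ∀ b, y ^ M * b = b * y ^ M := fun b => by rw [hσk M b, hσ]; rfl
  choose s hs using matProd_central hcen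
  have hu : ∀ i, y i * y' i = 1 := fun i => congrFun hy1 i
  choose α hα using fun i => IsAlgClosed.exists_pow_nat_eq (s i) hM
  have hexists : ∀ i, ∃ a : Matrix (Fin (d i)) (Fin (d i)) K, ∃ β γ : K, a ^ M = 1 ∧ β * γ = 1 ∧
      y i = β • a ∧ y' i = γ • a ^ (M - 1) := by
    intro i
    by_cases hs0 : s i = 0
    · have h0 : (1 : Matrix (Fin (d i)) (Fin (d i)) K) = 0 := by
        have h1 : (y ^ M * y' ^ M) i = 1 := by
          rw [← (show Commute y y' from hy1.trans hy2.symm).mul_pow, hy1, one_pow]; rfl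
        rw [← h1, Pi.mul_apply, hs i, hs0]
        simp
      have h2 : ∀ x : Matrix (Fin (d i)) (Fin (d i)) K, x = 0 := fun x => by
        rw [← mul_one x, h0, mul_zero]
      exact ⟨1, 1, 1, by simp, by simp, by rw [h2 (y i), h2 (1 • 1)], by
        rw [h2 (y' i), h2 (1 • 1 ^ _)]⟩
    · have hα0 : α i ≠ 0 := fun h => hs0 (by rw [← hα, h, zero_pow hM.ne'])
      have ha : ((α i)⁻¹ • y i) ^ M = 1 := by
        rw [smul_pow, show y i ^ M = s i • 1 from hs i, ← hα, smul_smul, inv_pow,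
          inv_mul_cancel₀ (pow_ne_zero _ hα0), one_smul]
      refine ⟨(α i)⁻¹ • y i, α i, (α i)⁻¹, ha, mul_inv_cancel₀ hα0, ?_, ?_⟩
      · rw [smul_smul, mul_inv_cancel₀ hα0, one_smul]
      · have h1 : ((α i)⁻¹ • y i) * (α i • y' i) = 1 := by
          rw [smul_mul_smul_comm, inv_mul_cancel₀ hα0, hu, one_smul]
        have h2 : ((α i)⁻¹ • y i) ^ (M - 1) = α i • y' i := by
          rw [← mul_one (_ ^ (M - 1)), ← h1, ← mul_assoc, ← pow_succ, Nat.sub_add_cancel hM, ha,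
            one_mul]
        rw [h2, smul_smul, inv_mul_cancel₀ hα0, one_smul]
  choose a β γ ha hβ hya hy'a using hexists
  intro h0
  have htrσ : ∀ c, LinearMap.trace K _ (mulRight K c ∘ₗ σ) =
      ∑ i, (y' i).trace * ((y * c) i).trace := by
    intro c
    rw [← show _ = ∑ i, (y' i).trace * ((y * c) i).trace from trace_matProd_mul y' (y * c)]
    congr 1
    refine LinearMap.ext fun b => ?_
    simp [hσ2, mul_assoc]
  have hsum : ∑ i, LinearMap.trace K _ (Matrix.toLin' (a i)) *
      LinearMap.trace K _ ((Matrix.toLin' (a i)) ^ (M - 1)) = 0 := by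
    rw [← h0, show σ = mulRight K 1 ∘ₗ σ by ext1; simp, htrσ]
    refine Finset.sum_congr rfl fun i _ => ?_
    rw [← Matrix.toLin'_pow, Matrix.trace_toLin'_eq, Matrix.trace_toLin'_eq, mul_one, hya, hy'a,
      Matrix.trace_smul, Matrix.trace_smul, smul_mul_smul_comm, mul_comm (γ i), hβ, one_smul,
      mul_comm]
  have hz := trace_eq_zero_of_sum_eq_zero hM
    (fun i => by rw [← Matrix.toLin'_pow, ha, Matrix.toLin'_one]; rfl) hsum
  refine hT0 (LinearMap.ext fun c => ?_)
  rw [htr, htrσ]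
  refine Finset.sum_eq_zero fun i _ => ?_
  have := hz i
  rw [← Matrix.toLin'_pow, Matrix.trace_toLin'_eq] at this
  rw [hy'a, Matrix.trace_smul, this, smul_zero, zero_mul]

end MatrixProducts

section LarsonRadford

variable {K H} [FiniteDimensional K H]

variable (K H) in
/-- The element `x` with `f(x) = tr (h ↦ Σ h₍₁₎ f(h₍₂₎))`. -/
noncomputable def regElem : H :=
  ∑ i, hitR ((Module.finBasis K H).coord i) (Module.finBasis K H i)

theorem apply_regElem (f : H →ₗ[K] K) : f (regElem K H) = LinearMap.trace K H (hitL f) := by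
  rw [regElem, map_sum, LinearMap.trace_eq_matrix_trace K (Module.finBasis K H), Matrix.trace]
  refine Finset.sum_congr rfl fun i _ => ?_
  rw [apply_hitR, Matrix.diag_apply, LinearMap.toMatrix_apply]
  rfl

/-- The bijection `h ⊗ k ↦ Σ h₍₁₎ ⊗ h₍₂₎ k`. -/
noncomputable def galoisMap : H ⊗[K] H →ₗ[K] H ⊗[K] H :=
  TensorProduct.lift (LinearMap.mk₂ K (fun h k => comul (R := K) h * (1 ⊗ₜ k))
    (by intros; simp [add_mul]) (by intros; simp) (by intros; simp [tmul_add, mul_add])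
    (by intros; simp))

theorem galoisMap_tmul (h k : H) : galoisMap (K := K) (h ⊗ₜ k) = comul (R := K) h * (1 ⊗ₜ k) := rfl

theorem galoisMap_surjective : Function.Surjective (galoisMap (K := K) (H := H)) := by
  intro t
  induction t with
  | zero => exact ⟨0, map_zero _⟩
  | tmul h k =>
    let r := ℛ K h
    refine ⟨∑ j ∈ r.index, r.left j ⊗ₜ (antipode K (r.right j) * k), ?_⟩
    simp only [map_sum, galoisMap_tmul]
    have := congrArg (· * ((1 : H) ⊗ₜ[K] k)) (tmul_one_eq_sum h r)
    simp only [Finset.sum_mul, mul_assoc, Algebra.TensorProduct.tmul_mul_tmul, one_mul,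
      mul_one] at this
    exact this.symm
  | add x y hx hy =>
    obtain ⟨a, ha⟩ := hx
    obtain ⟨b, hb⟩ := hy
    exact ⟨a + b, by rw [map_add, ha, hb]⟩

theorem regElem_mul_self :
    regElem K H * regElem K H = (Module.finrank K H : K) • regElem K H := by
  apply eq_of_dual_eq (K := K)
  intro f
  let b := Module.finBasis K H
  let G : H ⊗[K] H →ₗ[K] H ⊗[K] H :=
    ∑ i, ∑ j, f (b i * b j) • TensorProduct.map (hitL (b.coord i)) (hitL (b.coord j))
  have hG : LinearMap.trace K _ G = f (regElem K H * regElem K H) := by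
    simp only [G, map_sum, map_smul, LinearMap.trace_tensorProduct', ← apply_regElem]
    have := sum_dual_smul b (f ∘ₗ (mulRight K (regElem K H))) (regElem K H)
    simp only [LinearMap.comp_apply, mulRight_apply] at this
    rw [← this]
    refine Finset.sum_congr rfl fun i _ => ?_
    have := sum_dual_smul b (f ∘ₗ (mulLeft K (b i))) (regElem K H)
    simp only [LinearMap.comp_apply, mulLeft_apply] at this
    rw [← this, Finset.smul_sum]
    refine Finset.sum_congr rfl fun j _ => ?_
    simp only [smul_eq_mul]
    ring
  have hGa : ∀ h k, G (h ⊗ₜ k) = ∑ p ∈ (ℛ K h).index, ∑ q ∈ (ℛ K k).index,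
      f ((ℛ K h).right p * (ℛ K k).right q) • ((ℛ K h).left p ⊗ₜ[K] (ℛ K k).left q) := by
    intro h k
    have e : ∀ (g : H →ₗ[K] K) (h : H), hitL g h = ∑ p ∈ (ℛ K h).index, g ((ℛ K h).right p) • (ℛ K h).left p := by
      intro g h
      conv_lhs => rw [hitL_apply, ← (ℛ K h).eq]
      simp
    simp only [G, LinearMap.sum_apply, LinearMap.smul_apply, TensorProduct.map_tmul, e, sum_tmul,
      tmul_sum, smul_tmul', tmul_smul, Finset.smul_sum, smul_smul]
    rw [Finset.sum_congr rfl fun i _ => Finset.sum_comm]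
    rw [Finset.sum_comm]
    conv_rhs => rw [Finset.sum_comm]
    refine Finset.sum_congr rfl fun q _ => ?_
    rw [Finset.sum_congr rfl fun i _ => Finset.sum_comm]
    rw [Finset.sum_comm]
    refine Finset.sum_congr rfl fun p _ => ?_
    simp only [← sum_tmul, ← Finset.sum_smul]
    congr 2
    have h1 := sum_dual_smul b (f ∘ₗ (mulRight K ((ℛ K k).right q))) ((ℛ K h).right p)
    simp only [LinearMap.comp_apply, mulRight_apply] at h1
    rw [← h1]
    refine Finset.sum_congr rfl fun i _ => ?_
    have h2 := sum_dual_smul b (f ∘ₗ (mulLeft K (b i))) ((ℛ K k).right q)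
    simp only [LinearMap.comp_apply, mulLeft_apply] at h2
    rw [← h2, Finset.smul_sum]
    refine Finset.sum_congr rfl fun j _ => ?_
    simp only [smul_eq_mul]
    ring
  have hcomm : galoisMap ∘ₗ G = (LinearMap.lTensor H (hitL f)) ∘ₗ galoisMap := by
    apply TensorProduct.ext'
    intro h k
    have e0 : ∀ u : H ⊗[K] H, lTensor H (hitL f) u =
        sliceR f ((TensorProduct.assoc K H H H).symm (lTensor H (comul (R := K)) u)) := by
      intro u
      induction u with
      | zero => simp
      | tmul a c =>
        rw [lTensor_tmul, lTensor_tmul, hitL_apply]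
        generalize comul (R := K) c = t
        induction t with
        | zero => simp
        | tmul => simp
        | add x y hx hy => simp only [map_add, tmul_add, hx, hy]
      | add x y hx hy => simp only [map_add, hx, hy]
    have e1 : (TensorProduct.assoc K H H H).symm (lTensor H (comul (R := K))
        (comul (R := K) h * (1 ⊗ₜ k))) = rTensor H (comul (R := K)) (comul (R := K) h) *
          (TensorProduct.assoc K H H H).symm (1 ⊗ₜ comul (R := K) k) := by
      have := map_mul ((Algebra.TensorProduct.assoc K K K H H H).symm.toAlgHom.comp
        (Algebra.TensorProduct.map (AlgHom.id K H) (comulAlgHom K H)))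
          (comul (R := K) h) (1 ⊗ₜ k)
      rw [← coassoc_symm_apply]
      exact this
    rw [LinearMap.comp_apply, LinearMap.comp_apply, hGa, galoisMap_tmul, e0, e1]
    conv_rhs => rw [← (ℛ K h).eq, ← (ℛ K k).eq]
    simp only [map_sum, map_smul, galoisMap_tmul, rTensor_tmul, tmul_sum, assoc_symm_tmul,
      Finset.sum_mul_sum, Algebra.TensorProduct.tmul_mul_tmul, sliceR_tmul]
  have hbij : Function.Bijective (galoisMap (K := K) (H := H)) :=
    ⟨LinearMap.injective_iff_surjective.2 galoisMap_surjective, galoisMap_surjective⟩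
  let Ψ := LinearEquiv.ofBijective galoisMap hbij
  have hconj : Ψ.conj G = LinearMap.lTensor H (hitL f) := by
    refine LinearMap.ext fun u => ?_
    obtain ⟨v, rfl⟩ := Ψ.surjective u
    rw [LinearEquiv.conj_apply_apply, LinearEquiv.symm_apply_apply]
    exact LinearMap.congr_fun hcomm v
  rw [← hG, ← LinearMap.trace_conj' G Ψ, hconj, map_smul, apply_regElem, smul_eq_mul]
  have := LinearMap.trace_tensorProduct' (R := K) (LinearMap.id : H →ₗ[K] H) (hitL f)
  rwa [LinearMap.trace_id] at this

end LarsonRadford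

section LarsonRadford

variable {K H} [FiniteDimensional K H]

theorem sqS_hitL (f : H →ₗ[K] K) (h : H) :
    sqS K H (hitL (f ∘ₗ sqS K H) h) = hitL f (sqS K H h) := by
  rw [hitL_apply, hitL_apply, comul_sqS]
  generalize comul (R := K) h = t
  induction t with
  | zero => simp
  | tmul a b => simp
  | add x y hx hy => simp only [map_add, hx, hy]

section
variable {Λ : H} (hΛ : ∀ h : H, h * Λ = counit (R := K) h • Λ) (hε : counit (R := K) Λ = 1)

include hΛ hε

theorem sqS_regElem : sqS K H (regElem K H) = regElem K H := by
  apply eq_of_dual_eq (K := K)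
  intro f
  have hb : Function.Bijective (sqS K H) :=
    (antipode_bijective hΛ hε).comp (antipode_bijective hΛ hε)
  let Ψ := LinearEquiv.ofBijective (sqS K H) hb
  have := apply_regElem (f ∘ₗ sqS K H)
  rw [LinearMap.comp_apply] at this
  rw [this, apply_regElem, ← LinearMap.trace_conj' (hitL (f ∘ₗ sqS K H)) Ψ]
  congr 1
  refine LinearMap.ext fun u => ?_
  obtain ⟨v, rfl⟩ := Ψ.surjective u
  rw [LinearEquiv.conj_apply_apply, LinearEquiv.symm_apply_apply]
  exact sqS_hitL f v

theorem trS_regElem : trS K H (regElem K H) = trS K H 1 := by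
  set g := hitL (trS K H) Λ with hg
  have h1 : hitL (trS K H) = (trS K H).smulRight g := by
    refine LinearMap.ext fun h => ?_
    rw [hitL_trS hΛ hε]; rfl
  rw [apply_regElem, h1, LinearMap.trace_smulRight]
  have := trS_antipode_mul hΛ hε 1
  simpa using this

variable [IsAlgClosed K] [CharZero K]

theorem trace_sqS_ne_zero (hss : IsSemisimpleRing H) : LinearMap.trace K H (sqS K H) ≠ 0 := by
  obtain ⟨r, d, hd, ⟨e⟩⟩ := IsSemisimpleRing.exists_algEquiv_pi_matrix_of_isAlgClosed K H
  obtain ⟨M, hM, hS⟩ := exists_sqS_pow_eq_one hΛ hε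
  let E : H ≃ₗ[K] MatProd K d := e.toLinearEquiv
  have hE : ∀ a, E a = e a := fun _ => rfl
  have hE' : ∀ a, E.symm a = e.symm a := fun _ => rfl
  rw [← LinearMap.trace_conj' (sqS K H) E]
  refine trace_ne_zero_of_finite_order (T := trS K H ∘ₗ E.symm.toLinearMap) (M := M) ?_ ?_ ?_ hM
    ?_ ?_
  · intro a b
    simp only [LinearMap.comp_apply, LinearEquiv.coe_coe, hE', map_mul, LinearEquiv.conj_apply_apply,
      trS_mul _ (e.symm b), hE, AlgEquiv.symm_apply_apply]
  · intro h hh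
    have := trS_nondegenerate hΛ hε (h := e.symm h) fun x => by
      have := hh (e x)
      simpa [hE'] using this
    simpa using this
  · intro h
    rw [LinearMap.comp_apply, LinearEquiv.coe_coe, trS_apply, ← LinearMap.trace_conj' _ E]
    congr 1
    refine LinearMap.ext fun u => ?_
    simp [LinearEquiv.conj_apply_apply, hE, hE']
  · have : ∀ k, (E.conj (sqS K H)) ^ k = E.conj (sqS K H ^ k) := by
      intro k
      induction k with
      | zero =>
        refine LinearMap.ext fun u => ?_
        simp [LinearEquiv.conj_apply_apply]
      | succ k ih =>
        rw [pow_succ, pow_succ, ih]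
        refine LinearMap.ext fun u => ?_
        simp [LinearEquiv.conj_apply_apply]
    rw [this, hS]
    refine LinearMap.ext fun u => ?_
    simp [LinearEquiv.conj_apply_apply]
  · intro h0
    have := LinearMap.congr_fun h0 (E Λ)
    simp [trS_integral hΛ hε] at this

/-- Larson–Radford: in characteristic zero the antipode of a semisimple Hopf algebra is an
involution. -/
theorem sqS_eq_one (hss : IsSemisimpleRing H) : sqS K H = 1 := by
  have : Nontrivial H := by
    refine ⟨⟨Λ, 0, fun h => ?_⟩⟩
    rw [h, map_zero] at hε
    exact zero_ne_one hε
  obtain ⟨M, hM, hS⟩ := exists_sqS_pow_eq_one hΛ hε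
  set n : K := (Module.finrank K H : K) with hn
  have hn0 : n ≠ 0 := Nat.cast_ne_zero.2 Module.finrank_pos.ne'
  set p : H := n⁻¹ • regElem K H with hp
  have hpp : p * p = p := by
    rw [hp, smul_mul_smul_comm, regElem_mul_self, smul_smul, mul_assoc, inv_mul_cancel₀ hn0,
      mul_one]
  have hSp : sqS K H p = p := by rw [hp, map_smul, sqS_regElem hΛ hε]
  have hint : IsIntegral ℤ (LinearMap.trace K H (mulRight K p ∘ₗ sqS K H)) := by
    refine isIntegral_trace_of_pow_succ_eq hM ?_
    have key : ∀ k : ℕ, (mulRight K p ∘ₗ sqS K H) ^ (k + 1) =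
        mulRight K p ∘ₗ (sqS K H ^ (k + 1)) := by
      intro k
      induction k with
      | zero => simp
      | succ k ih =>
        rw [pow_succ', ih]
        refine LinearMap.ext fun u => ?_
        change sqS K H ((sqS K H ^ (k + 1)) u * p) * p = _
        rw [sqS_mul, hSp, mul_assoc, hpp, pow_succ' _ (k + 1)]
        rfl
    rw [key, pow_succ, hS, one_mul]
  rw [← trS_apply, hp, map_smul, trS_regElem hΛ hε, trS_one, smul_eq_mul, mul_comm,
    ← div_eq_mul_inv] at hint
  exact eq_one_of_isIntegral_trace hM hS (trace_sqS_ne_zero hΛ hε hss) hint one_ne_zero sqS_one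

end

end LarsonRadford

section

section MatrixCoefficients

variable {K H} [FiniteDimensional K H]

variable (K H) in
/-- The matrix coefficients of the regular comodule in a basis of `H`. -/
noncomputable def mc (i j : Fin (Module.finrank K H)) : H :=
  hitL ((Module.finBasis K H).coord j) (Module.finBasis K H i)

theorem comul_finBasis (i) : comul (R := K) (Module.finBasis K H i) =
    ∑ j, mc K H i j ⊗ₜ[K] Module.finBasis K H j := by
  simp only [mc, hitL_apply]
  generalize comul (R := K) (Module.finBasis K H i) = t
  induction t with
  | zero => simp
  | tmul a c =>
    simp only [sliceR_tmul, smul_tmul]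
    rw [← tmul_sum]
    congr 1
    exact ((Module.finBasis K H).sum_repr c).symm
  | add x y hx hy =>
    simp only [map_add, add_tmul, Finset.sum_add_distrib, ← hx, ← hy]

theorem comul_mc (i j) : comul (R := K) (mc K H i j) = ∑ k, mc K H i k ⊗ₜ[K] mc K H k j := by
  set f := (Module.finBasis K H).coord j with hf
  have h1 : ∀ t : H ⊗[K] H, comul (R := K) (sliceR f t) =
      sliceR f (rTensor H (comul (R := K)) t) := fun t => map_sliceR _ _ _
  have h2 : ∀ t : H ⊗[K] H, sliceR f ((TensorProduct.assoc K H H H).symm (lTensor H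
      (comul (R := K)) t)) = lTensor H (hitL f) t := by
    intro t
    induction t with
    | zero => simp
    | tmul a c =>
      rw [lTensor_tmul, lTensor_tmul, hitL_apply]
      generalize comul (R := K) c = t
      induction t with
      | zero => simp
      | tmul => simp
      | add x y hx hy => simp only [map_add, tmul_add, hx, hy]
    | add x y hx hy => simp only [map_add, hx, hy]
  rw [mc, hitL_apply, h1, ← coassoc_symm_apply, h2, comul_finBasis]
  simp only [map_sum, lTensor_tmul]
  rfl

theorem counit_mc (i j) : counit (R := K) (mc K H i j) = if i = j then 1 else 0 := by
  have : counit (R := K) (mc K H i j) =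
      (Module.finBasis K H).coord j (hitR (counit (R := K)) (Module.finBasis K H i)) := by
    rw [apply_hitR]; rfl
  rw [this, hitR_counit]
  simp [Finsupp.single_apply]

theorem finBasis_eq_sum_mc (i) : Module.finBasis K H i =
    ∑ j, counit (R := K) (Module.finBasis K H j) • mc K H i j := by
  have : Module.finBasis K H i = hitL (counit (R := K)) (Module.finBasis K H i) := by simp
  conv_lhs => rw [this, hitL_apply, comul_finBasis]
  simp

theorem ext_mc {V : Type*} [AddCommGroup V] [Module K V] {F G : H →ₗ[K] V}
    (h : ∀ i j, F (mc K H i j) = G (mc K H i j)) : F = G :=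
  (Module.finBasis K H).ext fun i => by
    rw [finBasis_eq_sum_mc]
    simp [h]

theorem sum_antipode_mul_mc (i j) : ∑ k, antipode K (mc K H i k) * mc K H k j =
    if i = j then 1 else 0 := by
  have := mul_antipode_rTensor_comul_apply (R := K) (mc K H i j)
  simpa [comul_mc, counit_mc, apply_ite] using this

theorem sum_mc_mul_antipode (i j) : ∑ k, mc K H i k * antipode K (mc K H k j) =
    if i = j then 1 else 0 := by
  have := mul_antipode_lTensor_comul_apply (R := K) (mc K H i j)
  simpa [comul_mc, counit_mc, apply_ite] using this

theorem comul_antipode_mc (i j) : comul (R := K) (antipode K (mc K H i j)) =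
    ∑ k, antipode K (mc K H k j) ⊗ₜ[K] antipode K (mc K H i k) := by
  rw [comul_antipode, comul_mc]
  simp

theorem hitL_mc (f : H →ₗ[K] K) (i j) : hitL f (mc K H i j) = ∑ k, f (mc K H k j) • mc K H i k := by
  simp [hitL_apply, comul_mc]

theorem hitR_mc (f : H →ₗ[K] K) (i j) : hitR f (mc K H i j) = ∑ k, f (mc K H i k) • mc K H k j := by
  simp [hitR_apply, comul_mc]

theorem convF_mc (f g : H →ₗ[K] K) (i j) :
    convF f g (mc K H i j) = ∑ k, f (mc K H i k) * g (mc K H k j) := by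
  simp [convF, hitL_mc, mul_comm]

theorem exists_matrix (h : H) : ∃ c : Fin (Module.finrank K H) → Fin (Module.finrank K H) → K,
    h = ∑ i, ∑ j, c i j • mc K H i j := by
  refine ⟨fun i j => (Module.finBasis K H).repr h i * counit (R := K) (Module.finBasis K H j), ?_⟩
  conv_lhs => rw [← (Module.finBasis K H).sum_repr h]
  refine Finset.sum_congr rfl fun i _ => ?_
  conv_lhs => rw [finBasis_eq_sum_mc, Finset.smul_sum]
  simp [smul_smul]

end MatrixCoefficients

/-- The integral and the normalized character of the regular representation of a semisimple Hopf
algebra with involutive antipode. -/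
structure HaarData where
  Λ : H
  lam : H →ₗ[K] K
  sq : ∀ h : H, antipode K (antipode K h) = h
  mul_Λ : ∀ h : H, h * Λ = counit (R := K) h • Λ
  Λ_mul : ∀ h : H, Λ * h = counit (R := K) h • Λ
  counit_Λ : counit (R := K) Λ = 1
  antipode_Λ : antipode K Λ = Λ
  lam_one : lam 1 = 1
  hitR_lam : ∀ h, hitR lam h = lam h • 1
  lam_comm : ∀ a b, lam (a * b) = lam (b * a)
  nondeg : ∀ a, (∀ x, lam (a * x) = 0) → a = 0
  lam_Λ : (Module.finrank K H : K) * lam Λ = 1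
  trace_mulRight : ∀ a, LinearMap.trace K H (mulRight K a) = (Module.finrank K H : K) * lam a

variable {K H} in
theorem exists_haarData [FiniteDimensional K H] [IsAlgClosed K] [CharZero K] [Nontrivial H]
    (hss : IsSemisimpleRing H) : Nonempty (HaarData K H) := by
  obtain ⟨Λ, hΛ, hε⟩ := exists_left_integral (K := K) hss
  have hS := sqS_eq_one hΛ hε hss
  have sq : ∀ h : H, antipode K (antipode K h) = h := fun h => LinearMap.congr_fun hS h
  set n : K := (Module.finrank K H : K) with hn
  have hn0 : n ≠ 0 := Nat.cast_ne_zero.2 Module.finrank_pos.ne'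
  have tr1 : trS K H 1 = n := by rw [trS_one, hS]; exact LinearMap.trace_id K H
  have htr : ∀ a, LinearMap.trace K H (mulRight K a) = trS K H a := by
    intro a
    rw [trS_apply, hS]
    rfl
  refine ⟨⟨Λ, n⁻¹ • trS K H, sq, hΛ, integral_mul hΛ hε, hε, antipode_integral hΛ hε, ?_, ?_, ?_,
    ?_, ?_, ?_⟩⟩
  · simp [tr1, hn0]
  · intro h
    rw [hitR_apply, sliceL_smul, ← hitR_apply, hitR_trS]
    simp [smul_smul]
  · intro a b
    simp only [LinearMap.smul_apply, trS_mul a b, hS]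
    rfl
  · intro a h
    refine trS_nondegenerate hΛ hε (h := a) fun x => ?_
    have := h x
    simpa [hn0] using this
  · simp [trS_integral hΛ hε, ← hn, hn0]
  · intro a
    rw [htr]
    simp [← hn, hn0]

namespace HaarData

variable {K H} [FiniteDimensional K H] (𝓱 : HaarData K H)
include 𝓱

theorem sum_antipode_mul_mc' (i j) : ∑ k, antipode K (mc K H k j) * mc K H i k =
    if i = j then 1 else 0 := by
  have := congrArg (antipode K) (sum_antipode_mul_mc (K := K) (H := H) i j)
  simpa [antipode_mul_antidistrib, 𝓱.sq, apply_ite] using this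

theorem sum_mc_mul_antipode' (i j) : ∑ k, mc K H k j * antipode K (mc K H i k) =
    if i = j then 1 else 0 := by
  have := congrArg (antipode K) (sum_mc_mul_antipode (K := K) (H := H) i j)
  simpa [antipode_mul_antidistrib, 𝓱.sq, apply_ite] using this

theorem exists_eq_lam_mulRight (g : H →ₗ[K] K) : ∃ y, g = 𝓱.lam ∘ₗ mulRight K y := by
  let F : H →ₗ[K] (H →ₗ[K] K) := LinearMap.mk₂ K (fun y x => 𝓱.lam (x * y))
    (by intros; simp [mul_add]) (by intros; simp) (by intros; simp [add_mul]) (by intros; simp)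
  have hF : ∀ y x, F y x = 𝓱.lam (x * y) := fun _ _ => rfl
  have hinj : Function.Injective F := by
    rw [injective_iff_map_eq_zero]
    intro y hy
    refine 𝓱.nondeg y fun x => ?_
    rw [𝓱.lam_comm, ← hF, hy]; rfl
  have hsurj : Function.Surjective F :=
    (LinearMap.injective_iff_surjective_of_finrank_eq_finrank
      (Subspace.dual_finrank_eq (K := K) (V := H)).symm).1 hinj
  obtain ⟨y, rfl⟩ := hsurj g
  exact ⟨y, rfl⟩

theorem hitR_lam_mulRight_mc (i j) (z : H) : hitR (𝓱.lam ∘ₗ mulRight K (mc K H i j)) z =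
    ∑ k, 𝓱.lam (z * mc K H i k) • antipode K (mc K H k j) := by
  rw [hitR_comp_mulRight 𝓱.hitR_lam]
  simp [comul_mc]

theorem trace_hitR_comp_mulLeft (g : H →ₗ[K] K) (h : H) :
    LinearMap.trace K H (hitR g ∘ₗ mulLeft K h) =
      (Module.finrank K H : K) * 𝓱.lam h * g 𝓱.Λ := by
  obtain ⟨y, rfl⟩ := 𝓱.exists_eq_lam_mulRight g
  obtain ⟨c, rfl⟩ := exists_matrix (K := K) y
  have e : ∀ i j, LinearMap.trace K H (hitR (𝓱.lam ∘ₗ mulRight K (mc K H i j)) ∘ₗ mulLeft K h) =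
      (if i = j then 𝓱.lam h else 0) := by
    intro i j
    have : hitR (𝓱.lam ∘ₗ mulRight K (mc K H i j)) ∘ₗ mulLeft K h = ∑ k,
        (𝓱.lam ∘ₗ mulLeft K h ∘ₗ mulRight K (mc K H i k)).smulRight (antipode K (mc K H k j)) := by
      refine LinearMap.ext fun x => ?_
      rw [LinearMap.comp_apply, hitR_lam_mulRight_mc]
      simp [mul_assoc]
    rw [this, map_sum]
    simp only [LinearMap.trace_smulRight, LinearMap.comp_apply, mulRight_apply, mulLeft_apply]
    rw [← map_sum, ← Finset.mul_sum, sum_antipode_mul_mc' 𝓱]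
    split_ifs <;> simp
  have lin : 𝓱.lam ∘ₗ mulRight K (∑ i, ∑ j, c i j • mc K H i j) =
      ∑ i, ∑ j, c i j • (𝓱.lam ∘ₗ mulRight K (mc K H i j)) := by
    refine LinearMap.ext fun x => ?_
    simp [Finset.mul_sum, LinearMap.sum_apply]
  have lin2 : hitR (∑ i, ∑ j, c i j • (𝓱.lam ∘ₗ mulRight K (mc K H i j))) ∘ₗ mulLeft K h =
      ∑ i, ∑ j, c i j • (hitR (𝓱.lam ∘ₗ mulRight K (mc K H i j)) ∘ₗ mulLeft K h) := by
    refine LinearMap.ext fun x => ?_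
    simp only [LinearMap.sum_apply, LinearMap.smul_apply, LinearMap.comp_apply, hitR_apply]
    generalize comul (R := K) (mulLeft K h x) = t
    induction t with
    | zero => simp
    | tmul a b => simp [Finset.sum_smul, LinearMap.sum_apply, smul_smul]
    | add x y hx hy => simp only [map_add, hx, hy, smul_add, Finset.sum_add_distrib]
  rw [lin, lin2]
  simp only [map_sum, map_smul, e, LinearMap.sum_apply, LinearMap.smul_apply, LinearMap.comp_apply,
    mulRight_apply, 𝓱.Λ_mul, counit_mc, smul_eq_mul, Finset.mul_sum]
  refine Finset.sum_congr rfl fun i _ => Finset.sum_congr rfl fun j _ => ?_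
  split_ifs
  · have := 𝓱.lam_Λ
    linear_combination (-(𝓱.lam h) * c i j) * this
  · simp

theorem trace_hitL (g : H →ₗ[K] K) :
    LinearMap.trace K H (hitL g) = (Module.finrank K H : K) * g 𝓱.Λ := by
  have hbij : Function.Bijective (antipode K (A := H)) :=
    (Function.Involutive.bijective 𝓱.sq)
  let Ψ := LinearEquiv.ofBijective (antipode K (A := H)) hbij
  have := 𝓱.trace_hitR_comp_mulLeft (g ∘ₗ antipode K) 1
  rw [LinearMap.comp_apply, 𝓱.antipode_Λ, 𝓱.lam_one, mul_one, mulLeft_one, LinearMap.comp_id] at this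
  rw [← this, ← LinearMap.trace_conj' (hitR (g ∘ₗ antipode K)) Ψ]
  congr 1
  refine LinearMap.ext fun u => ?_
  obtain ⟨v, rfl⟩ := Ψ.surjective u
  rw [LinearEquiv.conj_apply_apply, LinearEquiv.symm_apply_apply]
  change hitL g (antipode K v) = antipode K (hitR (g ∘ₗ antipode K) v)
  rw [hitL_apply, comul_antipode, hitR_apply]
  generalize comul (R := K) v = t
  induction t with
  | zero => simp
  | tmul a b => simp
  | add x y hx hy => simp only [map_add, hx, hy]

/-- Fourier inversion. -/
theorem lam_slice_eq (a : H) : (Module.finrank K H : K) •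
    sliceR (𝓱.lam ∘ₗ mulRight K a ∘ₗ antipode K) (comul (R := K) 𝓱.Λ) = a := by
  rw [← sub_eq_zero]
  refine 𝓱.nondeg _ fun y => ?_
  rw [𝓱.lam_comm, mul_sub, map_sub, sub_eq_zero]
  have key : ∀ y : H, 𝓱.lam (y * (sliceR (𝓱.lam ∘ₗ mulRight K a ∘ₗ antipode K)
      (comul (R := K) 𝓱.Λ))) = 𝓱.lam 𝓱.Λ * 𝓱.lam (y * a) := by
    intro y
    have h1 := smul_eq_antipode_slice 𝓱.mul_Λ 𝓱.hitR_lam y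
    have h2 : 𝓱.lam 𝓱.Λ * 𝓱.lam (y * a) = 𝓱.lam ((𝓱.lam 𝓱.Λ • y) * a) := by simp
    rw [h2, h1]
    generalize comul (R := K) 𝓱.Λ = t
    induction t with
    | zero => simp
    | tmul u v => simp [mul_comm]
    | add x y hx hy => simp only [map_add, hx, hy, mul_add, add_mul]
  rw [mul_smul_comm, map_smul, key, smul_eq_mul, ← mul_assoc, 𝓱.lam_Λ, one_mul]

end HaarData

end

section

variable [FiniteDimensional K H]

/-- A Yetter–Drinfeld module structure with values in an algebra `A`: an algebra map `π : H → A`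
and a family `P f = Σ f(v₍₋₁₎) v₍₀₎` of coefficients of the coaction. -/
structure DRep (A : Type) [Ring A] [Algebra K A] where
  π : H →ₐ[K] A
  P : (H →ₗ[K] K) →ₗ[K] A
  P_counit : P (counit (R := K)) = 1
  P_mul : ∀ f g, P f * P g = P (convF g f)
  yd : ∀ f i j, ∑ k, π (mc K H k j) * P (f ∘ₗ mulLeft K (mc K H i k)) =
    ∑ k, P (f ∘ₗ mulRight K (mc K H k j)) * π (mc K H i k)

variable {K H}

/-- `Σ f(h₍₁₎ y S(h₍₃₎)) h₍₂₎`. -/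
noncomputable def coadj (f : H →ₗ[K] K) (y : H) : H →ₗ[K] H :=
  sliceL (f ∘ₗ mul' K H ∘ₗ TensorProduct.map (mulRight K y) (antipode K)) ∘ₗ
    (TensorProduct.assoc K H H H).symm.toLinearMap ∘ₗ
    lTensor H ((TensorProduct.comm K H H).toLinearMap ∘ₗ comul (R := K)) ∘ₗ comul (R := K)

theorem coadj_mc (f : H →ₗ[K] K) (y : H) (i j) : coadj f y (mc K H i j) =
    ∑ k, ∑ l, f (mc K H i k * y * antipode K (mc K H l j)) • mc K H k l := by
  simp [coadj, comul_mc, tmul_sum]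

theorem coadj_one (f : H →ₗ[K] K) (y : H) : coadj f y 1 = f y • 1 := by
  simp [coadj, Algebra.TensorProduct.one_def]

theorem coadj_mc_mul (f : H →ₗ[K] K) (y : H) (i j) (h : H) : coadj f y (mc K H i j * h) =
    ∑ k, ∑ l, mc K H k l *
      coadj (f ∘ₗ mulLeft K (mc K H i k) ∘ₗ mulRight K (antipode K (mc K H l j))) y h := by
  have : coadj f y ∘ₗ mulLeft K (mc K H i j) = ∑ k, ∑ l, mulLeft K (mc K H k l) ∘ₗ
      coadj (f ∘ₗ mulLeft K (mc K H i k) ∘ₗ mulRight K (antipode K (mc K H l j))) y := by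
    refine ext_mc fun p q => ?_
    simp only [LinearMap.comp_apply, LinearMap.sum_apply, mulLeft_apply, coadj_mc, mulRight_apply,
      Finset.mul_sum, mul_smul_comm]
    simp only [coadj, LinearMap.comp_apply, Bialgebra.comul_mul, comul_mc, Finset.sum_mul_sum,
      Algebra.TensorProduct.tmul_mul_tmul, map_sum, lTensor_tmul, LinearEquiv.coe_coe,
      TensorProduct.comm_tmul, tmul_sum, TensorProduct.assoc_symm_tmul, sliceL_tmul,
      TensorProduct.map_tmul, mulRight_apply, mul'_apply, antipode_mul_antidistrib]
    refine Finset.sum_congr rfl fun k _ => ?_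
    rw [Finset.sum_comm]
    refine Finset.sum_congr rfl fun l _ => ?_
    refine Finset.sum_congr rfl fun r _ => ?_
    refine Finset.sum_congr rfl fun s _ => ?_
    simp only [mul_assoc]
  simpa using LinearMap.congr_fun this h

theorem coadj_counit (y : H) :
    coadj (counit (R := K)) y = counit (R := K) y • LinearMap.id := by
  refine ext_mc fun i j => ?_
  simp [coadj_mc, counit_mc]

theorem sum_reorder {ι V : Type*} [Fintype ι] [AddCommMonoid V] (F : ι → ι → ι → ι → ι → V) :
    ∑ a, ∑ b, ∑ c, ∑ d, ∑ e, F a b c d e = ∑ d, ∑ e, ∑ c, ∑ a, ∑ b, F a b c d e := by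
  have h1 : ∑ a, ∑ b, ∑ c, ∑ d, ∑ e, F a b c d e =
      ∑ x : ι × ι × ι × ι × ι, F x.1 x.2.1 x.2.2.1 x.2.2.2.1 x.2.2.2.2 := by
    simp [Fintype.sum_prod_type]
  have h2 : ∑ d, ∑ e, ∑ c, ∑ a, ∑ b, F a b c d e =
      ∑ x : ι × ι × ι × ι × ι, F x.2.2.2.1 x.2.2.2.2 x.2.2.1 x.1 x.2.1 := by
    simp [Fintype.sum_prod_type]
  rw [h1, h2]
  exact Fintype.sum_bijective (fun x => (x.2.2.2.1, x.2.2.2.2, x.2.2.1, x.1, x.2.1))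
    (Function.bijective_iff_has_inverse.2
      ⟨fun x => (x.2.2.2.1, x.2.2.2.2, x.2.2.1, x.1, x.2.1), fun _ => rfl, fun _ => rfl⟩) _ _
    fun _ => rfl

theorem coadj_comp (f g : H →ₗ[K] K) (i j) :
    coadj (convF g f) (mc K H i j) =
      ∑ k, coadj f (mc K H k j) ∘ₗ coadj g (mc K H i k) := by
  refine ext_mc fun p q => ?_
  simp only [LinearMap.sum_apply, LinearMap.comp_apply, coadj_mc, map_sum, map_smul, convF,
    hitL_apply, Bialgebra.comul_mul, comul_mc, comul_antipode_mc,
    Finset.sum_mul, Finset.mul_sum, Algebra.TensorProduct.tmul_mul_tmul, sliceR_tmul,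
    Finset.smul_sum, smul_smul, Finset.sum_smul, smul_eq_mul]
  refine (sum_reorder fun x x1 x2 x3 i1 => _).trans ?_
  simp only [mul_comm]

theorem coadj_add (f g : H →ₗ[K] K) (y : H) : coadj (f + g) y = coadj f y + coadj g y := by
  refine ext_mc fun i j => ?_
  simp [coadj_mc, add_smul, Finset.sum_add_distrib]

theorem coadj_smul (c : K) (f : H →ₗ[K] K) (y : H) : coadj (c • f) y = c • coadj f y := by
  refine ext_mc fun i j => ?_
  simp [coadj_mc, Finset.smul_sum, smul_smul]

/-- `coadj` as a linear map in its functional argument. -/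
noncomputable def coadjL (y : H) : (H →ₗ[K] K) →ₗ[K] Module.End K H where
  toFun f := coadj f y
  map_add' f g := coadj_add f g y
  map_smul' c f := coadj_smul c f y

variable (K H) in
/-- The free Yetter–Drinfeld module on the regular comodule. -/
noncomputable def freeDRep : DRep K H (Matrix (Fin (Module.finrank K H)) (Fin (Module.finrank K H))
    (Module.End K H)) where
  π := (Matrix.scalarAlgHom (Fin (Module.finrank K H)) K).comp (Algebra.lmul K H)
  P :=
    { toFun := fun f => Matrix.of fun s k => coadj f (mc K H k s)
      map_add' := fun f g => by ext1 s k; simp [coadj_add]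
      map_smul' := fun f g => by ext1 s k; simp [coadj_smul] }
  P_counit := by
    ext1 s k
    simp [coadj_counit, counit_mc, Matrix.one_apply, eq_comm]
    rfl
  P_mul := fun f g => by
    ext1 s k
    refine ext_mc fun i j => ?_
    simp [Matrix.mul_apply, coadj_comp]
  yd := fun f i j => by
    ext1 s k
    refine LinearMap.ext fun h => ?_
    have h1 : ∀ x, ((Matrix.scalarAlgHom (Fin (Module.finrank K H)) K).comp (Algebra.lmul K H)) x =
      Matrix.scalar _ (mulLeft K x) := fun x => rfl
    have h2 : ∀ p l, ∑ x, coadj (((f ∘ₗ mulRight K (mc K H x j)) ∘ₗ mulLeft K (mc K H i p)) ∘ₗ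
        mulRight K (antipode K (mc K H l x))) (mc K H k s) =
        if l = j then coadj (f ∘ₗ mulLeft K (mc K H i p)) (mc K H k s) else 0 := by
      intro p l
      have : ∑ x, ((f ∘ₗ mulRight K (mc K H x j)) ∘ₗ mulLeft K (mc K H i p)) ∘ₗ
        mulRight K (antipode K (mc K H l x)) = if l = j then f ∘ₗ mulLeft K (mc K H i p) else 0 := by
        refine LinearMap.ext fun a => ?_
        have := congr_arg (fun z => f (mc K H i p * a * z)) (sum_antipode_mul_mc (K := K) (H := H) l j)
        simp only [Finset.mul_sum, map_sum] at this
        simp only [LinearMap.sum_apply, LinearMap.comp_apply, mulLeft_apply, mulRight_apply, ← mul_assoc] at this ⊢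
        rw [this]
        split_ifs <;> simp
      have h3 := congr_arg (fun g => coadjL (mc K H k s) g) this
      simp only [map_sum] at h3
      refine Eq.trans h3 ?_
      split_ifs
      · rfl
      · exact map_zero _
    simp only [h1, LinearMap.coe_mk, AddHom.coe_mk, Matrix.sum_apply, Matrix.scalar_apply, Matrix.diagonal_mul, Matrix.mul_diagonal, Matrix.of_apply, LinearMap.sum_apply, Module.End.mul_apply, mulLeft_apply, coadj_mc_mul]
    rw [Finset.sum_comm]
    refine Finset.sum_congr rfl fun p _ => ?_
    rw [Finset.sum_comm]
    have h4 := fun l => LinearMap.congr_fun (h2 p l) h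
    simp only [LinearMap.sum_apply, LinearMap.comp_assoc] at h4
    simp only [← Finset.mul_sum, LinearMap.comp_assoc, h4]
    rw [Finset.sum_eq_single j]
    · simp
    · intro b _ hb; simp [hb]
    · simp

end

section

variable {K H}
variable [FiniteDimensional K H]

theorem sum_coord_comp {V : Type*} [AddCommGroup V] [Module K V]
    (B : H →ₗ[K] (H →ₗ[K] K) →ₗ[K] V) (φ : H →ₗ[K] H) :
    ∑ i, B (𝐛 i) ((𝐛).coord i ∘ₗ φ) = ∑ i, B (φ (𝐛 i)) ((𝐛).coord i) := by
  have h1 : ∀ i, (𝐛).coord i ∘ₗ φ = ∑ j, (𝐛).coord i (φ (𝐛 j)) • (𝐛).coord j := fun i =>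
    (𝐛).ext fun j => by simp [Finsupp.single_apply]
  simp_rw [h1, map_sum, map_smul]
  rw [Finset.sum_comm]
  refine Finset.sum_congr rfl fun j _ => ?_
  have := congr_arg (fun z => B z ((𝐛).coord j)) ((𝐛).sum_repr (φ (𝐛 j)))
  simpa only [map_sum, map_smul, LinearMap.sum_apply, LinearMap.smul_apply,
    Module.Basis.coord_apply] using this

theorem sum_smul_coord {V : Type*} [AddCommGroup V] [Module K V]
    (F : (H →ₗ[K] K) →ₗ[K] V) (f : H →ₗ[K] K) : ∑ i, f (𝐛 i) • F ((𝐛).coord i) = F f := by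
  have : f = ∑ i, f (𝐛 i) • (𝐛).coord i := (𝐛).ext fun j => by simp
  conv_rhs => rw [this, map_sum]
  simp

namespace DRep

variable {A B : Type} [Ring A] [Algebra K A] [Ring B] [Algebra K B]
variable (X : DRep K H A)

/-- `T θ = Σ π(θ bᵢ) P(bⁱ)`. -/
noncomputable def T : (H →ₗ[K] H) →ₗ[K] A :=
  ∑ i, mulRight K (X.P ((𝐛).coord i)) ∘ₗ X.π.toLinearMap ∘ₗ LinearMap.applyₗ (𝐛 i)

theorem T_apply (θ : H →ₗ[K] H) : X.T θ = ∑ i, X.π (θ (𝐛 i)) * X.P ((𝐛).coord i) := by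
  simp [T]

theorem π_mul_T (h : H) (θ : H →ₗ[K] H) : X.π h * X.T θ = X.T (mulLeft K h ∘ₗ θ) := by
  simp [T_apply, Finset.mul_sum, mul_assoc]

theorem sum_π_mul_P (θ φ : H →ₗ[K] H) :
    ∑ i, X.π (θ (𝐛 i)) * X.P ((𝐛).coord i ∘ₗ φ) = X.T (θ ∘ₗ φ) := by
  have := sum_coord_comp ((LinearMap.mul K A).compl₁₂ (X.π.toLinearMap ∘ₗ θ) X.P) φ
  simpa [T_apply] using this

theorem T_mul_P (θ : H →ₗ[K] H) (g : H →ₗ[K] K) : X.T θ * X.P g = X.T (θ ∘ₗ hitR g) := by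
  rw [← sum_π_mul_P, T_apply, Finset.sum_mul]
  simp [mul_assoc, X.P_mul, convF_eq]

theorem T_smulRight (f : H →ₗ[K] K) (h : H) : X.T (f.smulRight h) = X.π h * X.P f := by
  rw [T_apply, ← sum_smul_coord X.P f]
  simp [Finset.mul_sum]

theorem T_counit : X.T ((counit (R := K)).smulRight 1) = 1 := by
  rw [T_smulRight, X.P_counit, map_one, one_mul]

theorem P_mul_π_mc (f : H →ₗ[K] K) (i j) : X.P f * X.π (mc K H i j) =
    ∑ k, ∑ l, X.π (mc K H k l) *
      X.P (f ∘ₗ mulLeft K (mc K H i k) ∘ₗ mulRight K (antipode K (mc K H l j))) := by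
  have h := fun l => X.yd (f ∘ₗ mulRight K (antipode K (mc K H l j))) i l
  have h2 : ∀ k, ∑ l, X.P ((f ∘ₗ mulRight K (antipode K (mc K H l j))) ∘ₗ mulRight K (mc K H k l))
      = if k = j then X.P f else 0 := fun k => by
    rw [← map_sum]
    have : ∑ l, (f ∘ₗ mulRight K (antipode K (mc K H l j))) ∘ₗ mulRight K (mc K H k l) =
        if k = j then f else 0 := by
      refine LinearMap.ext fun a => ?_
      have := congr_arg (fun z => f (a * z)) (sum_mc_mul_antipode (K := K) (H := H) k j)
      simp only [Finset.mul_sum, map_sum] at this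
      simp only [LinearMap.sum_apply, LinearMap.comp_apply, mulRight_apply, mul_assoc] at this ⊢
      rw [this]
      split_ifs <;> simp
    rw [this]
    split_ifs <;> simp
  rw [Finset.sum_comm]
  have e : ∀ k l, f ∘ₗ mulLeft K (mc K H i k) ∘ₗ mulRight K (antipode K (mc K H l j)) =
      (f ∘ₗ mulRight K (antipode K (mc K H l j))) ∘ₗ mulLeft K (mc K H i k) := fun k l => by
    ext; simp [mul_assoc]
  simp_rw [e, h]
  rw [Finset.sum_comm]
  simp_rw [← Finset.sum_mul, h2]
  simp

theorem π_mul_P_mc (f : H →ₗ[K] K) (i j) : X.π (mc K H i j) * X.P f =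
    ∑ k, ∑ l, X.P (f ∘ₗ mulLeft K (antipode K (mc K H i k)) ∘ₗ mulRight K (mc K H l j)) *
      X.π (mc K H k l) := by
  have h := fun k => X.yd (f ∘ₗ mulLeft K (antipode K (mc K H i k))) k j
  have h2 : ∀ l, ∑ k, X.P ((f ∘ₗ mulLeft K (antipode K (mc K H i k))) ∘ₗ mulLeft K (mc K H k l))
      = if i = l then X.P f else 0 := fun l => by
    rw [← map_sum]
    have : ∑ k, (f ∘ₗ mulLeft K (antipode K (mc K H i k))) ∘ₗ mulLeft K (mc K H k l) =
        if i = l then f else 0 := by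
      refine LinearMap.ext fun a => ?_
      have := congr_arg (fun z => f (z * a)) (sum_antipode_mul_mc (K := K) (H := H) i l)
      simp only [Finset.sum_mul, map_sum] at this
      simp only [LinearMap.sum_apply, LinearMap.comp_apply, mulLeft_apply, ← mul_assoc] at this ⊢
      rw [this]
      split_ifs <;> simp
    rw [this]
    split_ifs <;> simp
  simp_rw [← LinearMap.comp_assoc, ← h]
  rw [Finset.sum_comm]
  simp_rw [← Finset.mul_sum, h2]
  simp

end DRep

/-- `x ↦ coadj f x h`. -/
noncomputable def coadjY (f : H →ₗ[K] K) (h : H) : H →ₗ[K] H where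
  toFun x := coadj f x h
  map_add' x y := by
    have : coadj f (x + y) = coadj f x + coadj f y :=
      ext_mc fun i j => by simp [coadj_mc, mul_add, add_mul, add_smul, Finset.sum_add_distrib]
    rw [this, LinearMap.add_apply]
  map_smul' c x := by
    have : coadj f (c • x) = c • coadj f x :=
      ext_mc fun i j => by simp [coadj_mc, Finset.smul_sum, smul_smul]
    rw [this, LinearMap.smul_apply, RingHom.id_apply]

theorem coadjY_apply (f : H →ₗ[K] K) (h x : H) : coadjY f h x = coadj f x h := rfl

theorem coadjY_mc (f : H →ₗ[K] K) (i j) : coadjY f (mc K H i j) = ∑ k, ∑ l,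
    (f ∘ₗ mulLeft K (mc K H i k) ∘ₗ mulRight K (antipode K (mc K H l j))).smulRight
      (mc K H k l) := by
  ext x
  simp [coadjY_apply, coadj_mc, mul_assoc]

/-- The product on `H →ₗ H` transported along `T`. -/
noncomputable def dmul (θ η : H →ₗ[K] H) : H →ₗ[K] H :=
  ∑ q, (∑ p, mulLeft K (θ (𝐛 p)) ∘ₗ coadjY ((𝐛).coord p) (η (𝐛 q))) ∘ₗ hitR ((𝐛).coord q)

namespace DRep

variable {A B : Type} [Ring A] [Algebra K A] [Ring B] [Algebra K B]
variable (X : DRep K H A)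

theorem P_mul_π (f : H →ₗ[K] K) (h : H) : X.P f * X.π h = X.T (coadjY f h) := by
  obtain ⟨c, rfl⟩ := exists_matrix (K := K) h
  have : coadjY f (∑ i, ∑ j, c i j • mc K H i j) = ∑ i, ∑ j, c i j • coadjY f (mc K H i j) := by
    ext x
    simp [coadjY_apply]
  rw [this]
  simp [P_mul_π_mc, Finset.mul_sum, coadjY_mc, T_smulRight]

theorem T_mul_T (θ η : H →ₗ[K] H) : X.T θ * X.T η = X.T (dmul θ η) := by
  rw [dmul, map_sum, T_apply X η, Finset.mul_sum]
  refine Finset.sum_congr rfl fun q _ => ?_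
  rw [← mul_assoc, ← T_mul_P, map_sum, T_apply, Finset.sum_mul]
  simp [mul_assoc, P_mul_π, π_mul_T]

theorem T_freeDRep_injective : Function.Injective (freeDRep K H).T := by
  rw [← LinearMap.ker_eq_bot, LinearMap.ker_eq_bot']
  intro θ hθ
  refine ext_mc fun k s => ?_
  have := LinearMap.congr_fun (congr_fun (congr_fun hθ s) k) 1
  rw [T_apply] at this
  have h1 : ∀ x, (freeDRep K H).π x = Matrix.scalar _ (mulLeft K x) := fun x => rfl
  have h2 : ∀ f, (freeDRep K H).P f = Matrix.of fun s k => coadj f (mc K H k s) := fun x => rfl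
  simp only [Matrix.sum_apply, LinearMap.sum_apply, h1, h2, Matrix.scalar_apply,
    Matrix.diagonal_mul, Matrix.of_apply, Module.End.mul_apply, coadj_one, mulLeft_apply,
    mul_smul_comm, mul_one] at this
  rw [sum_dual_smul 𝐛 θ] at this
  simpa using this

/-- The algebra generated by the coefficients of the free module: a model of the double. -/
noncomputable def double (K : Type) [Field K] (H : Type) [Ring H] [HopfAlgebra K H]
    [FiniteDimensional K H] : Subalgebra K (Matrix (Fin (Module.finrank K H))
      (Fin (Module.finrank K H)) (Module.End K H)) where
  carrier := Set.range (freeDRep K H).T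
  mul_mem' := by
    rintro _ _ ⟨θ, rfl⟩ ⟨η, rfl⟩
    exact ⟨_, (T_mul_T _ θ η).symm⟩
  add_mem' := by
    rintro _ _ ⟨θ, rfl⟩ ⟨η, rfl⟩
    exact ⟨θ + η, map_add _ _ _⟩
  algebraMap_mem' c := ⟨c • (counit (R := K)).smulRight 1, by
    rw [map_smul, T_counit, Algebra.algebraMap_eq_smul_one]⟩

theorem π_mem_double (h : H) : (freeDRep K H).π h ∈ double K H :=
  ⟨(counit (R := K)).smulRight h, by rw [T_smulRight, P_counit, mul_one]⟩

theorem P_mem_double (f : H →ₗ[K] K) : (freeDRep K H).P f ∈ double K H :=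
  ⟨f.smulRight 1, by rw [T_smulRight, map_one, one_mul]⟩

variable (K H) in
/-- The tautological structure with values in the double. -/
noncomputable def univ : DRep K H (double K H) where
  π := (freeDRep K H).π.codRestrict _ π_mem_double
  P := (freeDRep K H).P.codRestrict (Subalgebra.toSubmodule (double K H)) P_mem_double
  P_counit := Subtype.ext (freeDRep K H).P_counit
  P_mul f g := Subtype.ext ((freeDRep K H).P_mul f g)
  yd f i j := Subtype.ext (by
    simp only [AddSubmonoidClass.coe_finsetSum, MulMemClass.coe_mul, AlgHom.coe_codRestrict]
    exact (freeDRep K H).yd f i j)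

theorem coe_T_univ (θ : H →ₗ[K] H) : ((univ K H).T θ : Matrix _ _ _) = (freeDRep K H).T θ := by
  simp [T_apply]
  rfl

theorem T_univ_bijective : Function.Bijective (univ K H).T := by
  refine ⟨fun θ η h => T_freeDRep_injective ?_, fun ⟨x, θ, hθ⟩ => ⟨θ, Subtype.ext ?_⟩⟩
  · rw [← coe_T_univ, h, coe_T_univ]
  · rw [coe_T_univ, hθ]

/-- `T` for the double as a linear equivalence. -/
noncomputable def TE : (H →ₗ[K] H) ≃ₗ[K] double K H :=
  LinearEquiv.ofBijective (univ K H).T T_univ_bijective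

theorem TE_apply (θ : H →ₗ[K] H) : TE θ = (univ K H).T θ := rfl

/-- The algebra map out of the double classifying a Yetter–Drinfeld structure. -/
noncomputable def Φ : double K H →ₐ[K] A :=
  AlgHom.ofLinearMap (X.T ∘ₗ TE.symm.toLinearMap)
    (by
      have : TE.symm (1 : double K H) = (counit (R := K)).smulRight 1 := by
        rw [LinearEquiv.symm_apply_eq, TE_apply, T_counit]
      simp [this, T_counit])
    (fun a b => by
      obtain ⟨θ, rfl⟩ := TE.surjective a
      obtain ⟨η, rfl⟩ := TE.surjective b
      have : TE.symm (TE θ * TE η) = dmul θ η := by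
        rw [LinearEquiv.symm_apply_eq, TE_apply, TE_apply, TE_apply, T_mul_T]
      simp [this, T_mul_T])

theorem Φ_T (θ : H →ₗ[K] H) : X.Φ ((univ K H).T θ) = X.T θ := by
  rw [← TE_apply]
  simp [Φ]

theorem Φ_π (h : H) : X.Φ ((univ K H).π h) = X.π h := by
  have := Φ_T X ((counit (R := K)).smulRight h)
  simpa [T_smulRight, P_counit] using this

theorem Φ_P (f : H →ₗ[K] K) : X.Φ ((univ K H).P f) = X.P f := by
  have := Φ_T X (f.smulRight 1)
  simpa [T_smulRight] using this

end DRep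

end

section

variable {K H}
variable [FiniteDimensional K H]

/-- The convolution product of linear endomorphisms. -/
noncomputable def star (θ χ : H →ₗ[K] H) : H →ₗ[K] H :=
  mul' K H ∘ₗ TensorProduct.map θ χ ∘ₗ comul (R := K)

theorem star_mc (θ χ : H →ₗ[K] H) (i j) :
    star θ χ (mc K H i j) = ∑ k, θ (mc K H i k) * χ (mc K H k j) := by
  simp [star, comul_mc]

theorem star_eq_sum (θ χ : H →ₗ[K] H) :
    star θ χ = ∑ p, mulLeft K (θ (𝐛 p)) ∘ₗ χ ∘ₗ hitR ((𝐛).coord p) := by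
  refine ext_mc fun i j => ?_
  simp only [star_mc, LinearMap.sum_apply, LinearMap.comp_apply, hitR_mc, mulLeft_apply, map_sum,
    map_smul]
  rw [Finset.sum_comm]
  refine Finset.sum_congr rfl fun k _ => ?_
  exact (sum_dual_smul 𝐛 (mulRight K (χ (mc K H k j)) ∘ₗ θ) (mc K H i k)).symm

namespace DRep

variable {A B : Type} [Ring A] [Algebra K A] [Ring B] [Algebra K B]
variable (X : DRep K H A) (Y : DRep K H B)

/-- The character of a functional `t`, as an endomorphism of `H`. -/
noncomputable def chi (t : A →ₗ[K] K) : H →ₗ[K] H :=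
  ∑ i, (t ∘ₗ mulLeft K (X.P ((𝐛).coord i)) ∘ₗ X.π.toLinearMap).smulRight (𝐛 i)

theorem apply_chi (t : A →ₗ[K] K) (f : H →ₗ[K] K) (h : H) :
    f (X.chi t h) = t (X.P f * X.π h) := by
  rw [← sum_smul_coord X.P f]
  simp [chi, Finset.sum_mul, mul_comm]

theorem apply_T (t : A →ₗ[K] K) (θ : H →ₗ[K] H) (ht : ∀ a b, t (a * b) = t (b * a)) :
    t (X.T θ) = LinearMap.trace K H (X.chi t ∘ₗ θ) := by
  rw [LinearMap.trace_eq_matrix_trace K 𝐛, Matrix.trace]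
  simp only [T_apply, map_sum, Matrix.diag_apply, LinearMap.toMatrix_apply]
  refine Finset.sum_congr rfl fun i _ => ?_
  rw [ht, ← apply_chi]
  rfl

variable (𝓱 : HaarData K H)
include 𝓱

theorem mc_mul_chi {t : A →ₗ[K] K} (ht : ∀ a b, t (a * b) = t (b * a)) (i j) (b : H) :
    mc K H i j * X.chi t b = ∑ k, ∑ l,
      X.chi t (mc K H i k * b * antipode K (mc K H l j)) * mc K H k l := by
  refine eq_of_dual_eq (K := K) fun f => ?_
  have h1 : f (mc K H i j * X.chi t b) = t (X.P (f ∘ₗ mulLeft K (mc K H i j)) * X.π b) := by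
    rw [← apply_chi]; rfl
  have h2 : ∀ x y, f (X.chi t x * y) = t (X.P (f ∘ₗ mulRight K y) * X.π x) := fun x y => by
    rw [← apply_chi]; rfl
  have h3 : ∀ l, ∑ k, f (X.chi t (mc K H i k * b * antipode K (mc K H l j)) * mc K H k l) =
    ∑ k, t (X.P (f ∘ₗ mulLeft K (mc K H i k)) * X.π b *
      X.π (antipode K (mc K H l j) * mc K H k l)) := fun l => by
    have := congr_arg (fun z => t (z * X.π b * X.π (antipode K (mc K H l j)))) (X.yd f i l)
    simp only [Finset.sum_mul, map_sum] at this
    simp_rw [h2, map_mul]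
    refine Eq.trans ?_ (this.symm.trans ?_)
    · simp only [mul_assoc]
    · refine Finset.sum_congr rfl fun k _ => ?_
      rw [mul_assoc, mul_assoc, ht]
      simp only [mul_assoc]
  rw [h1]
  simp only [map_sum]
  rw [Finset.sum_comm]
  simp_rw [h3]
  rw [Finset.sum_comm]
  simp_rw [← map_sum, ← Finset.mul_sum, ← map_sum, 𝓱.sum_antipode_mul_mc']
  rw [Finset.sum_eq_single j] <;> simp +contextual

theorem T_chi_mul_π {t : A →ₗ[K] K} (ht : ∀ a b, t (a * b) = t (b * a)) (h : H) :
    Y.T (X.chi t) * Y.π h = Y.π h * Y.T (X.chi t) := by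
  obtain ⟨c, rfl⟩ := exists_matrix (K := K) h
  suffices ∀ i j, Y.T (X.chi t) * Y.π (mc K H i j) = Y.π (mc K H i j) * Y.T (X.chi t) by
    simp [Finset.mul_sum, Finset.sum_mul, this]
  intro i j
  rw [π_mul_T, T_apply, Finset.sum_mul]
  simp_rw [mul_assoc, P_mul_π_mc, Finset.mul_sum, ← mul_assoc, ← map_mul]
  rw [Finset.sum_comm]
  have h1 : ∀ k l, ∑ p, Y.π (X.chi t (𝐛 p) * mc K H k l) * Y.P ((𝐛).coord p ∘ₗ
      mulLeft K (mc K H i k) ∘ₗ mulRight K (antipode K (mc K H l j))) =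
      Y.T ((mulRight K (mc K H k l) ∘ₗ X.chi t) ∘ₗ
        mulLeft K (mc K H i k) ∘ₗ mulRight K (antipode K (mc K H l j))) := fun k l =>
    Y.sum_π_mul_P (mulRight K (mc K H k l) ∘ₗ X.chi t) _
  have h2 : mulLeft K (mc K H i j) ∘ₗ X.chi t = ∑ k, ∑ l, (mulRight K (mc K H k l) ∘ₗ X.chi t) ∘ₗ
        mulLeft K (mc K H i k) ∘ₗ mulRight K (antipode K (mc K H l j)) := by
    ext b
    simp [mc_mul_chi X 𝓱 ht, mul_assoc]
  rw [h2]
  simp_rw [map_sum, ← h1]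
  refine Finset.sum_congr rfl fun k _ => ?_
  rw [Finset.sum_comm]

theorem sum_convF_coord (f : H →ₗ[K] K) (m : H) :
    ∑ b, convF ((𝐛).coord b) (f ∘ₗ mulLeft K m ∘ₗ mulRight K (antipode K (𝐛 b))) =
      f m • counit (R := K) := by
  refine ext_mc fun p q => ?_
  have h1 : ∀ k, ∑ b, (𝐛).coord b (mc K H p k) * f (m * (mc K H k q * antipode K (𝐛 b))) =
    f (m * (mc K H k q * antipode K (mc K H p k))) := fun k =>
    sum_dual_smul 𝐛 (f ∘ₗ mulLeft K m ∘ₗ mulLeft K (mc K H k q) ∘ₗ antipode K) (mc K H p k)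
  simp only [LinearMap.sum_apply, convF_mc, LinearMap.comp_apply, mulLeft_apply, mulRight_apply]
  rw [Finset.sum_comm]
  simp_rw [h1, ← map_sum, ← Finset.mul_sum, 𝓱.sum_mc_mul_antipode', LinearMap.smul_apply,
    counit_mc]
  split_ifs <;> simp

omit 𝓱 in
theorem P_comp_coadj (f g : H →ₗ[K] K) (y : H) : X.P (g ∘ₗ coadj f y) =
    ∑ b, X.P ((𝐛).coord b) * X.P g *
      X.P ((f ∘ₗ mulRight K (antipode K (𝐛 b))) ∘ₗ mulRight K y) := by
  simp_rw [P_mul, ← map_sum]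
  congr 1
  refine ext_mc fun p q => ?_
  have h1 : ∀ l h : H, ∑ b, (𝐛).coord b l * f (h * y * antipode K (𝐛 b)) =
    f (h * y * antipode K l) := fun l h =>
    sum_dual_smul 𝐛 (f ∘ₗ mulLeft K (h * y) ∘ₗ antipode K) l
  simp only [LinearMap.sum_apply, convF_mc, LinearMap.comp_apply, mulRight_apply, coadj_mc,
    map_sum, map_smul, smul_eq_mul]
  conv_rhs => rw [Finset.sum_comm]
  refine Finset.sum_congr rfl fun k _ => ?_
  have h2 : ∀ l, f (mc K H p k * y * antipode K (mc K H l q)) * g (mc K H k l) =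
      ∑ b, (𝐛).coord b (mc K H l q) * f (mc K H p k * y * antipode K (𝐛 b)) * g (mc K H k l) :=
    fun l => by rw [← h1, Finset.sum_mul]
  simp_rw [h2, Finset.mul_sum]
  rw [Finset.sum_comm]
  refine Finset.sum_congr rfl fun b _ => Finset.sum_congr rfl fun l _ => ?_
  ring

theorem sum_coadj_chi {t : A →ₗ[K] K} (ht : ∀ a b, t (a * b) = t (b * a)) (f : H →ₗ[K] K) (i j) :
    ∑ k, coadj f (mc K H k j) (X.chi t (mc K H i k)) =
      ∑ k, f (mc K H i k) • X.chi t (mc K H k j) := by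
  refine eq_of_dual_eq (K := K) fun g => ?_
  have h1 : ∀ k, g (coadj f (mc K H k j) (X.chi t (mc K H i k))) =
      t (X.P (g ∘ₗ coadj f (mc K H k j)) * X.π (mc K H i k)) := fun k => by
    rw [← apply_chi]; rfl
  have h2 : ∀ b, ∑ k, t (X.P ((𝐛).coord b) * X.P g *
      X.P ((f ∘ₗ mulRight K (antipode K (𝐛 b))) ∘ₗ mulRight K (mc K H k j)) * X.π (mc K H i k)) =
      ∑ k, t (X.P g * X.π (mc K H k j) *
        X.P (convF ((𝐛).coord b) (f ∘ₗ mulLeft K (mc K H i k) ∘ₗ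
          mulRight K (antipode K (𝐛 b))))) := fun b => by
    have := congr_arg (fun z => t (X.P ((𝐛).coord b) * X.P g * z))
      (X.yd (f ∘ₗ mulRight K (antipode K (𝐛 b))) i j)
    simp only [Finset.mul_sum, map_sum] at this
    refine Eq.trans ?_ (this.symm.trans ?_)
    · simp only [mul_assoc]
    · refine Finset.sum_congr rfl fun k _ => ?_
      rw [← P_mul, mul_assoc, ht]
      have : (f ∘ₗ mulRight K (antipode K (𝐛 b))) ∘ₗ mulLeft K (mc K H i k) =
        f ∘ₗ mulLeft K (mc K H i k) ∘ₗ mulRight K (antipode K (𝐛 b)) := by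
        ext; simp [mul_assoc]
      rw [this]
      simp only [mul_assoc]
  simp_rw [map_sum, h1, P_comp_coadj, Finset.sum_mul, map_sum]
  rw [Finset.sum_comm]
  simp_rw [h2]
  rw [Finset.sum_comm]
  simp_rw [← map_sum, ← Finset.mul_sum, ← map_sum, sum_convF_coord 𝓱]
  simp [P_counit, apply_chi]

theorem P_mul_T_chi {t : A →ₗ[K] K} (ht : ∀ a b, t (a * b) = t (b * a)) (f : H →ₗ[K] K) :
    Y.P f * Y.T (X.chi t) = Y.T (X.chi t) * Y.P f := by
  rw [T_mul_P, T_apply, Finset.mul_sum]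
  simp_rw [← mul_assoc, P_mul_π, T_mul_P, ← map_sum]
  congr 1
  refine ext_mc fun i j => ?_
  have h1 : ∀ k, ∑ b, (𝐛).coord b (mc K H i k) • coadj f (mc K H k j) (X.chi t (𝐛 b)) =
    coadj f (mc K H k j) (X.chi t (mc K H i k)) := fun k =>
    sum_dual_smul 𝐛 (coadj f (mc K H k j) ∘ₗ X.chi t) (mc K H i k)
  simp only [LinearMap.sum_apply, LinearMap.comp_apply, hitR_mc, coadjY_apply, map_sum, map_smul]
  rw [Finset.sum_comm, ← sum_coadj_chi X 𝓱 ht]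
  exact Finset.sum_congr rfl fun k _ => h1 k

theorem T_mul_T_chi {t : A →ₗ[K] K} (ht : ∀ a b, t (a * b) = t (b * a)) (θ : H →ₗ[K] H) :
    Y.T θ * Y.T (X.chi t) = Y.T (star θ (X.chi t)) := by
  rw [T_apply, Finset.sum_mul, star_eq_sum, map_sum]
  refine Finset.sum_congr rfl fun p _ => ?_
  rw [mul_assoc, P_mul_T_chi X Y 𝓱 ht, ← mul_assoc, π_mul_T, T_mul_P]
  rfl

theorem T_chi_comm {t : A →ₗ[K] K} (ht : ∀ a b, t (a * b) = t (b * a)) (θ : H →ₗ[K] H) :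
    Y.T θ * Y.T (X.chi t) = Y.T (X.chi t) * Y.T θ := by
  rw [T_apply Y θ, Finset.sum_mul, Finset.mul_sum]
  refine Finset.sum_congr rfl fun p _ => ?_
  rw [mul_assoc, P_mul_T_chi X Y 𝓱 ht, ← mul_assoc, ← T_chi_mul_π X Y 𝓱 ht, mul_assoc]

end DRep

end

section

variable {K H}
variable [FiniteDimensional K H]

namespace HaarData
variable (𝓱 : HaarData K H)

theorem mc_mul_comul_Λ (i j) :
    (mc K H i j ⊗ₜ[K] 1) * lTensor H (antipode K) (comul (R := K) 𝓱.Λ) =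
      lTensor H (antipode K) (comul (R := K) 𝓱.Λ) * (1 ⊗ₜ[K] mc K H i j) := by
  have h1 : ∀ i r, ∑ k, (mc K H i k ⊗ₜ[K] 1) * lTensor H (antipode K) (comul (R := K) 𝓱.Λ) *
      (1 ⊗ₜ[K] antipode K (mc K H k r)) =
      (if i = r then lTensor H (antipode K) (comul (R := K) 𝓱.Λ) else 0) := fun i r => by
    have := congr_arg (fun z => lTensor H (antipode K) (comul (R := K) z)) (𝓱.mul_Λ (mc K H i r))
    simp only [Bialgebra.comul_mul, comul_mc, Finset.sum_mul, map_sum, map_smul, counit_mc] at this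
    rw [ite_smul, one_smul, zero_smul] at this
    rw [← this]
    refine Finset.sum_congr rfl fun k _ => ?_
    generalize comul (R := K) 𝓱.Λ = t
    induction t with
    | zero => simp
    | tmul a b => simp [antipode_mul_antidistrib]
    | add x y hx hy => simp only [map_add, mul_add, add_mul, hx, hy]
  have h2 := congr_arg (fun z : Fin _ → H ⊗[K] H => ∑ r, z r * (1 ⊗ₜ[K] mc K H r j))
    (funext (h1 i))
  simp only [Finset.sum_mul, ite_mul, zero_mul, Finset.sum_ite_eq, Finset.mem_univ, if_true] at h2
  rw [← h2, Finset.sum_comm]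
  simp_rw [mul_assoc, ← Finset.mul_sum, Algebra.TensorProduct.tmul_mul_tmul, one_mul,
    ← tmul_sum, sum_antipode_mul_mc]
  rw [Finset.sum_eq_single j]
  · simp [← Algebra.TensorProduct.one_def]
  · simp +contextual
  · simp

theorem convF_lam (b : H) (f : H →ₗ[K] K) :
    convF (𝓱.lam ∘ₗ mulRight K (antipode K b)) f =
      𝓱.lam ∘ₗ mulRight K (antipode K (hitR f b)) := by
  refine LinearMap.ext fun x => ?_
  rw [convF_eq, LinearMap.comp_apply, hitR_comp_mulRight 𝓱.hitR_lam, comul_antipode,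
    LinearMap.comp_apply, mulRight_apply, hitR_apply]
  generalize comul (R := K) b = t
  induction t with
  | zero => simp
  | tmul u v => simp [𝓱.sq, mul_comm]
  | add u v hu hv => simp only [map_add, mul_add, hu, hv]

end HaarData

namespace DRep

variable {A B : Type} [Ring A] [Algebra K A] [Ring B] [Algebra K B]
variable (X : DRep K H A) (Y : DRep K H B) (𝓱 : HaarData K H)

/-- `Σ π(Λ₍₁₎) ⊗ π(S(Λ₍₂₎))`. -/
noncomputable def sepH : A ⊗[K] A :=
  TensorProduct.map X.π.toLinearMap X.π.toLinearMap
    (lTensor H (antipode K) (comul (R := K) 𝓱.Λ))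

/-- The separability element of the double. -/
noncomputable def sep : A ⊗[K] A :=
  ∑ b, (X.P (𝓱.lam ∘ₗ mulRight K (antipode K (𝐛 b))) ⊗ₜ[K] 1) * X.sepH 𝓱 *
    (1 ⊗ₜ[K] X.P ((𝐛).coord b))

theorem π_mc_mul_sepH (i j) : (X.π (mc K H i j) ⊗ₜ[K] 1) * X.sepH 𝓱 =
    X.sepH 𝓱 * (1 ⊗ₜ[K] X.π (mc K H i j)) := by
  have h : ∀ x, TensorProduct.map X.π.toLinearMap X.π.toLinearMap x =
    Algebra.TensorProduct.map X.π X.π x := fun x => rfl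
  have := congr_arg (Algebra.TensorProduct.map X.π X.π) (𝓱.mc_mul_comul_Λ i j)
  simpa [sepH, h] using this

/-- The bilinear map `(x, g) ↦ (P(λ(· S x)) ⊗ 1) c (1 ⊗ d P(g))`. -/
noncomputable def sepB (c d : A ⊗[K] A) : H →ₗ[K] (H →ₗ[K] K) →ₗ[K] A ⊗[K] A :=
  LinearMap.mk₂ K (fun x g => (X.P (𝓱.lam ∘ₗ mulRight K (antipode K x)) ⊗ₜ[K] 1) * c *
    (d * (1 ⊗ₜ[K] X.P g)))
    (by
      intro x y g
      have : 𝓱.lam ∘ₗ mulRight K (antipode K (x + y)) = 𝓱.lam ∘ₗ mulRight K (antipode K x) +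
        𝓱.lam ∘ₗ mulRight K (antipode K y) := by ext; simp [mul_add]
      rw [this]
      simp [add_tmul, add_mul])
    (by
      intro r x g
      have : 𝓱.lam ∘ₗ mulRight K (antipode K (r • x)) =
        r • (𝓱.lam ∘ₗ mulRight K (antipode K x)) := by ext; simp
      rw [this]
      simp [← smul_tmul'])
    (by intros; simp [tmul_add, mul_add])
    (by intros; simp)

theorem sepB_apply (c d : A ⊗[K] A) (x : H) (g : H →ₗ[K] K) : X.sepB 𝓱 c d x g =
    (X.P (𝓱.lam ∘ₗ mulRight K (antipode K x)) ⊗ₜ[K] 1) * c * (d * (1 ⊗ₜ[K] X.P g)) := rfl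

theorem P_mul_sep (f : H →ₗ[K] K) :
    (X.P f ⊗ₜ[K] 1) * X.sep 𝓱 = X.sep 𝓱 * (1 ⊗ₜ[K] X.P f) := by
  have h1 : ∀ x, X.P f * X.P (𝓱.lam ∘ₗ mulRight K (antipode K x)) =
      X.P (𝓱.lam ∘ₗ mulRight K (antipode K (hitR f x))) := fun x => by
    rw [P_mul, 𝓱.convF_lam]
  have h2 := sum_coord_comp (X.sepB 𝓱 (X.sepH 𝓱) 1) (hitR f)
  simp only [sepB_apply, one_mul] at h2
  simp only [sep, Finset.mul_sum, Finset.sum_mul, ← mul_assoc,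
    Algebra.TensorProduct.tmul_mul_tmul, one_mul, h1]
  rw [← h2]
  simp [mul_assoc, P_mul, convF_eq]

theorem π_mc_mul_sep (i j) :
    (X.π (mc K H i j) ⊗ₜ[K] 1) * X.sep 𝓱 = X.sep 𝓱 * (1 ⊗ₜ[K] X.π (mc K H i j)) := by
  have h1 : ∀ x k l, (𝓱.lam ∘ₗ mulRight K (antipode K x)) ∘ₗ mulLeft K (antipode K (mc K H i k)) ∘ₗ
      mulRight K (mc K H l j) = 𝓱.lam ∘ₗ mulRight K (antipode K
        ((mulLeft K (mc K H i k) ∘ₗ mulRight K (antipode K (mc K H l j))) x)) := fun x k l => by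
    ext y
    simp only [LinearMap.comp_apply, mulLeft_apply, mulRight_apply, antipode_mul_antidistrib, 𝓱.sq]
    rw [mul_assoc, 𝓱.lam_comm]
    simp only [mul_assoc]
  have h2 := fun k l => sum_coord_comp (X.sepB 𝓱 (X.sepH 𝓱) (1 ⊗ₜ[K] X.π (mc K H k l)))
    (mulLeft K (mc K H i k) ∘ₗ mulRight K (antipode K (mc K H l j)))
  simp only [sepB_apply] at h2
  simp only [sep, Finset.mul_sum, Finset.sum_mul, ← mul_assoc,
    Algebra.TensorProduct.tmul_mul_tmul, one_mul, π_mul_P_mc, sum_tmul, h1]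
  have h3 : ∀ a k l, (a * X.π (mc K H k l)) ⊗ₜ[K] (1 : A) * X.sepH 𝓱 =
    (a ⊗ₜ[K] 1) * X.sepH 𝓱 * (1 ⊗ₜ[K] X.π (mc K H k l)) := fun a k l => by
    rw [mul_assoc, ← π_mc_mul_sepH, ← mul_assoc]
    simp
  simp only [h3]
  have h4 : ∀ b, X.P (𝓱.lam ∘ₗ mulRight K (antipode K (𝐛 b))) ⊗ₜ[K] 1 * X.sepH 𝓱 *
      1 ⊗ₜ[K] X.P ((𝐛).coord b) * 1 ⊗ₜ[K] X.π (mc K H i j) =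
      ∑ k, ∑ l, X.P (𝓱.lam ∘ₗ mulRight K (antipode K (𝐛 b))) ⊗ₜ[K] 1 * X.sepH 𝓱 *
        (1 ⊗ₜ[K] X.π (mc K H k l) * 1 ⊗ₜ[K] X.P ((𝐛).coord b ∘ₗ
          mulLeft K (mc K H i k) ∘ₗ mulRight K (antipode K (mc K H l j)))) := fun b => by
    simp [mul_assoc, P_mul_π_mc, tmul_sum, Finset.mul_sum]
  simp_rw [h4]
  refine Finset.sum_comm.trans (Eq.trans ?_ Finset.sum_comm.symm)
  refine Finset.sum_congr rfl fun k _ => Finset.sum_comm.trans (Eq.trans ?_ Finset.sum_comm.symm)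
  refine Finset.sum_congr rfl fun l _ => ?_
  rw [h2]
  simp [mul_assoc]

theorem π_mul_sep (h : H) :
    (X.π h ⊗ₜ[K] 1) * X.sep 𝓱 = X.sep 𝓱 * (1 ⊗ₜ[K] X.π h) := by
  obtain ⟨c, rfl⟩ := exists_matrix (K := K) h
  simp [sum_tmul, tmul_sum, Finset.sum_mul, Finset.mul_sum, π_mc_mul_sep, ← smul_tmul']

theorem T_mul_sep (θ : H →ₗ[K] H) :
    (X.T θ ⊗ₜ[K] 1) * X.sep 𝓱 = X.sep 𝓱 * (1 ⊗ₜ[K] X.T θ) := by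
  rw [T_apply, sum_tmul, tmul_sum, Finset.sum_mul, Finset.mul_sum]
  refine Finset.sum_congr rfl fun i _ => ?_
  have e1 : ∀ a b : A, (a * b) ⊗ₜ[K] (1 : A) = a ⊗ₜ 1 * b ⊗ₜ 1 := by simp
  have e2 : ∀ a b : A, (1 : A) ⊗ₜ[K] (a * b) = 1 ⊗ₜ a * 1 ⊗ₜ b := by simp
  rw [e1, e2, mul_assoc, P_mul_sep, ← mul_assoc, π_mul_sep, mul_assoc]

theorem sum_convF_lam (𝓱 : HaarData K H) : ∑ b, convF ((𝐛).coord b)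
    (𝓱.lam ∘ₗ mulRight K (antipode K (𝐛 b))) = counit (R := K) := by
  simpa [𝓱.lam_one] using sum_convF_coord 𝓱 𝓱.lam 1

theorem sep_eq {ι : Type*} (r : Coalgebra.Repr K 𝓱.Λ ι) : X.sep 𝓱 = ∑ b, ∑ i ∈ r.index,
    (X.P (𝓱.lam ∘ₗ mulRight K (antipode K (𝐛 b))) * X.π (r.left i)) ⊗ₜ[K]
      (X.π (antipode K (r.right i)) * X.P ((𝐛).coord b)) := by
  simp [sep, sepH, ← r.eq, Finset.mul_sum, Finset.sum_mul]

theorem mul_sep : mul' K A (X.sep 𝓱) = 1 := by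
  let r := ℛ K 𝓱.Λ
  have h : ∑ i ∈ r.index, r.left i * antipode K (r.right i) = 1 := by
    rw [sum_mul_antipode_eq_algebraMap_counit, 𝓱.counit_Λ, map_one]
  have h2 : ∀ u v : A, ∑ i ∈ r.index, u * X.π (r.left i) * (X.π (antipode K (r.right i)) * v) =
      u * v := fun u v => by
    have : ∀ i, u * X.π (r.left i) * (X.π (antipode K (r.right i)) * v) =
      u * X.π (r.left i * antipode K (r.right i)) * v := by simp [mul_assoc]
    simp_rw [this, ← Finset.sum_mul, ← Finset.mul_sum, ← map_sum, h]
    simp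
  simp only [X.sep_eq 𝓱 r, map_sum, mul'_apply, h2, P_mul]
  rw [← map_sum, sum_convF_lam, P_counit]

theorem apply_sep {t s : A →ₗ[K] K} (hs : ∀ a b, s (a * b) = s (b * a)) :
    mul' K K (TensorProduct.map t s (X.sep 𝓱)) =
      𝓱.lam (star (X.chi t) (antipode K ∘ₗ X.chi s ∘ₗ antipode K) 𝓱.Λ) := by
  let r := ℛ K 𝓱.Λ
  have h1 : ∀ u v : H, ∑ b,
      (t (X.P (𝓱.lam ∘ₗ mulRight K (antipode K (𝐛 b))) * X.π u)) *
      s (X.π (antipode K v) * X.P ((𝐛).coord b)) =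
      𝓱.lam (X.chi t u * antipode K (X.chi s (antipode K v))) := fun u v => by
    have : ∀ b, s (X.π (antipode K v) * X.P ((𝐛).coord b)) =
        (𝐛).coord b (X.chi s (antipode K v)) := fun b => by
      rw [hs, apply_chi]
    simp_rw [this, ← apply_chi, mul_comm _ ((𝐛).coord _ _)]
    exact sum_dual_smul 𝐛 (𝓱.lam ∘ₗ mulLeft K (X.chi t u) ∘ₗ antipode K) _
  rw [X.sep_eq 𝓱 r, Finset.sum_comm]
  simp [h1, star, ← r.eq]

end DRep

end

section

variable {K H}
variable [FiniteDimensional K H]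

omit [FiniteDimensional K H] in
theorem convF_repr (f g : H →ₗ[K] K) {x : H} {ι : Type*} (r : Coalgebra.Repr K x ι) :
    convF f g x = ∑ i ∈ r.index, f (r.left i) * g (r.right i) := by
  simp [convF, hitL_apply, ← r.eq, mul_comm]

theorem convF_comp_mulRight (g f : H →ₗ[K] K) (b : H) : convF g f ∘ₗ mulRight K b =
    ∑ i, ∑ j, convF ((𝐛).coord i) ((𝐛).coord j) b •
      convF (g ∘ₗ mulRight K (𝐛 i)) (f ∘ₗ mulRight K (𝐛 j)) := by
  refine LinearMap.ext fun x => ?_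
  let rx := ℛ K x
  let rb := ℛ K b
  have h1 : ∀ u v y z : H, ∑ i, ∑ j, ((𝐛).coord i u * (𝐛).coord j v) *
      (g (y * 𝐛 i) * f (z * 𝐛 j)) = g (y * u) * f (z * v) := fun u v y z => by
    have e1 := sum_dual_smul 𝐛 (g ∘ₗ mulLeft K y) u
    have e2 := sum_dual_smul 𝐛 (f ∘ₗ mulLeft K z) v
    simp only [LinearMap.comp_apply, mulLeft_apply, smul_eq_mul] at e1 e2
    rw [← e1, ← e2, Finset.sum_mul_sum]
    exact Finset.sum_congr rfl fun i _ => Finset.sum_congr rfl fun j _ => by ring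
  have h2 : convF g f (x * b) = ∑ p ∈ rb.index, ∑ q ∈ rx.index,
      g (rx.left q * rb.left p) * f (rx.right q * rb.right p) := by
    rw [convF, LinearMap.comp_apply, hitL_apply, Bialgebra.comul_mul, ← rx.eq, ← rb.eq,
      Finset.sum_mul_sum, Finset.sum_comm]
    simp [mul_comm]
  simp only [LinearMap.sum_apply, LinearMap.smul_apply, LinearMap.comp_apply, mulRight_apply, h2,
    convF_repr _ _ rx, convF_repr _ _ rb, smul_eq_mul]
  have h3 : ∀ i j, (∑ p ∈ rb.index, (𝐛).coord i (rb.left p) * (𝐛).coord j (rb.right p)) *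
      ∑ q ∈ rx.index, g (rx.left q * 𝐛 i) * f (rx.right q * 𝐛 j) =
      ∑ p ∈ rb.index, ∑ q ∈ rx.index, ((𝐛).coord i (rb.left p) * (𝐛).coord j (rb.right p)) *
        (g (rx.left q * 𝐛 i) * f (rx.right q * 𝐛 j)) := fun i j => Finset.sum_mul_sum _ _ _ _
  refine Eq.trans ?_ (Finset.sum_congr rfl fun i _ => Finset.sum_congr rfl fun j _ => (h3 i j).symm)
  refine Eq.trans (Finset.sum_congr rfl fun p _ => Finset.sum_congr rfl fun q _ =>
    (h1 (rb.left p) (rb.right p) (rx.left q) (rx.right q)).symm) ?_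
  refine Eq.trans (Finset.sum_congr rfl fun p _ => Finset.sum_comm) ?_
  refine Finset.sum_comm.trans (Finset.sum_congr rfl fun i _ => ?_)
  refine Eq.trans (Finset.sum_congr rfl fun p _ => Finset.sum_comm) ?_
  exact Finset.sum_comm

section tensor

variable {A B : Type} [Ring A] [Algebra K A] [Ring B] [Algebra K B]
variable (X : DRep K H A) (Y : DRep K H B)

/-- The coefficients of the coaction on a tensor product. -/
noncomputable def tensorP : (H →ₗ[K] K) →ₗ[K] A ⊗[K] B where
  toFun f := ∑ j, X.P (f ∘ₗ mulRight K (𝐛 j)) ⊗ₜ[K] Y.P ((𝐛).coord j)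
  map_add' f g := by simp [add_comp, add_tmul, Finset.sum_add_distrib]
  map_smul' c f := by simp [smul_comp, Finset.smul_sum, smul_tmul']

theorem tensorP_apply (f : H →ₗ[K] K) : tensorP X Y f =
    ∑ j, X.P (f ∘ₗ mulRight K (𝐛 j)) ⊗ₜ[K] Y.P ((𝐛).coord j) := rfl

theorem tensorP_mul (f g : H →ₗ[K] K) :
    tensorP X Y f * tensorP X Y g = tensorP X Y (convF g f) := by
  simp only [tensorP_apply, Finset.sum_mul_sum, Algebra.TensorProduct.tmul_mul_tmul, X.P_mul,
    Y.P_mul, convF_comp_mulRight, map_sum, map_smul, sum_tmul]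
  have h1 : ∀ i j, Y.P (convF ((𝐛).coord j) ((𝐛).coord i)) =
      ∑ b, convF ((𝐛).coord j) ((𝐛).coord i) (𝐛 b) • Y.P ((𝐛).coord b) := fun i j =>
    (sum_smul_coord Y.P _).symm
  simp only [h1, tmul_sum, tmul_smul, ← smul_tmul']
  rw [Finset.sum_comm]
  refine Eq.trans (Finset.sum_congr rfl fun j _ => Finset.sum_comm) ?_
  exact Finset.sum_comm

/-- The bilinear map `(x, g) ↦ P(f(· x)) ⊗ P(g)`. -/
noncomputable def tensorB (f : H →ₗ[K] K) : H →ₗ[K] (H →ₗ[K] K) →ₗ[K] A ⊗[K] B :=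
  LinearMap.mk₂ K (fun x g => X.P (f ∘ₗ mulRight K x) ⊗ₜ[K] Y.P g)
    (by
      intro x y g
      have : f ∘ₗ mulRight K (x + y) = f ∘ₗ mulRight K x + f ∘ₗ mulRight K y := by
        ext; simp [mul_add]
      simp [this, add_tmul])
    (by
      intro r x g
      have : f ∘ₗ mulRight K (r • x) = r • (f ∘ₗ mulRight K x) := by ext; simp
      simp [this, smul_tmul'])
    (by intros; simp [tmul_add])
    (by intros; simp)

theorem sum_tensorB (f : H →ₗ[K] K) (φ : H →ₗ[K] H) :
    ∑ b, X.P (f ∘ₗ mulRight K (𝐛 b)) ⊗ₜ[K] Y.P ((𝐛).coord b ∘ₗ φ) =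
      ∑ b, X.P (f ∘ₗ mulRight K (φ (𝐛 b))) ⊗ₜ[K] Y.P ((𝐛).coord b) :=
  sum_coord_comp (tensorB X Y f) φ

theorem tensor_yd (f : H →ₗ[K] K) (i j) :
    ∑ k, ∑ l, (X.π (mc K H k l) ⊗ₜ[K] Y.π (mc K H l j)) * tensorP X Y (f ∘ₗ mulLeft K (mc K H i k)) =
    ∑ k, ∑ l, tensorP X Y (f ∘ₗ mulRight K (mc K H k j)) *
      (X.π (mc K H i l) ⊗ₜ[K] Y.π (mc K H l k)) := by
  have e1 : ∀ l, ∑ k, (X.π (mc K H k l) ⊗ₜ[K] Y.π (mc K H l j)) *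
      tensorP X Y (f ∘ₗ mulLeft K (mc K H i k)) =
      ∑ k, ∑ b, (X.P (f ∘ₗ mulRight K (𝐛 b)) * X.π (mc K H i k)) ⊗ₜ[K]
        (Y.π (mc K H l j) * Y.P ((𝐛).coord b ∘ₗ mulLeft K (mc K H k l))) := fun l => by
    have h1 : ∀ k, ∑ b, X.P (f ∘ₗ mulRight K (mc K H k l * 𝐛 b)) ⊗ₜ[K] Y.P ((𝐛).coord b) =
        ∑ b, X.P (f ∘ₗ mulRight K (𝐛 b)) ⊗ₜ[K] Y.P ((𝐛).coord b ∘ₗ mulLeft K (mc K H k l)) :=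
      fun k => (sum_tensorB X Y f (mulLeft K (mc K H k l))).symm
    have h2 : ∀ b, ∑ k, X.π (mc K H k l) * X.P ((f ∘ₗ mulLeft K (mc K H i k)) ∘ₗ mulRight K (𝐛 b)) =
        ∑ k, X.P (f ∘ₗ mulRight K (mc K H k l * 𝐛 b)) * X.π (mc K H i k) := fun b => by
      refine Eq.trans (Finset.sum_congr rfl fun k _ => ?_)
        ((X.yd (f ∘ₗ mulRight K (𝐛 b)) i l).trans (Finset.sum_congr rfl fun k _ => ?_))
      · congr 2; ext; simp [mul_assoc]
      · congr 2; ext; simp [mul_assoc]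
    have h3 : ∀ k, ∑ b, (X.P (f ∘ₗ mulRight K (𝐛 b)) * X.π (mc K H i k)) ⊗ₜ[K]
        (Y.π (mc K H l j) * Y.P ((𝐛).coord b ∘ₗ mulLeft K (mc K H k l))) =
        ∑ b, (X.P (f ∘ₗ mulRight K (mc K H k l * 𝐛 b)) * X.π (mc K H i k)) ⊗ₜ[K]
        (Y.π (mc K H l j) * Y.P ((𝐛).coord b)) := fun k => by
      have := congr_arg (fun z => (1 ⊗ₜ[K] Y.π (mc K H l j)) * z * (X.π (mc K H i k) ⊗ₜ[K] 1)) (h1 k)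
      simpa [Finset.mul_sum, Finset.sum_mul] using this.symm
    simp only [tensorP_apply, Finset.mul_sum, Algebra.TensorProduct.tmul_mul_tmul, h3]
    refine Finset.sum_comm.trans (Eq.trans (Finset.sum_congr rfl fun b _ => ?_) Finset.sum_comm)
    rw [← sum_tmul, h2, sum_tmul]
  have e2 : ∀ k, ∑ l, ∑ b, (X.P (f ∘ₗ mulRight K (𝐛 b)) * X.π (mc K H i k)) ⊗ₜ[K]
        (Y.π (mc K H l j) * Y.P ((𝐛).coord b ∘ₗ mulLeft K (mc K H k l))) =
      ∑ l, tensorP X Y (f ∘ₗ mulRight K (mc K H l j)) *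
      (X.π (mc K H i k) ⊗ₜ[K] Y.π (mc K H k l)) := fun k => by
    have h1 : ∀ l, tensorP X Y (f ∘ₗ mulRight K (mc K H l j)) =
        ∑ b, X.P (f ∘ₗ mulRight K (𝐛 b)) ⊗ₜ[K] Y.P ((𝐛).coord b ∘ₗ mulRight K (mc K H l j)) :=
      fun l => by
        rw [sum_tensorB, tensorP_apply]
        refine Finset.sum_congr rfl fun b _ => ?_
        congr 2; ext; simp [mul_assoc]
    simp only [h1, Finset.sum_mul, Algebra.TensorProduct.tmul_mul_tmul]
    refine Finset.sum_comm.trans (Eq.trans (Finset.sum_congr rfl fun b _ => ?_) Finset.sum_comm)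
    rw [← tmul_sum, Y.yd, tmul_sum]
  rw [Finset.sum_comm]
  simp_rw [e1]
  rw [Finset.sum_comm]
  simp_rw [e2]
  exact Finset.sum_comm

/-- The tensor product of Yetter–Drinfeld structures. -/
noncomputable def DRep.tensor : DRep K H (A ⊗[K] B) where
  π := (Algebra.TensorProduct.map X.π Y.π).comp (comulAlgHom K H)
  P := tensorP X Y
  P_counit := by
    have : ∀ j, counit (R := K) ∘ₗ mulRight K (𝐛 j) = counit (R := K) (𝐛 j) • counit (R := K) :=
      fun j => by ext; simp [mul_comm]
    simp only [tensorP_apply, this, map_smul, X.P_counit, ← smul_tmul', ← tmul_smul, ← tmul_sum,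
      sum_smul_coord, Y.P_counit, Algebra.TensorProduct.one_def]
  P_mul := tensorP_mul X Y
  yd f i j := by
    simpa [comul_mc, Finset.sum_mul, Finset.mul_sum] using tensor_yd X Y f i j

theorem DRep.chi_tensor (t : A →ₗ[K] K) (s : B →ₗ[K] K) :
    (X.tensor Y).chi (mul' K K ∘ₗ TensorProduct.map t s) = star (X.chi t) (Y.chi s) := by
  refine ext_mc fun i j => eq_of_dual_eq (K := K) fun f => ?_
  have h1 : (X.tensor Y).P f = tensorP X Y f := rfl
  have h2 : (X.tensor Y).π (mc K H i j) = ∑ k, X.π (mc K H i k) ⊗ₜ[K] Y.π (mc K H k j) := by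
    simp [DRep.tensor, comul_mc]
  have h3 : ∀ k, ∑ b, t (X.P (f ∘ₗ mulRight K (𝐛 b)) * X.π (mc K H i k)) *
      s (Y.P ((𝐛).coord b) * Y.π (mc K H k j)) =
      f (X.chi t (mc K H i k) * Y.chi s (mc K H k j)) := fun k => by
    simp_rw [← DRep.apply_chi, mul_comm (_ : K) ((𝐛).coord _ _)]
    exact sum_dual_smul 𝐛 (f ∘ₗ mulLeft K (X.chi t (mc K H i k))) _
  rw [DRep.apply_chi, h1, h2, star_mc, map_sum, tensorP_apply, Finset.sum_mul_sum]
  simp only [← h3]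
  simp only [map_sum, Algebra.TensorProduct.tmul_mul_tmul, LinearMap.comp_apply,
    TensorProduct.map_tmul, mul'_apply]
  exact Finset.sum_comm

end tensor

section op

variable {A : Type} [Ring A] [Algebra K A] (X : DRep K H A)

theorem DRep.yd_repr {h : H} {ι : Type*} (r : Coalgebra.Repr K h ι) (f : H →ₗ[K] K) :
    ∑ k ∈ r.index, X.π (r.right k) * X.P (f ∘ₗ mulLeft K (r.left k)) =
      ∑ k ∈ r.index, X.P (f ∘ₗ mulRight K (r.right k)) * X.π (r.left k) := by
  let L : H →ₗ[K] H →ₗ[K] A := LinearMap.mk₂ K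
    (fun a b => X.π b * X.P (f ∘ₗ mulLeft K a))
    (by
      intro x y g
      have : f ∘ₗ mulLeft K (x + y) = f ∘ₗ mulLeft K x + f ∘ₗ mulLeft K y := by
        ext; simp [add_mul]
      simp [this, mul_add])
    (by
      intro r x g
      have : f ∘ₗ mulLeft K (r • x) = r • (f ∘ₗ mulLeft K x) := by ext; simp
      simp [this])
    (by intros; simp [add_mul]) (by intros; simp)
  let R : H →ₗ[K] H →ₗ[K] A := LinearMap.mk₂ K
    (fun a b => X.P (f ∘ₗ mulRight K b) * X.π a)
    (by intros; simp [mul_add]) (by intros; simp)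
    (by
      intro g x y
      have : f ∘ₗ mulRight K (x + y) = f ∘ₗ mulRight K x + f ∘ₗ mulRight K y := by
        ext; simp [mul_add]
      simp [this, add_mul])
    (by
      intro r g x
      have : f ∘ₗ mulRight K (r • x) = r • (f ∘ₗ mulRight K x) := by ext; simp
      simp [this])
  have h1 : TensorProduct.lift L ∘ₗ comul (R := K) = TensorProduct.lift R ∘ₗ comul (R := K) :=
    ext_mc fun i j => by
      simpa [comul_mc, L, R] using X.yd f i j
  have h2 := LinearMap.congr_fun h1 h
  simpa [← r.eq, L, R] using h2

variable (hS : ∀ h : H, antipode K (antipode K h) = h)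

/-- The opposite (dual) Yetter–Drinfeld structure. -/
noncomputable def DRep.op (hS : ∀ h : H, antipode K (antipode K h) = h) : DRep K H Aᵐᵒᵖ where
  π := AlgHom.ofLinearMap ((MulOpposite.opLinearEquiv K).toLinearMap ∘ₗ X.π.toLinearMap ∘ₗ
    antipode K) (by simp) (by intro a b; simp [antipode_mul_antidistrib])
  P :=
    { toFun := fun f => MulOpposite.op (X.P (f ∘ₗ antipode K))
      map_add' := fun f g => by simp [add_comp]
      map_smul' := fun c f => by simp [smul_comp] }
  P_counit := by
    have : counit (R := K) ∘ₗ antipode K = counit (R := K) (A := H) := by ext; simp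
    simp [this, X.P_counit]
  P_mul f g := by
    simp only [LinearMap.coe_mk, AddHom.coe_mk, ← MulOpposite.op_mul, X.P_mul]
    congr 2
    refine ext_mc fun i j => ?_
    let r : Coalgebra.Repr K (antipode K (mc K H i j)) (Fin (Module.finrank K H)) :=
      ⟨Finset.univ, fun k => antipode K (mc K H k j), fun k => antipode K (mc K H i k),
        (comul_antipode_mc i j).symm⟩
    rw [convF_mc, LinearMap.comp_apply, convF_repr g f r]
    simp [r, mul_comm]
  yd f i j := by
    let r : Coalgebra.Repr K (antipode K (mc K H i j)) (Fin (Module.finrank K H)) :=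
      ⟨Finset.univ, fun k => antipode K (mc K H k j), fun k => antipode K (mc K H i k),
        (comul_antipode_mc i j).symm⟩
    have := X.yd_repr r (f ∘ₗ antipode K)
    have e1 : ∀ x, (f ∘ₗ mulLeft K x) ∘ₗ antipode K = (f ∘ₗ antipode K) ∘ₗ
      mulRight K (antipode K x) := fun x => by
        ext; simp [antipode_mul_antidistrib, hS]
    have e2 : ∀ x, (f ∘ₗ mulRight K x) ∘ₗ antipode K = (f ∘ₗ antipode K) ∘ₗ
      mulLeft K (antipode K x) := fun x => by
        ext; simp [antipode_mul_antidistrib, hS]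
    change ∑ k, MulOpposite.op (X.π (antipode K (mc K H k j))) * MulOpposite.op (X.P _) =
      ∑ k, MulOpposite.op (X.P _) * MulOpposite.op (X.π (antipode K (mc K H i k)))
    apply MulOpposite.unop_injective
    simpa [e1, e2, r] using this.symm

theorem DRep.chi_op {t : A →ₗ[K] K} (ht : ∀ a b, t (a * b) = t (b * a)) :
    (X.op hS).chi (t ∘ₗ (MulOpposite.opLinearEquiv K).symm.toLinearMap) =
      antipode K ∘ₗ X.chi t ∘ₗ antipode K := by
  refine LinearMap.ext fun h => eq_of_dual_eq (K := K) fun f => ?_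
  rw [DRep.apply_chi]
  have := X.apply_chi t (f ∘ₗ antipode K) (antipode K h)
  rw [ht] at this
  exact this.symm

end op

theorem trace_eq_of_intertwine {V W : Type*} [AddCommGroup V] [Module K V] [AddCommGroup W]
    [Module K W] (e : V ≃ₗ[K] W) (φ : V →ₗ[K] V) (ψ : W →ₗ[K] W)
    (h : ∀ x, ψ (e x) = e (φ x)) : LinearMap.trace K W ψ = LinearMap.trace K V φ := by
  rw [← LinearMap.trace_conj' φ e]
  congr 1
  refine LinearMap.ext fun x => ?_
  simp [LinearEquiv.conj_apply, ← h]

theorem trace_sandwich {V : Type*} [AddCommGroup V] [Module K V] [FiniteDimensional K V]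
    (a b : V →ₗ[K] V) : LinearMap.trace K (V →ₗ[K] V) (LinearMap.llcomp K V V V a ∘ₗ
      LinearMap.lcomp K V b) = LinearMap.trace K V a * LinearMap.trace K V b := by
  rw [trace_eq_of_intertwine (V := Module.Dual K V ⊗[K] V) (W := V →ₗ[K] V) (dualTensorHomEquiv K V V)
    (TensorProduct.map (Module.Dual.transpose (R := K) b) a) _ fun t => ?_]
  · rw [LinearMap.trace_tensorProduct', LinearMap.trace_transpose', mul_comm]
  · induction t with
    | zero => simp
    | add x y hx hy => simp only [map_add, hx, hy]
    | tmul f v => ext x; simp [Module.Dual.transpose_apply]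

/-- Right convolution multiplication by `χ`. -/
noncomputable def starR (χ : H →ₗ[K] H) : (H →ₗ[K] H) →ₗ[K] (H →ₗ[K] H) where
  toFun θ := star θ χ
  map_add' θ η := by ext; simp [star, TensorProduct.map_add_left]
  map_smul' c η := by ext; simp [star, TensorProduct.map_smul_left]

theorem trace_starR (𝓱 : HaarData K H) (χ : H →ₗ[K] H) :
    LinearMap.trace K _ (starR χ) = (Module.finrank K H : K) ^ 2 * 𝓱.lam (χ 𝓱.Λ) := by
  have h1 : starR χ = ∑ i, LinearMap.llcomp K H H H (mulRight K (χ (𝐛 i))) ∘ₗ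
      LinearMap.lcomp K H (hitL ((𝐛).coord i)) := by
    refine LinearMap.ext fun θ => ext_mc fun i j => ?_
    simp only [starR, LinearMap.coe_mk, AddHom.coe_mk, star_mc, LinearMap.sum_apply,
      LinearMap.comp_apply, LinearMap.llcomp_apply, LinearMap.lcomp_apply, hitL_mc, map_sum,
      map_smul, mulRight_apply]
    rw [Finset.sum_comm]
    refine Finset.sum_congr rfl fun k _ => ?_
    have := sum_dual_smul 𝐛 (mulLeft K (θ (mc K H i k)) ∘ₗ χ) (mc K H k j)
    simp only [LinearMap.comp_apply, mulLeft_apply] at this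
    rw [← this]
  rw [h1, map_sum]
  simp_rw [trace_sandwich, 𝓱.trace_mulRight, 𝓱.trace_hitL]
  have := sum_dual_smul 𝐛 (𝓱.lam ∘ₗ χ) 𝓱.Λ
  simp only [LinearMap.comp_apply, smul_eq_mul] at this
  rw [← this, Finset.mul_sum]
  exact Finset.sum_congr rfl fun i _ => by ring

end

section

variable {K H}
variable [FiniteDimensional K H]

section characters

variable {A B : Type} [Ring A] [Algebra K A] [Ring B] [Algebra K B]

/-- A trace functional which takes natural values at idempotents. -/
def IsNatTrace (t : A →ₗ[K] K) : Prop :=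
  (∀ a b, t (a * b) = t (b * a)) ∧ ∀ e, e * e = e → ∃ m : ℕ, t e = m

theorem trace_idempotent_nat {V : Type*} [AddCommGroup V] [Module K V] [FiniteDimensional K V]
    {e : Module.End K V} (he : e * e = e) : ∃ m : ℕ, LinearMap.trace K V e = m :=
  ⟨_, (LinearMap.IsIdempotentElem.isProj_range e he).trace⟩

theorem isNatTrace_of_hom {V : Type*} [AddCommGroup V] [Module K V] [FiniteDimensional K V]
    (ρ : A →ₐ[K] Module.End K V) : IsNatTrace (LinearMap.trace K V ∘ₗ ρ.toLinearMap) := by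
  refine ⟨fun a b => ?_, fun e he => ?_⟩
  · simp [LinearMap.trace_mul_comm K (ρ a)]
  · exact trace_idempotent_nat (by rw [AlgHom.toLinearMap_apply, ← map_mul, he])

theorem IsNatTrace.comp {t : B →ₗ[K] K} (ht : IsNatTrace t) (ρ : A →ₐ[K] B) :
    IsNatTrace (t ∘ₗ ρ.toLinearMap) := by
  refine ⟨fun a b => ?_, fun e he => ?_⟩
  · simp [ht.1 (ρ a)]
  · exact ht.2 _ (by rw [AlgHom.toLinearMap_apply, ← map_mul, he])

theorem IsNatTrace.op {t : A →ₗ[K] K} (ht : IsNatTrace t) :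
    IsNatTrace (t ∘ₗ (MulOpposite.opLinearEquiv (M := A) K).symm.toLinearMap) := by
  refine ⟨fun a b => ?_, fun e he => ?_⟩
  · exact ht.1 _ _
  · exact ht.2 (MulOpposite.unop e) (by rw [← MulOpposite.unop_mul, he])

theorem isNatTrace_tensor {V W : Type*} [AddCommGroup V] [Module K V] [FiniteDimensional K V]
    [AddCommGroup W] [Module K W] [FiniteDimensional K W]
    (ρ : A →ₐ[K] Module.End K V) (σ : B →ₐ[K] Module.End K W) :
    IsNatTrace (mul' K K ∘ₗ TensorProduct.map (LinearMap.trace K V ∘ₗ ρ.toLinearMap)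
      (LinearMap.trace K W ∘ₗ σ.toLinearMap)) := by
  have := isNatTrace_of_hom ((Module.endTensorEndAlgHom (R := K) (A := K) (M := V) (N := W)).comp
    (Algebra.TensorProduct.map ρ σ))
  have h : mul' K K ∘ₗ TensorProduct.map (LinearMap.trace K V ∘ₗ ρ.toLinearMap)
      (LinearMap.trace K W ∘ₗ σ.toLinearMap) = LinearMap.trace K (V ⊗[K] W) ∘ₗ
      ((Module.endTensorEndAlgHom (R := K) (A := K) (M := V) (N := W)).comp
      (Algebra.TensorProduct.map ρ σ)).toLinearMap := TensorProduct.ext' fun a b => by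
    simpa [Module.endTensorEndAlgHom_apply, TensorProduct.AlgebraTensorModule.map_eq] using
      (LinearMap.trace_tensorProduct' (ρ a) (σ b)).symm
  rw [h]
  exact this

variable {r : ℕ} {d : Fin r → ℕ}

variable (K d) in
/-- The action on the `i`-th standard module. -/
noncomputable def blockHom (i : Fin r) : MatProd K d →ₐ[K] Module.End K (Fin (d i) → K) :=
  (Matrix.toLinAlgEquiv' (R := K)).toAlgHom.comp (Pi.evalAlgHom K _ i)

variable (K d) in
/-- The trace on the `i`-th standard module. -/
noncomputable def blockTr (i : Fin r) : MatProd K d →ₗ[K] K :=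
  LinearMap.trace K _ ∘ₗ (blockHom K d i).toLinearMap

theorem blockTr_apply (i : Fin r) (a : MatProd K d) : blockTr K d i a = (a i).trace := by
  exact Matrix.trace_toLin'_eq (a i)

theorem exists_scalars_of_tracial {t : MatProd K d →ₗ[K] K} (ht : ∀ a b, t (a * b) = t (b * a)) :
    ∃ s : Fin r → K, t = ∑ i, s i • blockTr K d i := by
  obtain ⟨y, hy⟩ := exists_matProd_trace_form t
  have hc : ∀ b, y * b = b * y := fun b => by
    refine matProd_eq_of_trace fun x => ?_
    have h1 := hy (b * x)
    have h2 := hy (x * b)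
    rw [ht, h2] at h1
    simp only [Pi.mul_apply] at h1 ⊢
    simp only [mul_assoc] at h1
    rw [h1]
    exact Finset.sum_congr rfl fun i _ => by rw [← mul_assoc, Matrix.trace_mul_comm]
  choose s hs using matProd_central hc
  refine ⟨s, LinearMap.ext fun a => ?_⟩
  simp [hy, hs, blockTr_apply]

theorem IsNatTrace.exists_nat [∀ i, NeZero (d i)] {t : MatProd K d →ₗ[K] K} (ht : IsNatTrace t) :
    ∃ m : Fin r → ℕ, t = ∑ i, (m i : K) • blockTr K d i := by
  obtain ⟨s, hs⟩ := exists_scalars_of_tracial ht.1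
  have h1 : ∀ i, ∃ m : ℕ, s i = m := fun i => by
    obtain ⟨m, hm⟩ := ht.2 (Pi.single i (Matrix.single 0 0 1)) (by
      rw [← Pi.single_mul]; simp)
    refine ⟨m, ?_⟩
    rw [← hm, hs]
    simp only [LinearMap.sum_apply, LinearMap.smul_apply, blockTr_apply, smul_eq_mul]
    rw [Finset.sum_eq_single i]
    · simp
    · intro j _ hj
      simp [hj]
    · simp
  choose m hm using h1
  exact ⟨m, by simp [hs, hm]⟩

end characters

section semisimple

theorem isSemisimpleRing_of_sep {A : Type} [Ring A] [Algebra K A] (q : A ⊗[K] A)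
    (h1 : mul' K A q = 1) (h2 : ∀ a, (a ⊗ₜ[K] 1) * q = q * (1 ⊗ₜ[K] a)) : IsSemisimpleRing A := by
  refine (isSemisimpleModule_iff A A).2 ⟨fun I => ?_⟩
  obtain ⟨f, hf⟩ := (I.restrictScalars K).subtype.exists_leftInverse_of_injective (by
    rw [LinearMap.ker_eq_bot]; exact Subtype.val_injective)
  let F : A →ₗ[K] A := (I.restrictScalars K).subtype ∘ₗ f
  have hF : ∀ x, F x ∈ I := fun x => (f x).2
  have hF2 : ∀ x ∈ I, F x = x := fun x hx => congr_arg Subtype.val (LinearMap.congr_fun hf ⟨x, hx⟩)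
  let G : A →ₗ[K] A ⊗[K] A →ₗ[K] A := LinearMap.flip
    (TensorProduct.lift (LinearMap.mk₂ K (fun a b => mulLeft K a ∘ₗ F ∘ₗ mulLeft K b)
      (by intros; ext; simp [add_mul]) (by intros; ext; simp) (by intros; ext; simp [add_mul, mul_add])
      (by intros; ext; simp)))
  have hG : ∀ x a b, G x (a ⊗ₜ b) = a * F (b * x) := fun x a b => rfl
  have g1 : ∀ x t, G x t ∈ I := fun x t => by
    induction t with
    | zero => simp
    | add u v hu hv => rw [map_add]; exact I.add_mem hu hv
    | tmul a b => exact I.smul_mem _ (hF _)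
  have g2 : ∀ x ∈ I, ∀ t, G x t = mul' K A t * x := fun x hx t => by
    induction t with
    | zero => simp
    | add u v hu hv => rw [map_add, hu, hv, map_add, add_mul]
    | tmul a b => rw [hG, hF2 (b * x) (I.smul_mem b hx), mul'_apply, mul_assoc]
  have g3 : ∀ x c t, G (c * x) t = G x (t * (1 ⊗ₜ[K] c)) := fun x c t => by
    induction t with
    | zero => simp
    | add u v hu hv => rw [map_add, hu, hv, add_mul, map_add]
    | tmul a b => simp [hG, mul_assoc]
  have g4 : ∀ x c t, G x ((c ⊗ₜ[K] 1) * t) = c * G x t := fun x c t => by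
    induction t with
    | zero => simp
    | add u v hu hv => rw [mul_add, map_add, hu, hv, map_add, mul_add]
    | tmul a b => simp [hG, mul_assoc]
  let p : A →ₗ[A] I :=
    { toFun := fun x => ⟨G x q, g1 x q⟩
      map_add' := fun x y => Subtype.ext (by simp)
      map_smul' := fun c x => Subtype.ext (by simp [g3, ← h2, g4]) }
  exact ⟨_, LinearMap.isCompl_of_proj (f := p) fun x => Subtype.ext (by
    change G x q = x
    rw [g2 _ x.2, h1, one_mul])⟩

theorem isSemisimpleRing_double (𝓱 : HaarData K H) : IsSemisimpleRing (DRep.double K H) :=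
  isSemisimpleRing_of_sep ((DRep.univ K H).sep 𝓱) (DRep.mul_sep _ 𝓱) fun a => by
    obtain ⟨θ, rfl⟩ := DRep.T_univ_bijective.2 a
    exact DRep.T_mul_sep _ 𝓱 θ

theorem tr_tr_sep {r : ℕ} {d : Fin r → ℕ} [∀ i, NeZero (d i)] (q : MatProd K d ⊗[K] MatProd K d)
    (h1 : mul' K _ q = 1) (h2 : ∀ a, (a ⊗ₜ[K] 1) * q = q * (1 ⊗ₜ[K] a)) (i j : Fin r) :
    mul' K K (TensorProduct.map (blockTr K d i) (blockTr K d j) q) = if i = j then 1 else 0 := by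
  let ent : ∀ i, Fin (d i) → Fin (d i) → MatProd K d →ₗ[K] K := fun i p q =>
    Matrix.entryLinearMap K K p q ∘ₗ LinearMap.proj i
  have hent : ∀ i p q a, ent i p q a = a i p q := fun i p q a => rfl
  have e1 : blockTr K d i = ∑ p, ent i p p := LinearMap.ext fun a => by
    simp [blockTr_apply, hent, Matrix.trace]
  have e2 : blockTr K d j = ∑ p, ent j p p := LinearMap.ext fun a => by
    simp [blockTr_apply, hent, Matrix.trace]
  have e3 : ∀ p s t, mul' K K (TensorProduct.map (ent i p p) (ent j s s) t) =
      mul' K K (TensorProduct.map (ent i 0 p) (ent j s s)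
        ((Pi.single i (Matrix.single 0 p 1) ⊗ₜ[K] 1) * t)) := fun p s t => by
    induction t with
    | zero => simp
    | add u v hu hv => simp only [map_add, mul_add, hu, hv]
    | tmul a b => simp [hent]
  have e4 : ∀ p s t, mul' K K (TensorProduct.map (ent i 0 p) (ent j s s)
      (t * (1 ⊗ₜ[K] Pi.single i (Matrix.single 0 p 1)))) =
      if h : i = j then (if h ▸ p = s then
        mul' K K (TensorProduct.map (ent i 0 p) (ent i p 0) t) else 0) else 0 := fun p s t => by
    induction t with
    | zero => simp
    | add u v hu hv =>
      simp only [map_add, add_mul, hu, hv]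
      split_ifs <;> simp
    | tmul a b =>
      split_ifs with h h'
      · subst h
        dsimp only at h'
        subst h'
        simp [hent]
      · subst h
        dsimp only at h'
        simp [hent, Ne.symm h']
      · simp [hent, Ne.symm h]
  have e5 : ∀ t, ∑ p, mul' K K (TensorProduct.map (ent i 0 p) (ent i p 0) t) =
      mul' K _ t i 0 0 := fun t => by
    induction t with
    | zero => simp
    | add u v hu hv => simp only [map_add, Finset.sum_add_distrib, hu, hv]; rfl
    | tmul a b => simp [hent, Matrix.mul_apply]
  have e6 : ∀ t, mul' K K (TensorProduct.map (∑ p, ent i p p) (∑ s, ent j s s) t) =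
      ∑ p, ∑ s, mul' K K (TensorProduct.map (ent i p p) (ent j s s) t) := fun t => by
    induction t with
    | zero => simp
    | add u v hu hv => simp only [map_add, Finset.sum_add_distrib, hu, hv]
    | tmul a b => simp [Finset.sum_mul_sum]
  rw [e1, e2, e6]
  simp only [e3, h2, e4]
  split_ifs with h
  · subst h
    simp [e5, h1]
  · simp

end semisimple

end

section

variable {K H}
variable [FiniteDimensional K H]

open DRep

theorem DRep.chi_sum {A : Type} [Ring A] [Algebra K A] (X : DRep K H A) {ι : Type*} (s : Finset ι)
    (c : ι → K) (t : ι → A →ₗ[K] K) :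
    X.chi (∑ i ∈ s, c i • t i) = ∑ i ∈ s, c i • X.chi (t i) := by
  refine LinearMap.ext fun h => eq_of_dual_eq (K := K) fun f => ?_
  simp [apply_chi]

theorem star_sum_right {ι : Type*} (s : Finset ι) (c : ι → K) (χ : ι → H →ₗ[K] H) (θ : H →ₗ[K] H) :
    star θ (∑ i ∈ s, c i • χ i) = ∑ i ∈ s, c i • star θ (χ i) := by
  refine ext_mc fun i j => ?_
  simp only [star_mc, LinearMap.sum_apply, LinearMap.smul_apply, Finset.mul_sum, Finset.smul_sum,
    mul_smul_comm]
  exact Finset.sum_comm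

theorem star_sum_left {ι : Type*} (s : Finset ι) (c : ι → K) (χ : ι → H →ₗ[K] H) (θ : H →ₗ[K] H) :
    star (∑ i ∈ s, c i • χ i) θ = ∑ i ∈ s, c i • star (χ i) θ := by
  refine ext_mc fun i j => ?_
  simp only [star_mc, LinearMap.sum_apply, LinearMap.smul_apply, Finset.sum_mul, Finset.smul_sum,
    smul_mul_assoc]
  exact Finset.sum_comm

/-- `E` is freely generated by the structure `𝓤`, and the operators `T` form a basis of it. -/
structure DRep.IsUniversal {E : Type} [Ring E] [Algebra K E] (𝓤 : DRep K H E) : Prop where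
  bijective : Function.Bijective 𝓤.T
  lift : ∀ {A : Type} [Ring A] [Algebra K A] (X : DRep K H A),
    ∃ φ : E →ₐ[K] A, (∀ h, φ (𝓤.π h) = X.π h) ∧ ∀ f, φ (𝓤.P f) = X.P f

theorem DRep.isUniversal_univ : (univ K H).IsUniversal :=
  ⟨T_univ_bijective, fun X => ⟨X.Φ, X.Φ_π, X.Φ_P⟩⟩

section block

variable (𝓱 : HaarData K H) {r : ℕ} {d : Fin r → ℕ} [∀ i, NeZero (d i)]
  {E : Type} [Ring E] [Algebra K E] {𝓤 : DRep K H E} (h𝓤 : 𝓤.IsUniversal)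
  (Ψ : E ≃ₐ[K] MatProd K d)

/-- The trace of the `i`-th irreducible representation of the double. -/
noncomputable def irrTr (i : Fin r) : E →ₗ[K] K := blockTr K d i ∘ₗ Ψ.toLinearMap

/-- The character of the `i`-th irreducible representation of the double. -/
noncomputable def irrChar (𝓤 : DRep K H E) (i : Fin r) : H →ₗ[K] H := 𝓤.chi (irrTr Ψ i)

theorem isNatTrace_irrTr (i : Fin r) : IsNatTrace (irrTr Ψ i) :=
  isNatTrace_of_hom ((blockHom K d i).comp Ψ.toAlgHom)

theorem irrTr_tracial (i : Fin r) : ∀ a b, irrTr Ψ i (a * b) = irrTr Ψ i (b * a) :=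
  (isNatTrace_irrTr Ψ i).1

include h𝓤

theorem exists_chi_eq {A : Type} [Ring A] [Algebra K A] (X : DRep K H A) {t : A →ₗ[K] K}
    (ht : IsNatTrace t) : ∃ m : Fin r → ℕ, X.chi t = ∑ i, (m i : K) • irrChar Ψ 𝓤 i := by
  obtain ⟨φ, hπ, hP⟩ := h𝓤.lift X
  obtain ⟨m, hm⟩ := ((ht.comp φ).comp Ψ.symm.toAlgHom).exists_nat
  refine ⟨m, ?_⟩
  have h1 : X.chi t = 𝓤.chi (t ∘ₗ φ.toLinearMap) :=
    LinearMap.ext fun h => eq_of_dual_eq (K := K) fun f => by simp [apply_chi, hπ, hP]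
  simp only [irrChar]
  rw [h1, ← chi_sum]
  congr 1
  refine LinearMap.ext fun x => ?_
  have := LinearMap.congr_fun hm (Ψ x)
  simpa [irrTr] using this

theorem exists_star_irrChar (i j : Fin r) :
    ∃ m : Fin r → ℕ, star (irrChar Ψ 𝓤 i) (irrChar Ψ 𝓤 j) = ∑ k, (m k : K) • irrChar Ψ 𝓤 k := by
  have := exists_chi_eq h𝓤 Ψ (𝓤.tensor 𝓤) (isNatTrace_tensor
    ((blockHom K d i).comp Ψ.toAlgHom) ((blockHom K d j).comp Ψ.toAlgHom))
  have h2 := chi_tensor 𝓤 𝓤 (irrTr Ψ i) (irrTr Ψ j)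
  rw [irrChar, irrChar, ← h2]
  exact this

include 𝓱

theorem exists_antipode_irrChar (i : Fin r) : ∃ m : Fin r → ℕ,
    antipode K ∘ₗ irrChar Ψ 𝓤 i ∘ₗ antipode K = ∑ k, (m k : K) • irrChar Ψ 𝓤 k := by
  have := exists_chi_eq h𝓤 Ψ (𝓤.op 𝓱.sq) (isNatTrace_irrTr Ψ i).op
  rwa [chi_op _ _ (irrTr_tracial Ψ i)] at this

theorem irrChar_orthogonal (i j : Fin r) :
    𝓱.lam (star (irrChar Ψ 𝓤 i) (antipode K ∘ₗ irrChar Ψ 𝓤 j ∘ₗ antipode K) 𝓱.Λ) =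
      if i = j then 1 else 0 := by
  rw [irrChar, irrChar, ← apply_sep _ 𝓱 (irrTr_tracial Ψ j)]
  have h0 := mul_sep 𝓤 𝓱
  have h1 : ∀ a, (a ⊗ₜ[K] 1) * 𝓤.sep 𝓱 = 𝓤.sep 𝓱 * (1 ⊗ₜ[K] a) := fun a => by
    obtain ⟨θ, rfl⟩ := h𝓤.bijective.2 a
    exact T_mul_sep _ 𝓱 θ
  generalize 𝓤.sep 𝓱 = q at h0 h1
  let EE := Algebra.TensorProduct.map Ψ.toAlgHom Ψ.toAlgHom
  rw [← tr_tr_sep (EE q)]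
  · have : ∀ q, mul' K K (TensorProduct.map (irrTr Ψ i) (irrTr Ψ j) q) =
      mul' K K (TensorProduct.map (blockTr K d i) (blockTr K d j) (EE q)) := fun q => by
      induction q with
      | zero => simp
      | add u v hu hv => simp only [map_add, hu, hv]
      | tmul a b => simp [irrTr, EE]
    exact this q
  · have : ∀ q, mul' K _ (EE q) = Ψ (mul' K _ q) := fun q => by
      induction q with
      | zero => simp
      | add u v hu hv => simp only [map_add, hu, hv]
      | tmul a b => simp [EE]
    rw [this, h0, map_one]
  · intro a
    have := congr_arg EE (h1 (Ψ.symm a))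
    simpa [EE] using this

theorem exists_block_unit (v : Fin r) : ∃ c : Fin r → K,
    Ψ (𝓤.T (∑ i, c i • irrChar Ψ 𝓤 i)) = Pi.single v 1 := by
  have hcen : ∀ c : Fin r → K, ∀ b, Ψ (𝓤.T (∑ i, c i • irrChar Ψ 𝓤 i)) * b =
      b * Ψ (𝓤.T (∑ i, c i • irrChar Ψ 𝓤 i)) := fun c b => by
    obtain ⟨b, rfl⟩ := Ψ.surjective b
    obtain ⟨θ, rfl⟩ := h𝓤.bijective.2 b
    rw [← map_mul Ψ, ← map_mul Ψ]
    congr 1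
    simp only [map_sum, map_smul, Finset.sum_mul, Finset.mul_sum, smul_mul_assoc, mul_smul_comm,
      irrChar, T_chi_comm _ _ 𝓱 (irrTr_tracial Ψ _)]
  have hval : ∀ (c : Fin r → K) j, Ψ (𝓤.T (∑ i, c i • irrChar Ψ 𝓤 i)) j =
      Ψ (𝓤.T (∑ i, c i • irrChar Ψ 𝓤 i)) j 0 0 • 1 := fun c j => by
    obtain ⟨s, hs⟩ := matProd_central (hcen c) j
    rw [hs]
    simp
  let L : (Fin r → K) →ₗ[K] (Fin r → K) := LinearMap.pi fun j =>
    Matrix.entryLinearMap K K 0 0 ∘ₗ LinearMap.proj j ∘ₗ Ψ.toLinearMap ∘ₗ 𝓤.T ∘ₗ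
      Fintype.linearCombination K (irrChar Ψ 𝓤)
  have hL : ∀ c j, L c j = Ψ (𝓤.T (∑ i, c i • irrChar Ψ 𝓤 i)) j 0 0 := fun c j => rfl
  have hinj : Function.Injective L := by
    refine (injective_iff_map_eq_zero L).2 fun c hc => ?_
    have h1 : Ψ (𝓤.T (∑ i, c i • irrChar Ψ 𝓤 i)) = 0 := by
      funext j
      rw [hval, ← hL, hc]
      simp
    have h2 : 𝓤.chi (∑ i, c i • irrTr Ψ i) = 0 := by
      rw [chi_sum]
      apply h𝓤.bijective.1
      apply Ψ.injective
      rw [map_zero, map_zero]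
      exact h1
    have h3 : (∑ i, c i • irrTr Ψ i) = 0 := by
      refine LinearMap.ext fun x => ?_
      obtain ⟨θ, rfl⟩ := h𝓤.bijective.2 x
      rw [𝓤.apply_T (∑ i, c i • irrTr Ψ i) θ ?_, h2]
      · simp
      · intro a b
        simp [irrTr_tracial Ψ _ a b]
    funext i
    have h4 := LinearMap.congr_fun h3 (Ψ.symm (Pi.single i (Matrix.single 0 0 1)))
    simp only [LinearMap.sum_apply, LinearMap.smul_apply, irrTr, LinearMap.comp_apply,
      AlgEquiv.toLinearMap_apply, AlgEquiv.apply_symm_apply, blockTr_apply, smul_eq_mul] at h4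
    rw [Finset.sum_eq_single i] at h4
    · simpa using h4
    · intro j _ hj
      simp [hj]
    · simp
  obtain ⟨c, hc⟩ := LinearMap.injective_iff_surjective.1 hinj (Pi.single v 1)
  refine ⟨c, ?_⟩
  funext j
  rw [hval, ← hL, hc]
  by_cases h : j = v
  · subst h; simp
  · simp [h]

end block

end

section

variable {K H}
variable [FiniteDimensional K H]

open DRep

theorem dvd_of_isIntegral_mul [CharZero K] {a b : ℕ} {s : K} (hs : IsIntegral ℤ s)
    (h : (a : K) * s = b) : a ∣ b := by
  rcases eq_or_ne a 0 with rfl | ha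
  · have : (b : K) = 0 := by rw [← h]; simp
    rw [Nat.cast_eq_zero.1 this]
  have ha' : (a : K) ≠ 0 := Nat.cast_ne_zero.2 ha
  have h1 : s = algebraMap ℚ K ((b : ℚ) / a) := by
    rw [map_div₀, map_natCast, map_natCast, eq_div_iff ha', mul_comm, h]
  rw [h1, isIntegral_algebraMap_iff (algebraMap ℚ K).injective] at hs
  obtain ⟨z, hz⟩ := IsIntegrallyClosed.isIntegral_iff.1 hs
  have h2 : (b : ℚ) = a * z := by
    have : (z : ℚ) = b / a := by simpa using hz
    rw [this]
    field_simp
  have h3 : (b : ℤ) = a * z := by exact_mod_cast h2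
  exact Int.natCast_dvd_natCast.1 ⟨z, h3⟩

theorem isIntegral_of_structure_constants [CharZero K] {ι : Type*} [Finite ι] (ν : ι → K)
    (h : ∀ i j, ν i * ν j ∈ Submodule.span ℤ (Set.range ν)) (i : ι) : IsIntegral ℤ (ν i) := by
  by_cases h0 : ∀ j, ν j = 0
  · rw [h0 i]; exact isIntegral_zero
  push Not at h0
  obtain ⟨j, hj⟩ := h0
  refine isIntegral_of_smul_mem_submodule (N := Submodule.span ℤ (Set.range ν)) ?_
    (Submodule.fg_span (Set.finite_range ν)) (ν i) fun x hx => ?_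
  · intro hb
    exact hj ((Submodule.mem_bot ℤ).1 (hb ▸ Submodule.subset_span ⟨j, rfl⟩))
  · induction hx using Submodule.span_induction with
    | mem x hx => obtain ⟨k, rfl⟩ := hx; exact h i k
    | zero => simp
    | add x y _ _ hx hy => rw [smul_add]; exact add_mem hx hy
    | smul z x _ hx =>
      rw [smul_comm]; exact Submodule.smul_mem _ z hx

section block

variable (𝓱 : HaarData K H) {r : ℕ} {d : Fin r → ℕ} [∀ i, NeZero (d i)]
  {E : Type} [Ring E] [Algebra K E] {𝓤 : DRep K H E} (h𝓤 : 𝓤.IsUniversal)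
  (Ψ : E ≃ₐ[K] MatProd K d)

include 𝓱 h𝓤 Ψ

theorem T_irrChar_central (i : Fin r) (b : MatProd K d) :
    Ψ (𝓤.T (irrChar Ψ 𝓤 i)) * b = b * Ψ (𝓤.T (irrChar Ψ 𝓤 i)) := by
  obtain ⟨b, rfl⟩ := Ψ.surjective b
  obtain ⟨θ, rfl⟩ := h𝓤.bijective.2 b
  rw [← map_mul Ψ, ← map_mul Ψ, irrChar, T_chi_comm _ _ 𝓱 (irrTr_tracial Ψ _)]

theorem block_dim_dvd [CharZero K] (v : Fin r) : d v ∣ Module.finrank K H := by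
  obtain ⟨c, hc⟩ := exists_block_unit 𝓱 h𝓤 Ψ v
  set e := ∑ i, c i • irrChar Ψ 𝓤 i with he
  choose m' hm' using exists_antipode_irrChar 𝓱 h𝓤 Ψ
  choose m hm using exists_star_irrChar h𝓤 Ψ
  let ν : Fin r → K := fun j => Ψ (𝓤.T (irrChar Ψ 𝓤 j)) v 0 0
  have hν : ∀ j, Ψ (𝓤.T (irrChar Ψ 𝓤 j)) v = ν j • 1 := fun j => by
    obtain ⟨s, hs⟩ := matProd_central (T_irrChar_central 𝓱 h𝓤 Ψ j) v
    simp only [ν]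
    rw [hs]
    simp
  let L : E →ₗ[K] K := Matrix.entryLinearMap K K 0 0 ∘ₗ LinearMap.proj (φ := fun i => Matrix (Fin (d i)) (Fin (d i)) K) v ∘ₗ Ψ.toLinearMap
  have hLν : ∀ j, L (𝓤.T (irrChar Ψ 𝓤 j)) = ν j := fun j => rfl
  have hL : ∀ x, L x = Ψ x v 0 0 := fun x => rfl
  have hstar : ∀ θ j, 𝓤.T θ * 𝓤.T (irrChar Ψ 𝓤 j) = 𝓤.T (star θ (irrChar Ψ 𝓤 j)) :=
    fun θ j => T_mul_T_chi 𝓤 𝓤 𝓱 (irrTr_tracial Ψ j) θ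
  have heχ : ∀ j, star e (irrChar Ψ 𝓤 j) = ν j • e := fun j => by
    apply h𝓤.bijective.1
    apply Ψ.injective
    rw [← hstar, map_mul Ψ, hc, map_smul, map_smul, hc]
    funext i
    rw [Pi.mul_apply, Pi.smul_apply]
    by_cases h : i = v
    · subst h; simp [hν]
    · simp [h]
  have hc' : ∀ j, c j = (∑ k, (m' j k : K) * ν k) * 𝓱.lam (e 𝓱.Λ) := fun j => by
    have h1 : 𝓱.lam (star e (antipode K ∘ₗ irrChar Ψ 𝓤 j ∘ₗ antipode K) 𝓱.Λ) = c j := by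
      rw [he, star_sum_left]
      simp only [LinearMap.sum_apply, LinearMap.smul_apply, map_sum, map_smul,
        irrChar_orthogonal 𝓱 h𝓤 Ψ]
      simp
    rw [← h1, hm', star_sum_right]
    simp only [heχ, LinearMap.sum_apply, LinearMap.smul_apply, map_sum, map_smul, smul_eq_mul,
      Finset.sum_mul, mul_assoc]
  have hone : ∑ j, c j * ν j = 1 := by
    have h1 : L (𝓤.T e) = 1 := by
      rw [hL, hc]
      simp
    rw [he] at h1
    simpa only [map_sum, map_smul, hLν, smul_eq_mul] using h1
  have htrace : (Module.finrank K H : K) ^ 2 * 𝓱.lam (e 𝓱.Λ) = (d v : K) * d v := by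
    rw [← trace_starR]
    have h2 := trace_eq_of_intertwine
      (V := H →ₗ[K] H) (W := MatProd K d)
      ((LinearEquiv.ofBijective 𝓤.T h𝓤.bijective).trans Ψ.toLinearEquiv) (starR e)
      (mulLeft K (1 : MatProd K d) ∘ₗ mulRight K (Pi.single v 1 : MatProd K d)) (fun θ => by
        have h3 : 𝓤.T (star θ e) = 𝓤.T θ * 𝓤.T e := by
          rw [he, star_sum_right]
          simp only [map_sum, map_smul, Finset.mul_sum, mul_smul_comm, hstar]
        change 1 * (Ψ (𝓤.T θ) * Pi.single v 1) = Ψ (𝓤.T (star θ e))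
        rw [h3, map_mul, hc, one_mul])
    rw [← h2, trace_matProd_mul, Finset.sum_eq_single v]
    · simp
    · intro i _ hi
      simp [hi]
    · simp
  have hint : ∀ i, IsIntegral ℤ (ν i) := isIntegral_of_structure_constants ν fun i j => by
    have h1 : ν i * ν j = ∑ k, (m i j k : K) * ν k := by
      have h2 := congr_arg L (hstar (irrChar Ψ 𝓤 i) j)
      rw [hm, hL, map_mul Ψ, Pi.mul_apply, hν, hν] at h2
      simp only [map_sum, map_smul, hLν, smul_eq_mul] at h2
      rw [← h2]
      simp [mul_comm]
    rw [h1]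
    refine sum_mem fun k _ => ?_
    have : (m i j k : K) * ν k = (m i j k : ℤ) • ν k := by simp
    rw [this]
    exact Submodule.smul_mem _ _ (Submodule.subset_span ⟨k, rfl⟩)
  have key : ((d v ^ 2 : ℕ) : K) * (∑ j, (∑ k, (m' j k : K) * ν k) * ν j) =
      ((Module.finrank K H ^ 2 : ℕ) : K) := by
    have h1 : 𝓱.lam (e 𝓱.Λ) * (∑ j, (∑ k, (m' j k : K) * ν k) * ν j) = 1 := by
      rw [← hone, Finset.mul_sum]
      exact Finset.sum_congr rfl fun j _ => by rw [hc' j]; ring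
    push_cast
    rw [sq (d v : K), ← htrace, mul_assoc, h1, mul_one]
  refine (Nat.pow_dvd_pow_iff two_ne_zero).1 (dvd_of_isIntegral_mul ?_ key)
  refine IsIntegral.sum _ fun j _ => IsIntegral.mul (IsIntegral.sum _ fun k _ =>
    IsIntegral.mul ?_ (hint k)) (hint j)
  exact_mod_cast isIntegral_algebraMap (R := ℤ) (A := K) (x := (m' j k : ℤ))
end block

end

section

variable {K H}
variable [FiniteDimensional K H]

open DRep

theorem trace_eq_one_of_sandwich {V : Type} [AddCommGroup V] [Module K V] [FiniteDimensional K V]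
    {p : Module.End K V} (hp : p * p = p) (h0 : p ≠ 0)
    (h : ∀ ψ : Module.End K V, ∃ c : K, p * ψ * p = c • p) : trace K V p = 1 := by
  obtain ⟨w, hw⟩ : ∃ w, p w ≠ 0 := by
    by_contra! hc
    exact h0 (LinearMap.ext hc)
  have hpv : p (p w) = p w := LinearMap.congr_fun hp w
  obtain ⟨f, hf⟩ : ∃ f : Module.Dual K V, f (p w) ≠ 0 := by
    by_contra! hc
    exact hw ((Module.forall_dual_apply_eq_zero_iff K _).1 hc)
  obtain ⟨c, hc⟩ := h (f.smulRight (p w))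
  have h1 : ∀ x, f (p x) • p w = c • p x := fun x => by
    simpa [hpv] using LinearMap.congr_fun hc x
  have h2 : c = f (p w) := by
    have h3 := congr_arg f (h1 w)
    simp only [map_smul, smul_eq_mul] at h3
    exact (mul_right_cancel₀ hf h3).symm
  have h3 := congr_arg (trace K V) (LinearMap.ext fun x => h1 x :
    (f ∘ₗ p).smulRight (p w) = c • p)
  rw [trace_smulRight, map_smul, LinearMap.comp_apply, hpv, ← h2, smul_eq_mul] at h3
  exact mul_left_cancel₀ (h2 ▸ hf) (h3.symm.trans (mul_one c).symm)

theorem Matrix.mul_single_eq_sum {m : ℕ} (x : Matrix (Fin m) (Fin m) K) (a b : Fin m) :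
    x * Matrix.single a b 1 = ∑ k, x k a • Matrix.single k b 1 := by
  ext k l
  rw [Matrix.sum_apply]
  by_cases h : b = l <;> simp [Matrix.mul_apply, Matrix.single_apply, h]

theorem Matrix.single_mul_eq_sum {m : ℕ} (x : Matrix (Fin m) (Fin m) K) (a b : Fin m) :
    Matrix.single a b 1 * x = ∑ k, x b k • Matrix.single a k 1 := by
  ext k l
  rw [Matrix.sum_apply]
  by_cases h : a = k <;> simp [Matrix.mul_apply, Matrix.single_apply, h]

theorem exists_trace_eq_block {V : Type} [AddCommGroup V] [Module K V] [FiniteDimensional K V]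
    {r : ℕ} {d : Fin r → ℕ} [∀ i, NeZero (d i)] (g : MatProd K d →ₐ[K] Module.End K V)
    {e : Module.End K V} (he : e * e = e) (h0 : e ≠ 0) (hcomm : ∀ x, g x * e = e * g x)
    (h : ∀ φ : Module.End K V, (∀ x, g x * φ = φ * g x) → ∃ c : K, e * φ * e = c • e) :
    ∃ i, trace K V e = d i := by
  obtain ⟨i, hi⟩ : ∃ i, e * g (Pi.single i 1) ≠ 0 := by
    by_contra! hc
    apply h0
    have h1 : (1 : MatProd K d) = ∑ i, Pi.single i 1 := by
      funext i
      rw [Finset.sum_apply, Finset.sum_eq_single i]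
      · simp
      · intro j _ hj; simp [hj.symm]
      · simp
    rw [← mul_one e, ← map_one g, h1, map_sum, Finset.mul_sum]
    exact Finset.sum_eq_zero fun i _ => hc i
  have hei : e * g (Pi.single i 1) = e := by
    obtain ⟨c, hc⟩ := h (g (Pi.single i 1)) fun x => by
      rw [← map_mul, ← map_mul]
      congr 1
      funext j
      by_cases hj : j = i
      · subst hj; simp
      · simp [hj]
    rw [mul_assoc, hcomm, ← mul_assoc, he] at hc
    have h2 : e * g (Pi.single i 1) = c • (c • e) := by
      have h3 : (Pi.single i 1 : MatProd K d) = Pi.single i 1 * Pi.single i 1 := by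
        rw [← Pi.single_mul, one_mul]
      rw [h3, map_mul, ← mul_assoc, hc, smul_mul_assoc, hc]
    have h4 : c ≠ 0 := fun h => hi (by rw [hc, h, zero_smul])
    rw [hc] at h2
    have h5 : e = c • e := by
      have := congr_arg (fun x => c⁻¹ • x) h2
      simpa [smul_smul, h4] using this
    rw [hc, ← h5]
  let M : Fin (d i) → Fin (d i) → MatProd K d := fun a b => Pi.single i (Matrix.single a b 1)
  have hM : ∀ a b c, M a b * M b c = M a c := fun a b c => by
    simp only [M]
    rw [← Pi.single_mul, Matrix.single_mul_single_same, one_mul]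
  have hM0 : ∀ a b b' c, b ≠ b' → M a b * M b' c = 0 := fun a b b' c hb => by
    simp only [M]
    rw [← Pi.single_mul, Matrix.single_mul_single_of_ne _ _ _ _ hb, Pi.single_zero]
  have hML : ∀ a b, M a b = LinearMap.single K (fun i => Matrix (Fin (d i)) (Fin (d i)) K) i
    (Matrix.single a b 1) := fun a b => rfl
  have hxM : ∀ x a b, x * M a b = ∑ k, x i k a • M k b := fun x a b => by
    have h1 : x * M a b = LinearMap.single K (fun i => Matrix (Fin (d i)) (Fin (d i)) K) i
        (x i * Matrix.single a b 1) := by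
      funext j
      by_cases hj : j = i
      · subst hj; simp [M]
      · simp [M, hj]
    rw [h1, Matrix.mul_single_eq_sum, map_sum]
    simp only [hML, map_smul]
  have hMx : ∀ x a b, M a b * x = ∑ k, x i b k • M a k := fun x a b => by
    have h1 : M a b * x = LinearMap.single K (fun i => Matrix (Fin (d i)) (Fin (d i)) K) i
        (Matrix.single a b 1 * x i) := by
      funext j
      by_cases hj : j = i
      · subst hj; simp [M]
      · simp [M, hj]
    rw [h1, Matrix.single_mul_eq_sum, map_sum]
    simp only [hML, map_smul]
  have hsum : (Pi.single i 1 : MatProd K d) = ∑ j, M j 0 * M 0 j := by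
    simp only [hM]
    simp only [hML]
    rw [← map_sum, Matrix.sum_single_one]
    rfl
  have hp : trace K V (e * g (M 0 0)) = 1 := by
    refine trace_eq_one_of_sandwich ?_ ?_ fun ψ => ?_
    · rw [mul_assoc, ← mul_assoc (g _), hcomm, mul_assoc, ← map_mul, hM, ← mul_assoc, he]
    · intro hz
      apply h0
      have : ∀ j, e * g (M j 0 * M 0 j) = 0 := fun j => by
        rw [← hM j 0 0, map_mul, map_mul, mul_assoc, ← mul_assoc, ← hcomm, mul_assoc,
          ← mul_assoc e, hz, zero_mul, mul_zero]
      rw [← hei, hsum, map_sum, Finset.mul_sum]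
      exact Finset.sum_eq_zero fun j _ => this j
    · obtain ⟨c, hc⟩ := h (∑ j, g (M j 0) * ψ * g (M 0 j)) fun x => by
        simp only [Finset.mul_sum, Finset.sum_mul]
        have h1 : ∀ j, g x * (g (M j 0) * ψ * g (M 0 j)) =
            ∑ k, x i k j • (g (M k 0) * ψ * g (M 0 j)) := fun j => by
          rw [← mul_assoc, ← mul_assoc, ← map_mul, hxM]
          simp [Finset.sum_mul]
        have h2 : ∀ j, (g (M j 0) * ψ * g (M 0 j)) * g x =
            ∑ k, x i j k • (g (M j 0) * ψ * g (M 0 k)) := fun j => by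
          rw [mul_assoc, ← map_mul, hMx]
          simp [Finset.mul_sum]
        simp only [h1, h2]
        exact Finset.sum_comm
      refine ⟨c, ?_⟩
      have h3 := congr_arg (fun x => g (M 0 0) * x * g (M 0 0)) hc
      simp only [Finset.mul_sum, Finset.sum_mul] at h3
      rw [Finset.sum_eq_single 0] at h3
      · have h4 : g (M 0 0) * g (M 0 0) = g (M 0 0) := by rw [← map_mul, hM]
        calc e * g (M 0 0) * ψ * (e * g (M 0 0))
            = g (M 0 0) * (e * (g (M 0 0) * ψ * g (M 0 0)) * e) * g (M 0 0) := by
              have h5 : g (M 0 0) * (e * (g (M 0 0) * ψ * g (M 0 0)) * e) * g (M 0 0) =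
                (g (M 0 0) * e) * g (M 0 0) * ψ * (g (M 0 0) * e * g (M 0 0)) := by
                  simp only [mul_assoc]
              rw [h5, hcomm, mul_assoc e (g _) (g _), h4]
          _ = c • (e * g (M 0 0)) := by
              rw [h3, mul_smul_comm, smul_mul_assoc, hcomm, mul_assoc, h4]
      · intro j _ hj
        have h6 : g (M 0 0) * g (M j 0) = 0 := by rw [← map_mul, hM0 _ _ _ _ hj.symm, map_zero]
        have h5 : g (M 0 0) * (e * (g (M j 0) * ψ * g (M 0 j)) * e) * g (M 0 0) =
                (g (M 0 0) * e) * g (M j 0) * ψ * (g (M 0 j) * e * g (M 0 0)) := by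
                  simp only [mul_assoc]
        rw [h5, hcomm, mul_assoc e, h6]
        simp
      · simp
  refine ⟨i, ?_⟩
  rw [← hei, hsum, map_sum, Finset.mul_sum, map_sum]
  rw [Finset.sum_congr rfl fun j _ => (?_ : _ = (1 : K))]
  · simp
  · rw [map_mul g, ← mul_assoc, LinearMap.trace_mul_comm, ← mul_assoc, hcomm, mul_assoc, ← map_mul, hM, hp]

theorem DRep.exists_trace_eq_dvd [IsAlgClosed K] [CharZero K] (𝓱 : HaarData K H)
    {V : Type} [AddCommGroup V] [Module K V] [FiniteDimensional K V]
    (X : DRep K H (Module.End K V)) {e : Module.End K V} (he : e * e = e) (h0 : e ≠ 0)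
    (hπ : ∀ h, X.π h * e = e * X.π h) (hP : ∀ f, X.P f * e = e * X.P f)
    (h : ∀ φ : Module.End K V, (∀ h, X.π h * φ = φ * X.π h) → (∀ f, X.P f * φ = φ * X.P f) →
      ∃ c : K, e * φ * e = c • e) :
    ∃ m : ℕ, trace K V e = m ∧ m ∣ Module.finrank K H := by
  have := isSemisimpleRing_double 𝓱
  obtain ⟨r, d, hd, ⟨Ψ⟩⟩ :=
    IsSemisimpleRing.exists_algEquiv_pi_matrix_of_isAlgClosed K (DRep.double K H)
  have hcomm : ∀ φ : Module.End K V, (∀ h, X.π h * φ = φ * X.π h) →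
      (∀ f, X.P f * φ = φ * X.P f) → ∀ x, X.Φ x * φ = φ * X.Φ x := fun φ h1 h2 x => by
    obtain ⟨θ, rfl⟩ := T_univ_bijective.2 x
    rw [Φ_T, T_apply]
    simp only [Finset.sum_mul, Finset.mul_sum, mul_assoc, h2]
    simp only [← mul_assoc, h1]
  obtain ⟨i, hi⟩ := exists_trace_eq_block (X.Φ.comp Ψ.symm.toAlgHom) he h0
    (fun x => hcomm e hπ hP _) fun φ hφ => h φ
      (fun a => by simpa [Φ_π, Φ_P] using hφ (Ψ ((univ K H).π a)))
      (fun f => by simpa [Φ_π, Φ_P] using hφ (Ψ ((univ K H).P f)))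
  exact ⟨d i, hi, block_dim_dvd 𝓱 isUniversal_univ Ψ i⟩

end

section

variable {K H}
variable [FiniteDimensional K H]

section sandwich

variable {A : Type} [Ring A] [Algebra K A]

/-- `a ⊗ b ↦ (φ ↦ a φ b)`. -/
noncomputable def sandwich : A ⊗[K] A →ₗ[K] Module.End K A :=
  TensorProduct.lift ((LinearMap.llcomp K A A A).compl₁₂ (LinearMap.mul K A)
    (LinearMap.mul K A).flip)

@[simp] theorem sandwich_tmul (a b φ : A) : sandwich (K := K) (a ⊗ₜ b) φ = a * φ * b := by
  simp [sandwich, mul_assoc]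

theorem sandwich_left_mul (x φ : A) (s : A ⊗[K] A) :
    sandwich ((x ⊗ₜ 1) * s) φ = x * sandwich s φ := by
  induction s with
  | zero => simp
  | add s t hs ht => simp [mul_add, hs, ht]
  | tmul a b => simp [mul_assoc]

theorem sandwich_mul_right (x φ : A) (s : A ⊗[K] A) :
    sandwich (s * (1 ⊗ₜ x)) φ = sandwich s φ * x := by
  induction s with
  | zero => simp
  | add s t hs ht => simp [add_mul, hs, ht]
  | tmul a b => simp [mul_assoc]

theorem mul'_left_mul (x : A) (s : A ⊗[K] A) : mul' K A ((x ⊗ₜ 1) * s) = x * mul' K A s := by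
  induction s with
  | zero => simp
  | add s t hs ht => simp [mul_add, hs, ht]
  | tmul a b => simp [mul_assoc]

theorem mul'_mul_right (x : A) (s : A ⊗[K] A) : mul' K A (s * (1 ⊗ₜ x)) = mul' K A s * x := by
  induction s with
  | zero => simp
  | add s t hs ht => simp [add_mul, hs, ht]
  | tmul a b => simp [mul_assoc]

end sandwich

namespace DRep

variable {A : Type} [Ring A] [Algebra K A] (X : DRep K H A) (𝓱 : HaarData K H)

theorem sandwich_sep_of_commute {φ : A} (hπ : ∀ h, X.π h * φ = φ * X.π h)
    (hP : ∀ f, X.P f * φ = φ * X.P f) : sandwich (X.sep 𝓱) φ = φ := by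
  have h1 : sandwich (X.sepH 𝓱) φ = φ * mul' K A (X.sepH 𝓱) := by
    rw [sepH]
    generalize lTensor H (antipode K) (comul (R := K) 𝓱.Λ) = s
    induction s with
    | zero => simp
    | add s t hs ht => simp only [map_add, LinearMap.add_apply, hs, ht, mul_add]
    | tmul a b => simp [hπ, mul_assoc]
  have h2 : sandwich (X.sep 𝓱) φ = φ * mul' K A (X.sep 𝓱) := by
    rw [sep]
    simp only [map_sum, LinearMap.sum_apply, Finset.mul_sum]
    refine Finset.sum_congr rfl fun b _ => ?_
    rw [sandwich_mul_right, sandwich_left_mul, mul'_mul_right, mul'_left_mul, h1, ← mul_assoc,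
      hP]
    simp only [mul_assoc]
  rw [h2, mul_sep, mul_one]

theorem commute_sandwich_sep {x : A} (h : (x ⊗ₜ[K] 1) * X.sep 𝓱 = X.sep 𝓱 * (1 ⊗ₜ[K] x))
    (φ : A) : x * sandwich (X.sep 𝓱) φ = sandwich (X.sep 𝓱) φ * x := by
  rw [← sandwich_left_mul, h, sandwich_mul_right]

theorem finrank_commutant {V : Type} [AddCommGroup V] [Module K V] [FiniteDimensional K V]
    (X : DRep K H (Module.End K V)) {S : Submodule K (Module.End K V)}
    (hS : ∀ φ, φ ∈ S ↔ (∀ h, X.π h * φ = φ * X.π h) ∧ ∀ f, X.P f * φ = φ * X.P f)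
    {e : Module.End K V} (he : e * e = e) (heS : e ∈ S) :
    (Module.finrank K (S.map (mulLeft K e)) : K) =
      𝓱.lam (star (X.chi (trace K V ∘ₗ mulLeft K e))
        (antipode K ∘ₗ X.chi (trace K V) ∘ₗ antipode K) 𝓱.Λ) := by
  have hSmul : ∀ a ∈ S, ∀ b ∈ S, a * b ∈ S := fun a ha b hb => by
    rw [hS] at ha hb ⊢
    exact ⟨fun h => by rw [← mul_assoc, ha.1, mul_assoc, hb.1, mul_assoc],
      fun h => by rw [← mul_assoc, ha.2, mul_assoc, hb.2, mul_assoc]⟩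
  have hQ : ∀ φ, sandwich (X.sep 𝓱) φ ∈ S := fun φ => (hS _).2
    ⟨fun h => X.commute_sandwich_sep 𝓱 (X.π_mul_sep 𝓱 h) φ,
      fun f => X.commute_sandwich_sep 𝓱 (X.P_mul_sep 𝓱 f) φ⟩
  have hproj : LinearMap.IsProj (S.map (mulLeft K e)) (mulLeft K e ∘ₗ sandwich (X.sep 𝓱)) := by
    refine ⟨fun φ => ⟨_, hQ φ, rfl⟩, ?_⟩
    rintro _ ⟨φ, hφ, rfl⟩
    have h1 := (hS _).1 (hSmul e heS φ hφ)
    simp only [LinearMap.comp_apply, mulLeft_apply, X.sandwich_sep_of_commute 𝓱 h1.1 h1.2,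
      ← mul_assoc, he]
  rw [← hproj.trace, ← apply_sep X 𝓱 (fun a b => LinearMap.trace_mul_comm K a b)]
  generalize X.sep 𝓱 = s
  induction s with
  | zero => simp
  | add s t hs ht => simp only [map_add, LinearMap.comp_add, hs, ht]
  | tmul a b =>
    rw [TensorProduct.map_tmul, mul'_apply, LinearMap.comp_apply, mulLeft_apply, ← trace_sandwich]
    congr 1

end DRep

end

section

variable {K H}
variable [FiniteDimensional K H]

/-- An expansion `R = Σ aᵢ ⊗ bᵢ` of an `R`-matrix, together with its basic identities. -/
structure RData (R : H ⊗[K] H) where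
  a : Fin (Module.finrank K H) → H
  b : Fin (Module.finrank K H) → H
  eq : R = ∑ i, a i ⊗ₜ b i
  comul_a : ∑ i, comul (R := K) (a i) ⊗ₜ[K] b i = ∑ i, ∑ j, (a i ⊗ₜ[K] a j) ⊗ₜ[K] (b i * b j)
  comul_b : ∑ i, a i ⊗ₜ[K] comul (R := K) (b i) = ∑ i, ∑ j, (a i * a j) ⊗ₜ[K] (b j ⊗ₜ[K] b i)
  intertwine : ∀ h, (∑ i, a i ⊗ₜ b i) * comul (R := K) h =
    TensorProduct.comm K H H (comul (R := K) h) * ∑ i, a i ⊗ₜ b i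
  counit_a : ∑ i, counit (R := K) (a i) • b i = 1
  counit_b : ∑ i, counit (R := K) (b i) • a i = 1
  antipode_mul : ∑ i, ∑ j, (a i * a j) ⊗ₜ[K] (antipode K (b j) * b i) = 1
  mul_antipode : ∑ i, ∑ j, (a i * a j) ⊗ₜ[K] (b j * antipode K (b i)) = 1

theorem eq_sum_finBasis_tmul {V : Type*} [AddCommGroup V] [Module K V] (R : H ⊗[K] V) :
    R = ∑ i, 𝐛 i ⊗ₜ[K] sliceL ((𝐛).coord i) R := by
  induction R with
  | zero => simp
  | add s t hs ht =>
    conv_lhs => rw [hs, ht]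
    simp only [map_add, tmul_add, Finset.sum_add_distrib]
  | tmul x y =>
    conv_lhs => rw [← (𝐛).sum_repr x, sum_tmul]
    simp [smul_tmul]

theorem mul'_map_counit_comul (h : H) :
    mul' K K (TensorProduct.map (counit (R := K)) (counit (R := K)) (comul (R := K) h)) =
      counit (R := K) h := by
  rw [← lTensor_comp_rTensor, LinearMap.comp_apply, rTensor_counit_comul]
  simp

theorem exists_rData {R : H ⊗[K] H} (hR : IsQuasiTriangular K H R) : Nonempty (RData R) := by
  obtain ⟨a, b, hab⟩ : ∃ a b : Fin (Module.finrank K H) → H, R = ∑ i, a i ⊗ₜ b i :=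
    ⟨_, _, eq_sum_finBasis_tmul R⟩
  have h1 := hR.comul_rTensor
  have h2 := hR.comul_lTensor
  have h3 := hR.intertwine
  obtain ⟨R', hR'⟩ := hR.isUnit.exists_right_inv
  simp only [r13, r23, r12, hab, map_sum, Finset.sum_mul_sum, rTensor_tmul, lTensor_tmul,
    TensorProduct.map_tmul, LinearMap.id_apply, TensorProduct.mk_apply, LinearMap.flip_apply,
    tmul_sum, Algebra.TensorProduct.tmul_mul_tmul, one_mul, mul_one] at h1 h2
  have hcomul_a : ∑ i, comul (R := K) (a i) ⊗ₜ[K] b i =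
      ∑ i, ∑ j, (a i ⊗ₜ[K] a j) ⊗ₜ[K] (b i * b j) := by
    apply (TensorProduct.assoc K H H H).injective
    rw [map_sum, h1]
    simp
  have hε_b : ∑ i, counit (R := K) (b i) • a i = 1 := by
    let E : H ⊗[K] H →ₐ[K] H := (Algebra.TensorProduct.rid K K H).toAlgHom.comp
      (Algebra.TensorProduct.map (AlgHom.id K H) (counitAlgHom K H))
    have hE : E R = ∑ i, counit (R := K) (b i) • a i := by
      simp [E, hab]
    have hEE : E R = E R * E R := by
      have := congr_arg (sliceR (mul' K K ∘ₗ TensorProduct.map (counit (R := K) (A := H))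
        (counit (R := K) (A := H)))) h2
      simp only [map_sum, sliceR_tmul, LinearMap.comp_apply, mul'_map_counit_comul,
        TensorProduct.map_tmul, mul'_apply] at this
      refine hE.trans (this.trans ?_)
      rw [hE, Finset.sum_mul_sum]
      refine Finset.sum_congr rfl fun i _ => Finset.sum_congr rfl fun j _ => ?_
      rw [smul_mul_smul_comm, mul_comm (counit (R := K) (b i))]
    have : E R * E R' = 1 := by rw [← map_mul, hR', map_one]
    rw [← hE]
    calc E R = E R * (E R * E R') := by rw [this, mul_one]
      _ = 1 := by rw [← mul_assoc, ← hEE, this]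
  have hε_a : ∑ i, counit (R := K) (a i) • b i = 1 := by
    let E : H ⊗[K] H →ₐ[K] H := (Algebra.TensorProduct.lid K H).toAlgHom.comp
      (Algebra.TensorProduct.map (counitAlgHom K H) (AlgHom.id K H))
    have hE : E R = ∑ i, counit (R := K) (a i) • b i := by
      simp [E, hab]
    have hEE : E R = E R * E R := by
      have := congr_arg (sliceL (mul' K K ∘ₗ TensorProduct.map (counit (R := K) (A := H))
        (counit (R := K) (A := H)))) hcomul_a
      simp only [map_sum, sliceL_tmul, LinearMap.comp_apply, mul'_map_counit_comul,
        TensorProduct.map_tmul, mul'_apply] at this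
      refine hE.trans (this.trans ?_)
      rw [hE, Finset.sum_mul_sum]
      refine Finset.sum_congr rfl fun i _ => Finset.sum_congr rfl fun j _ => ?_
      rw [smul_mul_smul_comm]
    have : E R * E R' = 1 := by rw [← map_mul, hR', map_one]
    rw [← hE]
    calc E R = E R * (E R * E R') := by rw [this, mul_one]
      _ = 1 := by rw [← mul_assoc, ← hEE, this]
  have hone : ∑ i, a i ⊗ₜ[K] algebraMap K H (counit (R := K) (b i)) = 1 := by
    simp only [Algebra.algebraMap_eq_smul_one, tmul_smul, smul_tmul']
    rw [← sum_tmul, hε_b, Algebra.TensorProduct.one_def]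
  refine ⟨⟨a, b, hab, hcomul_a, h2, fun h => by rw [← hab, h3 h], hε_a, hε_b, ?_, ?_⟩⟩
  · have := congr_arg (lTensor H (mul' K H ∘ₗ rTensor H (antipode K))) h2
    simp only [map_sum, lTensor_tmul, LinearMap.comp_apply, rTensor_tmul, mul'_apply,
      mul_antipode_rTensor_comul_apply] at this
    rw [← this, hone]
  · have := congr_arg (lTensor H (mul' K H ∘ₗ lTensor H (antipode K))) h2
    simp only [map_sum, lTensor_tmul, LinearMap.comp_apply, mul'_apply,
      mul_antipode_lTensor_comul_apply] at this
    rw [← this, hone]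

end

section

variable {K H}
variable [FiniteDimensional K H]

/-- The left adjoint action as a bilinear map. -/
noncomputable def ad : H →ₗ[K] H →ₗ[K] H := TensorProduct.curry (adMap K H)

theorem ad_apply (h x : H) : ad (K := K) h x = adAct K H h x := rfl

theorem ad_eq (h x : H) : ad (K := K) h x =
    mul' K H (TensorProduct.map (mulRight K x) (antipode K) (comul (R := K) h)) := by
  simp only [ad, adMap, TensorProduct.curry_apply, LinearMap.comp_apply, rTensor_tmul,
    LinearEquiv.coe_coe]
  induction comul (R := K) h with
  | zero => simp
  | tmul u v => simp [mul_assoc]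
  | add s t hs ht => simp only [add_tmul, map_add, hs, ht]

theorem ad_mc (i j) (x : H) : ad (K := K) (mc K H i j) x =
    ∑ k, mc K H i k * x * antipode K (mc K H k j) := by
  simp [ad_eq, comul_mc]

theorem ad_one (x : H) : ad (K := K) 1 x = x := by
  simp [ad_eq, Algebra.TensorProduct.one_def]

theorem ad_mul (g h x : H) : ad (K := K) (g * h) x = ad (K := K) g (ad (K := K) h x) := by
  simp only [ad_eq, Bialgebra.comul_mul]
  induction comul (R := K) g with
  | zero => simp
  | add s t hs ht => simp only [add_mul, map_add, hs, ht]
  | tmul a b =>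
    induction comul (R := K) h with
    | zero => simp
    | tmul u v => simp [mul_assoc, antipode_mul_antidistrib]
    | add s t hs ht =>
      simp only [mul_add, map_add, hs, ht, TensorProduct.map_tmul, mulRight_apply, mul'_apply,
        add_mul]

theorem sum_ad_mc_mul_mc (i j) (x : H) :
    ∑ k, ad (K := K) (mc K H i k) x * mc K H k j = mc K H i j * x := by
  simp only [ad_mc, Finset.sum_mul]
  rw [Finset.sum_comm]
  simp only [mul_assoc, ← Finset.mul_sum, sum_antipode_mul_mc]
  simp

theorem deltaR_eq {R : H ⊗[K] H} (d : RData R) (h : H) : deltaR K H R h =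
    ∑ i, TensorProduct.map (mulRight K (antipode K (d.b i))) (ad (K := K) (d.a i))
      (comul (R := K) h) := by
  simp only [deltaR, LinearMap.comp_apply]
  conv_lhs => rw [d.eq]
  induction comul (R := K) h with
  | zero => simp
  | tmul u v =>
    simp only [LinearMap.sum_apply, flip_apply, TensorProduct.mk_apply, map_sum, lTensor_tmul,
      LinearEquiv.coe_coe, TensorProduct.comm_tmul, tensorTensorTensorComm_tmul,
      TensorProduct.map_tmul, LinearMap.comp_apply, mul'_apply, mulRight_apply]
    rfl
  | add s t hs ht => simp only [map_add, hs, ht, Finset.sum_add_distrib]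

theorem deltaR_mc {R : H ⊗[K] H} (d : RData R) (p q) : deltaR K H R (mc K H p q) =
    ∑ i, ∑ k, (mc K H p k * antipode K (d.b i)) ⊗ₜ[K] ad (K := K) (d.a i) (mc K H k q) := by
  simp [deltaR_eq d, comul_mc]

namespace RData

variable {R : H ⊗[K] H} (d : RData R)

theorem sum_slice (g φ : H →ₗ[K] K) :
    ∑ j, ∑ k, g (antipode K (d.b k) * d.b j) •
      sliceL φ (comul (R := K) (d.a j) * (d.a k ⊗ₜ 1)) = φ 1 • ∑ j, g (d.b j) • d.a j := by
  have h1 : ∀ k, ∑ j, g (antipode K (d.b k) * d.b j) •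
      sliceL φ (comul (R := K) (d.a j) * (d.a k ⊗ₜ 1)) =
      ∑ j, ∑ l, g (antipode K (d.b k) * (d.b j * d.b l)) •
        sliceL φ ((d.a j * d.a k) ⊗ₜ[K] d.a l) := by
    intro k
    have := congr_arg (sliceR (g ∘ₗ mulLeft K (antipode K (d.b k)))) d.comul_a
    have := congr_arg (fun t => sliceL φ (t * (d.a k ⊗ₜ[K] (1 : H)))) this
    simpa only [map_sum, sliceR_tmul, Finset.sum_mul, LinearMap.comp_apply, mulLeft_apply,
      smul_mul_assoc, map_smul, Algebra.TensorProduct.tmul_mul_tmul, mul_one] using this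
  rw [Finset.sum_comm]
  simp only [h1]
  have h2 : ∀ l, ∑ j, ∑ k, g (antipode K (d.b k) * (d.b j * d.b l)) •
      sliceL φ ((d.a j * d.a k) ⊗ₜ[K] d.a l) = φ 1 • g (d.b l) • d.a l := by
    intro l
    have := congr_arg (sliceR (g ∘ₗ mulRight K (d.b l))) d.antipode_mul
    simp only [map_sum, sliceR_tmul, Algebra.TensorProduct.one_def, LinearMap.comp_apply,
      mulRight_apply, one_mul] at this
    have := congr_arg φ this
    simp only [map_sum, map_smul, smul_eq_mul] at this
    simp only [sliceL_tmul, smul_smul, ← Finset.sum_smul]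
    rw [mul_comm (φ 1), ← this]
    simp only [mul_assoc]
  calc _ = ∑ l, ∑ j, ∑ k, g (antipode K (d.b k) * (d.b j * d.b l)) •
      sliceL φ ((d.a j * d.a k) ⊗ₜ[K] d.a l) := by
        rw [Finset.sum_comm, Finset.sum_congr rfl fun j _ => Finset.sum_comm, Finset.sum_comm]
    _ = _ := by simp only [h2, Finset.smul_sum]

theorem intertwine_mc (l j) : ∑ i, ∑ k, (d.a i * mc K H l k) ⊗ₜ[K] (d.b i * mc K H k j) =
    ∑ i, ∑ k, (mc K H k j * d.a i) ⊗ₜ[K] (mc K H l k * d.b i) := by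
  have := d.intertwine (mc K H l j)
  simp only [comul_mc, map_sum, TensorProduct.comm_tmul, Finset.sum_mul_sum,
    Algebra.TensorProduct.tmul_mul_tmul] at this
  rw [this, Finset.sum_comm]

end RData

section Coaction

variable {R : H ⊗[K] H} {V : Type} [AddCommGroup V] [Module K V] (s : RModStr K H R V)

/-- The coefficient `v ↦ Σ f(v₍₋₁₎) v₍₀₎` of the coaction. -/
noncomputable def coeff : (H →ₗ[K] K) →ₗ[K] Module.End K V where
  toFun f := sliceL f ∘ₗ s.coact
  map_add' f g := by
    ext v
    simp only [LinearMap.comp_apply, LinearMap.add_apply]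
    induction s.coact v with
    | zero => simp
    | tmul x y => simp [add_smul]
    | add x y hx hy => simp only [map_add, hx, hy]; abel
  map_smul' c f := by
    ext v
    exact sliceL_smul f c _

theorem coeff_apply (f : H →ₗ[K] K) (v : V) : coeff s f v = sliceL f (s.coact v) := rfl

theorem coeff_eq_sum (f : H →ₗ[K] K) :
    coeff s f = ∑ m, f (𝐛 m) • coeff s ((𝐛).coord m) := (sum_smul_coord (coeff s) f).symm

theorem coeff_counit : coeff s (counit (R := K)) = 1 := by
  ext v
  exact s.counit_coact v

theorem coeff_mul_coeff (f g : H →ₗ[K] K) : coeff s g * coeff s f =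
    coeff s (mul' K K ∘ₗ TensorProduct.map f g ∘ₗ deltaR K H R) := by
  ext v
  have h := congr_arg (sliceL (mul' K K ∘ₗ TensorProduct.map f g))
    (LinearMap.congr_fun s.coassocR v)
  simp only [LinearMap.comp_apply] at h
  rw [coeff_apply, ← LinearMap.comp_assoc, ← sliceL_rTensor, h, Module.End.mul_apply,
    coeff_apply s f]
  induction s.coact v with
  | zero => simp
  | add x y hx hy => simp only [map_add, hx, hy]
  | tmul x y =>
    simp only [sliceL_tmul, map_smul, coeff_apply, lTensor_tmul, LinearEquiv.coe_coe]
    induction s.coact y with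
    | zero => simp
    | add x y hx hy => simp only [map_add, tmul_add, hx, hy, smul_add]
    | tmul u v => simp [smul_smul]

theorem coeff_mul_act (f : H →ₗ[K] K) (h : H) : coeff s f * s.act h =
    ∑ m, s.act (sliceL (f ∘ₗ (ad (K := K)).flip (𝐛 m)) (comul (R := K) h)) *
      coeff s ((𝐛).coord m) := by
  ext v
  have hc := congr_arg (sliceL f) (LinearMap.congr_fun s.compat (h ⊗ₜ v))
  simp only [LinearMap.comp_apply, TensorProduct.lift.tmul, TensorProduct.map_tmul,
    LinearEquiv.coe_coe] at hc
  refine hc.trans ?_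
  simp only [LinearMap.sum_apply, Module.End.mul_apply, coeff_apply]
  induction comul (R := K) h with
  | zero => simp
  | add x y hx hy => simp only [map_add, add_tmul, hx, hy, LinearMap.add_apply, Finset.sum_add_distrib]
  | tmul x y =>
    induction s.coact v with
    | zero => simp
    | add x y hx hy => simp only [map_add, tmul_add, hx, hy, Finset.sum_add_distrib]
    | tmul u v =>
      have hu := congr_arg (fun t => f (ad (K := K) x t)) ((𝐛).sum_repr u)
      simp only [map_sum, map_smul, smul_eq_mul] at hu
      simp only [tensorTensorTensorComm_tmul, TensorProduct.map_tmul, sliceL_tmul,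
        TensorProduct.lift.tmul, map_smul, LinearMap.smul_apply, smul_smul, ← Finset.sum_smul]
      change f (ad (K := K) x u) • _ = _
      rw [← hu]
      simp

theorem coeff_mul_act_mc (f : H →ₗ[K] K) (i j) : coeff s f * s.act (mc K H i j) =
    ∑ k, s.act (mc K H k j) * coeff s (f ∘ₗ ad (K := K) (mc K H i k)) := by
  rw [coeff_mul_act]
  simp only [comul_mc, map_sum, sliceL_tmul, map_smul, Finset.sum_mul, smul_mul_assoc]
  rw [Finset.sum_comm]
  refine Finset.sum_congr rfl fun k _ => ?_
  rw [coeff_eq_sum s (f ∘ₗ _)]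
  simp [Finset.mul_sum]

end Coaction

end

section

variable {K H}
variable [FiniteDimensional K H]

section

variable {R : H ⊗[K] H} (d : RData R) {V : Type} [AddCommGroup V] [Module K V]
  (s : RModStr K H R V)

/-- The coefficients of the Yetter–Drinfeld coaction `v ↦ Σ v₍₋₁₎ R² ⊗ R¹ v₍₀₎` attached to an
`H_R`-coaction. -/
noncomputable def drepP : (H →ₗ[K] K) →ₗ[K] Module.End K V where
  toFun f := ∑ i, s.act (d.a i) * coeff s (f ∘ₗ mulRight K (d.b i))
  map_add' f g := by simp [LinearMap.add_comp, mul_add, Finset.sum_add_distrib]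
  map_smul' c f := by simp [LinearMap.smul_comp, Finset.smul_sum]

theorem drepP_apply (f : H →ₗ[K] K) :
    drepP d s f = ∑ i, s.act (d.a i) * coeff s (f ∘ₗ mulRight K (d.b i)) := rfl

theorem drepP_eq_sum (f : H →ₗ[K] K) : drepP d s f =
    ∑ m, s.act (∑ i, f (𝐛 m * d.b i) • d.a i) * coeff s ((𝐛).coord m) := by
  simp only [drepP_apply, map_sum, map_smul, Finset.sum_mul, smul_mul_assoc]
  rw [Finset.sum_comm]
  refine Finset.sum_congr rfl fun i _ => ?_
  rw [coeff_eq_sum]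
  simp [Finset.mul_sum]

theorem drepP_counit : drepP d s (counit (R := K)) = 1 := by
  rw [drepP_apply]
  have : ∀ i, coeff s (counit (R := K) ∘ₗ mulRight K (d.b i)) = counit (R := K) (d.b i) • 1 := by
    intro i
    rw [← coeff_counit s, ← map_smul]
    congr 1
    ext x
    simp [mul_comm]
  simp only [this, mul_smul_comm, mul_one, ← map_smul, ← map_sum, d.counit_b, map_one]

theorem coeff_mul_act_mul_coeff (f g : H →ₗ[K] K) (h : H) :
    coeff s f * s.act h * coeff s g = ∑ n, ∑ p, ∑ k,
      g (mc K H n p * antipode K (d.b k)) •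
        (s.act (sliceL (f ∘ₗ (ad (K := K)).flip (𝐛 p)) (comul (R := K) h * (d.a k ⊗ₜ 1))) *
          coeff s ((𝐛).coord n)) := by
  have hc : ∀ m, coeff s ((𝐛).coord m) * coeff s g = ∑ n, ∑ p, ∑ k,
      (g (mc K H n p * antipode K (d.b k)) * (𝐛).coord m (ad (K := K) (d.a k) (𝐛 p))) •
        coeff s ((𝐛).coord n) := by
    intro m
    rw [coeff_mul_coeff, coeff_eq_sum]
    refine Finset.sum_congr rfl fun n _ => ?_
    simp only [LinearMap.comp_apply, deltaR_eq d, comul_finBasis, map_sum, TensorProduct.map_tmul,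
      mulRight_apply, mul'_apply, Finset.sum_smul]
    rw [Finset.sum_comm]
  have hs : ∀ k p, sliceL (f ∘ₗ (ad (K := K)).flip (𝐛 p)) (comul (R := K) h * (d.a k ⊗ₜ 1)) =
      ∑ m, (𝐛).coord m (ad (K := K) (d.a k) (𝐛 p)) •
        sliceL (f ∘ₗ (ad (K := K)).flip (𝐛 m)) (comul (R := K) h) := by
    intro k p
    induction comul (R := K) h with
    | zero => simp
    | add x y hx hy => simp only [add_mul, map_add, hx, hy, smul_add, Finset.sum_add_distrib]
    | tmul x y =>
      have hu := congr_arg (fun t => f (ad (K := K) x t))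
        ((𝐛).sum_repr (ad (K := K) (d.a k) (𝐛 p)))
      simp only [map_sum, map_smul, smul_eq_mul] at hu
      simp only [Algebra.TensorProduct.tmul_mul_tmul, sliceL_tmul, LinearMap.comp_apply,
        LinearMap.flip_apply, ad_mul, mul_one, smul_smul, ← Finset.sum_smul]
      rw [← hu]
      rfl
  rw [coeff_mul_act, Finset.sum_mul]
  simp only [mul_assoc, hc, hs]
  simp only [Finset.mul_sum, mul_smul_comm, map_sum, map_smul, Finset.sum_mul, smul_mul_assoc,
    Finset.smul_sum, smul_smul]
  rw [Finset.sum_comm]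
  refine Finset.sum_congr rfl fun n _ => ?_
  rw [Finset.sum_comm]
  refine Finset.sum_congr rfl fun p _ => ?_
  rw [Finset.sum_comm]

theorem drepP_mul (f g : H →ₗ[K] K) : drepP d s f * drepP d s g = drepP d s (convF g f) := by
  have h1 : ∀ i, coeff s (f ∘ₗ mulRight K (d.b i)) * drepP d s g = ∑ n, ∑ p,
      s.act (f (𝐛 p * d.b i) • ∑ j, g (mc K H n p * d.b j) • d.a j) *
        coeff s ((𝐛).coord n) := by
    intro i
    simp only [drepP_apply d s g, Finset.mul_sum, ← mul_assoc, coeff_mul_act_mul_coeff d s]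
    rw [Finset.sum_comm]
    refine Finset.sum_congr rfl fun n _ => ?_
    rw [Finset.sum_comm]
    refine Finset.sum_congr rfl fun p _ => ?_
    have := congr_arg (fun t => s.act t * coeff s ((𝐛).coord n))
      (d.sum_slice (g ∘ₗ mulLeft K (mc K H n p))
        ((f ∘ₗ mulRight K (d.b i)) ∘ₗ (ad (K := K)).flip (𝐛 p)))
    simp only [map_sum, map_smul, Finset.sum_mul, smul_mul_assoc, LinearMap.comp_apply,
      mulLeft_apply, mulRight_apply, LinearMap.flip_apply, ad_one, ← mul_assoc] at this ⊢
    exact this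
  rw [drepP_apply d s f, Finset.sum_mul]
  simp only [mul_assoc, h1]
  rw [drepP_eq_sum]
  simp only [Finset.mul_sum, ← mul_assoc, ← map_mul]
  rw [Finset.sum_comm]
  refine Finset.sum_congr rfl fun n _ => ?_
  simp only [← Finset.sum_mul, ← map_sum]
  congr 2
  have h2 : ∀ h : H, convF g f (𝐛 n * h) = ∑ p, mul' K K (TensorProduct.map
      (g ∘ₗ mulLeft K (mc K H n p)) (f ∘ₗ mulLeft K (𝐛 p)) (comul (R := K) h)) := by
    intro h
    simp only [convF, hitL, LinearMap.comp_apply, Bialgebra.comul_mul,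
      comul_finBasis, map_sum, Finset.sum_mul]
    refine Finset.sum_congr rfl fun p _ => ?_
    induction comul (R := K) h with
    | zero => simp
    | add x y hx hy => simp only [mul_add, map_add, hx, hy]
    | tmul x y => simp [mul_comm]
  simp only [h2, Finset.sum_smul]
  rw [Finset.sum_comm, Finset.sum_comm (γ := Fin _) (f := fun i p => mul' K K _ • d.a i)]
  refine Finset.sum_congr rfl fun p _ => ?_
  have := congr_arg (sliceR (mul' K K ∘ₗ TensorProduct.map (g ∘ₗ mulLeft K (mc K H n p))
    (f ∘ₗ mulLeft K (𝐛 p)))) d.comul_b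
  simp only [map_sum, sliceR_tmul, LinearMap.comp_apply, TensorProduct.map_tmul, mulLeft_apply,
    mul'_apply] at this
  rw [this]
  simp only [mul_smul_comm, Finset.mul_sum, Finset.smul_sum, smul_smul]
  refine Finset.sum_congr rfl fun i _ => Finset.sum_congr rfl fun j _ => ?_
  rw [mul_comm (g _)]

theorem drepP_yd (f : H →ₗ[K] K) (i j) :
    ∑ k, s.act (mc K H k j) * drepP d s (f ∘ₗ mulLeft K (mc K H i k)) =
      ∑ k, drepP d s (f ∘ₗ mulRight K (mc K H k j)) * s.act (mc K H i k) := by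
  have h1 : ∀ k, drepP d s (f ∘ₗ mulRight K (mc K H k j)) * s.act (mc K H i k) =
      ∑ m, ∑ l, ∑ r, f (ad (K := K) (mc K H i l) (𝐛 m) * (d.b r * mc K H k j)) •
        (s.act (d.a r * mc K H l k) * coeff s ((𝐛).coord m)) := by
    intro k
    rw [drepP_apply, Finset.sum_mul]
    simp only [mul_assoc, coeff_mul_act_mc]
    simp only [coeff_eq_sum s (_ ∘ₗ ad (K := K) _), LinearMap.comp_apply, mulRight_apply,
      Finset.mul_sum, mul_smul_comm, map_mul, mul_assoc]
    rw [Finset.sum_congr rfl fun r _ => Finset.sum_comm, Finset.sum_comm]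
    refine Finset.sum_congr rfl fun m _ => ?_
    rw [Finset.sum_comm]
  have h2 : ∀ m l, ∑ k, ∑ r, f (ad (K := K) (mc K H i l) (𝐛 m) * (d.b r * mc K H k j)) •
      (s.act (d.a r * mc K H l k) * coeff s ((𝐛).coord m)) =
      ∑ k, ∑ r, f (ad (K := K) (mc K H i l) (𝐛 m) * (mc K H l k * d.b r)) •
      (s.act (mc K H k j * d.a r) * coeff s ((𝐛).coord m)) := by
    intro m l
    have := congr_arg (fun t => s.act (sliceR
      (f ∘ₗ mulLeft K (ad (K := K) (mc K H i l) (𝐛 m))) t) * coeff s ((𝐛).coord m))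
      (d.intertwine_mc l j)
    simp only [map_sum, sliceR_tmul, map_smul, Finset.sum_mul, smul_mul_assoc, LinearMap.comp_apply,
      mulLeft_apply] at this
    rw [Finset.sum_comm, this, Finset.sum_comm]
  calc _ = ∑ m, ∑ k, ∑ r, f (mc K H i k * 𝐛 m * d.b r) •
      (s.act (mc K H k j * d.a r) * coeff s ((𝐛).coord m)) := by
        rw [Finset.sum_comm]
        refine Finset.sum_congr rfl fun k _ => ?_
        rw [drepP_eq_sum, Finset.mul_sum]
        refine Finset.sum_congr rfl fun m _ => ?_
        simp only [← mul_assoc, ← map_mul, Finset.mul_sum, mul_smul_comm, map_sum, map_smul,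
          Finset.sum_mul, smul_mul_assoc, LinearMap.comp_apply, mulLeft_apply]
    _ = _ := by
        symm
        simp only [h1]
        rw [Finset.sum_comm]
        refine Finset.sum_congr rfl fun m _ => ?_
        rw [Finset.sum_comm]
        simp only [h2]
        rw [Finset.sum_comm]
        refine Finset.sum_congr rfl fun k _ => ?_
        rw [Finset.sum_comm]
        refine Finset.sum_congr rfl fun r _ => ?_
        rw [← Finset.sum_smul, ← map_sum, ← sum_ad_mc_mul_mc i k, Finset.sum_mul]
        simp only [mul_assoc]

/-- The Yetter–Drinfeld module attached to an object of `_H^{H_R}M`. -/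
noncomputable def toDRep : DRep K H (Module.End K V) where
  π := s.act
  P := drepP d s
  P_counit := drepP_counit d s
  P_mul := drepP_mul d s
  yd := drepP_yd d s

end

end

section

variable {K H}
variable [FiniteDimensional K H]

section

variable {R : H ⊗[K] H} {V : Type} [AddCommGroup V] [Module K V] (s : RModStr K H R V)

theorem coeff_eq_sum_drepP (d : RData R) (f : H →ₗ[K] K) : coeff s f =
    ∑ k, s.act (d.a k) * drepP d s (f ∘ₗ mulRight K (antipode K (d.b k))) := by
  have h : ∀ m, ∑ k, ∑ i, f (𝐛 m * d.b i * antipode K (d.b k)) • (d.a k * d.a i) =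
      f (𝐛 m) • 1 := by
    intro m
    have := congr_arg (sliceR (f ∘ₗ mulLeft K (𝐛 m))) d.mul_antipode
    simpa [Algebra.TensorProduct.one_def, mul_assoc] using this
  simp only [drepP_eq_sum, Finset.mul_sum, ← mul_assoc, ← map_mul, mul_smul_comm]
  rw [Finset.sum_comm, coeff_eq_sum]
  refine Finset.sum_congr rfl fun m _ => ?_
  rw [← Finset.sum_mul, ← map_sum]
  simp only [LinearMap.comp_apply, mulRight_apply, h]
  simp

theorem mem_endHD_iff (φ : Module.End K V) : φ ∈ endHD K H R s ↔
    (∀ h, s.act h * φ = φ * s.act h) ∧ ∀ f, coeff s f * φ = φ * coeff s f := by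
  refine and_congr Iff.rfl ⟨fun h f => ?_, fun h => ?_⟩
  · ext v
    have := congr_arg (sliceL f) (LinearMap.congr_fun h v)
    simp only [LinearMap.comp_apply, ← map_sliceL] at this
    exact this.symm
  · ext v
    rw [eq_sum_finBasis_tmul ((lTensor H φ ∘ₗ s.coact) v), eq_sum_finBasis_tmul ((s.coact ∘ₗ φ) v)]
    refine Finset.sum_congr rfl fun i _ => ?_
    congr 1
    have := LinearMap.congr_fun (h ((𝐛).coord i)) v
    simp only [LinearMap.comp_apply, ← map_sliceL]
    exact this.symm

theorem mem_endHD_iff_drepP (d : RData R) (φ : Module.End K V) : φ ∈ endHD K H R s ↔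
    (∀ h, (toDRep d s).π h * φ = φ * (toDRep d s).π h) ∧
      ∀ f, (toDRep d s).P f * φ = φ * (toDRep d s).P f := by
  rw [mem_endHD_iff]
  refine and_congr_right fun hπ => ⟨fun h f => ?_, fun h f => ?_⟩
  · change drepP d s f * φ = φ * drepP d s f
    simp only [drepP_apply, Finset.sum_mul, Finset.mul_sum, mul_assoc, h]
    simp only [← mul_assoc, hπ]
  · have h' : ∀ f, drepP d s f * φ = φ * drepP d s f := h
    simp only [coeff_eq_sum_drepP s d, Finset.sum_mul, Finset.mul_sum, mul_assoc, h']
    simp only [← mul_assoc, hπ]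

/-- The element `z` of `H` with `f z = tr (C_f e)` for every functional `f`. -/
noncomputable def charElt (e : Module.End K V) : H :=
  ∑ m, trace K V (coeff s ((𝐛).coord m) * e) • 𝐛 m

theorem apply_charElt (e : Module.End K V) (f : H →ₗ[K] K) :
    f (charElt s e) = trace K V (coeff s f * e) := by
  rw [coeff_eq_sum]
  simp [charElt, Finset.sum_mul, mul_comm]

theorem counit_charElt (e : Module.End K V) :
    counit (R := K) (charElt s e) = trace K V e := by
  rw [apply_charElt, coeff_counit, one_mul]

theorem charElt_mem {D : Submodule K H}
    (hD : ∀ v, s.coact v ∈ Submodule.map₂ (TensorProduct.mk K H V) D ⊤) (e : Module.End K V) :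
    charElt s e ∈ D := by
  by_contra hz
  obtain ⟨f, hfz, hfD⟩ := Submodule.exists_le_ker_of_notMem hz
  have : coeff s f = 0 := by
    ext v
    have hle : Submodule.map₂ (TensorProduct.mk K H V) D ⊤ ≤ ker (sliceL f) := by
      rw [Submodule.map₂_le]
      intro x hx y _
      simp [LinearMap.mem_ker.mp (hfD hx)]
    exact hle (hD v)
  exact hfz (by rw [apply_charElt, this]; simp)

theorem ad_charElt_mc (𝓱 : HaarData K H) {e : Module.End K V} (he : e ∈ endHD K H R s) (i l) :
    ad (K := K) (mc K H i l) (charElt s e) = if i = l then charElt s e else 0 := by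
  refine eq_of_dual_eq (K := K) fun f => ?_
  have h1 : coeff s (f ∘ₗ ad (K := K) (mc K H i l)) =
      ∑ j, s.act (antipode K (mc K H j l)) * coeff s f * s.act (mc K H i j) := by
    simp only [mul_assoc, coeff_mul_act_mc, Finset.mul_sum]
    rw [Finset.sum_comm]
    simp only [← mul_assoc, ← map_mul, ← Finset.sum_mul, ← map_sum, 𝓱.sum_antipode_mul_mc']
    simp
  change (f ∘ₗ ad (K := K) (mc K H i l)) _ = _
  rw [apply_charElt, h1, Finset.sum_mul, map_sum]
  have h2 : ∀ j, trace K V (s.act (antipode K (mc K H j l)) * coeff s f * s.act (mc K H i j) * e) =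
      trace K V (coeff s f * e * s.act (mc K H i j * antipode K (mc K H j l))) := by
    intro j
    rw [mul_assoc _ _ e, ((mem_endHD_iff s e).1 he).1, mul_assoc, LinearMap.trace_mul_comm,
      map_mul s.act]
    simp only [mul_assoc]
  simp only [h2, ← map_sum, ← Finset.mul_sum, sum_mc_mul_antipode]
  split_ifs
  · simp [apply_charElt]
  · simp

theorem ad_charElt (𝓱 : HaarData K H) {e : Module.End K V} (he : e ∈ endHD K H R s) (h : H) :
    ad (K := K) h (charElt s e) = counit (R := K) h • charElt s e := by
  have : (ad (K := K)).flip (charElt s e) = (counit (R := K)).smulRight (charElt s e) := by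
    refine ext_mc fun i j => ?_
    simp [ad_charElt_mc s 𝓱 he, counit_mc]
  exact LinearMap.congr_fun this h

end

end

section

variable {K H}
variable [FiniteDimensional K H]

namespace RData

variable {R : H ⊗[K] H} (d : RData R) (𝓱 : HaarData K H)
include 𝓱

theorem inv_mul : (∑ i, d.a i ⊗ₜ[K] antipode K (d.b i)) * ∑ i, d.a i ⊗ₜ[K] d.b i = 1 := by
  have := congr_arg (lTensor H (antipode K)) d.antipode_mul
  simp only [map_sum, lTensor_tmul, antipode_mul_antidistrib, 𝓱.sq,
    Algebra.TensorProduct.one_def, antipode_one] at this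
  simpa only [Finset.sum_mul_sum, Algebra.TensorProduct.tmul_mul_tmul,
    Algebra.TensorProduct.one_def] using this

theorem mul_inv : (∑ i, d.a i ⊗ₜ[K] d.b i) * ∑ i, d.a i ⊗ₜ[K] antipode K (d.b i) = 1 := by
  have := congr_arg (lTensor H (antipode K)) d.mul_antipode
  simp only [map_sum, lTensor_tmul, antipode_mul_antidistrib, 𝓱.sq,
    Algebra.TensorProduct.one_def, antipode_one] at this
  simpa only [Finset.sum_mul_sum, Algebra.TensorProduct.tmul_mul_tmul,
    Algebra.TensorProduct.one_def] using this

omit 𝓱 in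
theorem mul_inv_left : (∑ i, d.a i ⊗ₜ[K] d.b i) * ∑ i, antipode K (d.a i) ⊗ₜ[K] d.b i = 1 := by
  have := congr_arg (rTensor H (mul' K H ∘ₗ lTensor H (antipode K))) d.comul_a
  simp only [map_sum, rTensor_tmul, LinearMap.comp_apply, mul_antipode_lTensor_comul_apply,
    lTensor_tmul, mul'_apply, Algebra.algebraMap_eq_smul_one] at this
  rw [Finset.sum_mul_sum]
  simp only [Algebra.TensorProduct.tmul_mul_tmul, ← this, smul_tmul, ← tmul_sum, d.counit_a,
    Algebra.TensorProduct.one_def]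

theorem inv_eq : ∑ i, d.a i ⊗ₜ[K] antipode K (d.b i) = ∑ i, antipode K (d.a i) ⊗ₜ[K] d.b i :=
  left_inv_eq_right_inv (d.inv_mul 𝓱) d.mul_inv_left

theorem antipode_antipode :
    ∑ i, antipode K (d.a i) ⊗ₜ[K] antipode K (d.b i) = ∑ i, d.a i ⊗ₜ[K] d.b i := by
  have := congr_arg (rTensor H (antipode K)) (d.inv_eq 𝓱)
  simpa only [map_sum, rTensor_tmul, 𝓱.sq] using this

theorem sum_mul_antipode : ∑ i, ∑ j, (d.a i * antipode K (d.a j)) ⊗ₜ[K]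
    (antipode K (d.b i) * antipode K (d.b j)) = 1 := by
  have := d.inv_mul 𝓱
  rw [← d.antipode_antipode 𝓱] at this
  simpa only [Finset.sum_mul_sum, Algebra.TensorProduct.tmul_mul_tmul] using this

theorem inv_intertwine (p q) :
    ∑ r, ∑ j, (d.a j * mc K H r q) ⊗ₜ[K] (antipode K (d.b j) * mc K H p r) =
      ∑ r, ∑ j, (mc K H p r * d.a j) ⊗ₜ[K] (mc K H r q * antipode K (d.b j)) := by
  have h := d.intertwine (mc K H p q)
  have h' : (∑ i, d.a i ⊗ₜ[K] antipode K (d.b i)) *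
      TensorProduct.comm K H H (comul (R := K) (mc K H p q)) =
      comul (R := K) (mc K H p q) * ∑ i, d.a i ⊗ₜ[K] antipode K (d.b i) := by
    rw [← mul_one (_ * TensorProduct.comm K H H _), ← d.mul_inv 𝓱, mul_assoc, ← mul_assoc _ _ (∑ i, _),
      ← h, ← mul_assoc, ← mul_assoc, d.inv_mul 𝓱, one_mul]
  simp only [comul_mc, map_sum, TensorProduct.comm_tmul, Finset.sum_mul_sum,
    Algebra.TensorProduct.tmul_mul_tmul] at h'
  rw [← h', Finset.sum_comm]

theorem sum_smul_ad {f : H →ₗ[K] K} (hf : ∀ x y, f (x * y) = f (y * x)) (p q) :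
    ∑ r, ∑ j, f (mc K H p r * antipode K (d.b j)) • ad (K := K) (d.a j) (mc K H r q) =
      hitL f (mc K H p q) := by
  have h1 : ∀ r, ∑ j, f (mc K H p r * antipode K (d.b j)) • ad (K := K) (d.a j) (mc K H r q) =
      ∑ k, ∑ j, f (antipode K (d.b j) * mc K H p r * antipode K (d.b k)) •
        (d.a j * mc K H r q * antipode K (d.a k)) := by
    intro r
    have := congr_arg (fun t => mul' K H (TensorProduct.map (mulRight K (mc K H r q)) (antipode K)
      (sliceR (f ∘ₗ mulLeft K (mc K H p r) ∘ₗ antipode K) t))) d.comul_a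
    simp only [map_sum, sliceR_tmul, map_smul, ← ad_eq, TensorProduct.map_tmul, mul'_apply,
      mulRight_apply, LinearMap.comp_apply, mulLeft_apply, antipode_mul_antidistrib] at this
    rw [this, Finset.sum_comm]
    refine Finset.sum_congr rfl fun k _ => Finset.sum_congr rfl fun j _ => ?_
    rw [← mul_assoc, hf, ← mul_assoc]
  have h2 : ∀ k, ∑ r, ∑ j, f (antipode K (d.b j) * mc K H p r * antipode K (d.b k)) •
        (d.a j * mc K H r q * antipode K (d.a k)) =
      ∑ r, ∑ j, f (mc K H r q * antipode K (d.b j) * antipode K (d.b k)) •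
        (mc K H p r * d.a j * antipode K (d.a k)) := by
    intro k
    have := congr_arg (fun t => sliceR (f ∘ₗ mulRight K (antipode K (d.b k))) t *
      antipode K (d.a k)) (d.inv_intertwine 𝓱 p q)
    simpa only [map_sum, sliceR_tmul, Finset.sum_mul, smul_mul_assoc, LinearMap.comp_apply,
      mulRight_apply] using this
  have h3 : ∀ r, ∑ j, ∑ k, f (mc K H r q * antipode K (d.b j) * antipode K (d.b k)) •
        (mc K H p r * d.a j * antipode K (d.a k)) = f (mc K H r q) • mc K H p r := by
    intro r
    have := congr_arg (fun t => mc K H p r * sliceR (f ∘ₗ mulLeft K (mc K H r q)) t)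
      (d.sum_mul_antipode 𝓱)
    simpa only [map_sum, sliceR_tmul, Finset.mul_sum, mul_smul_comm, LinearMap.comp_apply,
      mulLeft_apply, Algebra.TensorProduct.one_def, mul_one, ← mul_assoc] using this
  simp only [h1]
  rw [Finset.sum_comm]
  simp only [h2, hitL_mc]
  rw [Finset.sum_comm]
  refine Finset.sum_congr rfl fun r _ => ?_
  rw [Finset.sum_comm, h3]

end RData

section Invariant

variable {f : H →ₗ[K] K} (𝓱 : HaarData K H)

include 𝓱 in
theorem apply_mul_comm_of_ad_invariant (hf : ∀ h x, f (ad (K := K) h x) = counit (R := K) h * f x)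
    (x y : H) : f (x * y) = f (y * x) := by
  have : f ∘ₗ mulRight K y = f ∘ₗ mulLeft K y := by
    refine ext_mc fun i j => ?_
    have h1 : ∑ k, f (ad (K := K) (mc K H i k) (y * mc K H k j)) = f (y * mc K H i j) := by
      simp [hf, counit_mc]
    have h2 : ∑ k, ad (K := K) (mc K H i k) (y * mc K H k j) = mc K H i j * y := by
      simp only [ad_mc, ← mul_assoc]
      rw [Finset.sum_comm]
      simp only [mul_assoc, ← Finset.mul_sum, 𝓱.sum_mc_mul_antipode']
      simp
    simp only [LinearMap.comp_apply, mulRight_apply, mulLeft_apply]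
    rw [← h1, ← map_sum, h2]
  exact LinearMap.congr_fun this x

theorem hitL_ad (hf : ∀ h x, f (ad (K := K) h x) = counit (R := K) h * f x) (h x : H) :
    hitL f (ad (K := K) h x) = ad (K := K) h (hitL f x) := by
  have : hitL f ∘ₗ (ad (K := K)).flip x = (ad (K := K)).flip (hitL f x) := by
    refine ext_mc fun i j => ?_
    simp only [LinearMap.comp_apply, flip_apply, ad_mc, map_sum, hitL_apply, Bialgebra.comul_mul,
      comul_antipode_mc, comul_mc]
    induction comul (R := K) x with
    | zero => simp
    | add s t hs ht => simp only [add_mul, mul_add, map_add, Finset.sum_add_distrib, hs, ht]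
    | tmul u v =>
      simp only [Finset.sum_mul, Finset.mul_sum,
        Algebra.TensorProduct.tmul_mul_tmul, map_sum, sliceR_tmul]
      have h1 : ∀ p l, ∑ k, f (mc K H p k * v * antipode K (mc K H k l)) =
          if p = l then f v else 0 := by
        intro p l
        rw [← map_sum, ← ad_mc, hf, counit_mc]
        simp
      rw [Finset.sum_congr rfl fun k _ => Finset.sum_comm, Finset.sum_comm]
      refine Finset.sum_congr rfl fun p _ => ?_
      rw [Finset.sum_comm]
      simp only [← Finset.sum_smul, h1]
      simp
  exact LinearMap.congr_fun this h

theorem lTensor_hitL_deltaR {R : H ⊗[K] H} (d : RData R)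
    (hf : ∀ h x, f (ad (K := K) h x) = counit (R := K) h * f x) (x : H) :
    lTensor H (hitL f) (deltaR K H R x) = deltaR K H R (hitL f x) := by
  have : lTensor H (hitL f) ∘ₗ deltaR K H R = deltaR K H R ∘ₗ hitL f := by
    refine ext_mc fun p q => ?_
    simp only [LinearMap.comp_apply, deltaR_mc d, map_sum, lTensor_tmul, hitL_ad hf]
    simp only [hitL_mc, map_sum, map_smul, deltaR_mc d, tmul_sum, tmul_smul, Finset.smul_sum]
    rw [Finset.sum_congr rfl fun i _ => Finset.sum_comm, Finset.sum_comm]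
  exact LinearMap.congr_fun this x

include 𝓱 in
theorem rTensor_hitL_deltaR {R : H ⊗[K] H} (d : RData R)
    (hf : ∀ h x, f (ad (K := K) h x) = counit (R := K) h * f x) (x : H) :
    rTensor H (hitL f) (deltaR K H R x) = deltaR K H R (hitL f x) := by
  rw [← lTensor_hitL_deltaR d hf]
  have hc := apply_mul_comm_of_ad_invariant 𝓱 hf
  have : rTensor H (hitL f) ∘ₗ deltaR K H R = lTensor H (hitL f) ∘ₗ deltaR K H R := by
    refine ext_mc fun p q => ?_
    simp only [LinearMap.comp_apply, deltaR_mc d, map_sum, lTensor_tmul, rTensor_tmul, hitL_ad hf]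
    have h1 : ∀ k, ∑ i, hitL f (mc K H p k * antipode K (d.b i)) ⊗ₜ[K] ad (K := K) (d.a i) (mc K H k q) =
        ∑ r, ∑ i, (mc K H p r * antipode K (d.b i)) ⊗ₜ[K] ad (K := K) (d.a i)
          (∑ j, f (mc K H r k * antipode K (d.b j)) • ad (K := K) (d.a j) (mc K H k q)) := by
      intro k
      have h2 : ∀ b : H, hitL f (mc K H p k * antipode K b) = ∑ r, mc K H p r * antipode K
          (sliceL (f ∘ₗ mulLeft K (mc K H r k) ∘ₗ antipode K) (comul (R := K) b)) := by
        intro b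
        rw [hitL_apply, Bialgebra.comul_mul, comul_antipode, comul_mc, Finset.sum_mul, map_sum]
        refine Finset.sum_congr rfl fun r _ => ?_
        induction comul (R := K) b with
        | zero => simp
        | add s t hs ht => simp only [map_add, mul_add, hs, ht]
        | tmul u v => simp
      simp only [h2, sum_tmul, map_sum, tmul_sum]
      rw [Finset.sum_comm]
      refine Finset.sum_congr rfl fun r _ => ?_
      have := congr_arg (fun t => TensorProduct.comm K H H
        (TensorProduct.map ((ad (K := K)).flip (mc K H k q)) (mulLeft K (mc K H p r) ∘ₗ antipode K ∘ₗ
          sliceL (f ∘ₗ mulLeft K (mc K H r k) ∘ₗ antipode K)) t)) d.comul_b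
      simp only [map_sum, TensorProduct.map_tmul, TensorProduct.comm_tmul, LinearMap.comp_apply,
        sliceL_tmul, mulLeft_apply, flip_apply, ad_mul, map_smul] at this ⊢
      rw [this]
      simp only [smul_tmul]
    rw [Finset.sum_comm]
    simp only [h1]
    rw [Finset.sum_comm, Finset.sum_comm (γ := Fin _) (f := fun i r => (mc K H p r * _) ⊗ₜ[K] _)]
    refine Finset.sum_congr rfl fun r _ => ?_
    rw [Finset.sum_comm]
    refine Finset.sum_congr rfl fun i _ => ?_
    rw [← d.sum_smul_ad 𝓱 hc, map_sum, tmul_sum]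
  exact LinearMap.congr_fun this x

theorem hitL_eq_sliceR_deltaR {R : H ⊗[K] H} (d : RData R)
    (hf : ∀ h x, f (ad (K := K) h x) = counit (R := K) h * f x) (x : H) :
    hitL f x = sliceR f (deltaR K H R x) := by
  rw [deltaR_eq d, map_sum, hitL_apply]
  induction comul (R := K) x with
  | zero => simp
  | add s t hs ht => simp only [map_add, Finset.sum_add_distrib, hs, ht]
  | tmul u v =>
    simp only [TensorProduct.map_tmul, sliceR_tmul, hf, mulRight_apply]
    have := congr_arg (fun t => f v • (u * antipode K t)) d.counit_a
    simp only [map_sum, map_smul, Finset.mul_sum, mul_smul_comm, Finset.smul_sum, smul_smul,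
      antipode_one, mul_one] at this
    rw [← this]
    simp [mul_comm]

end Invariant

section Slices

variable {A B : Type*} [AddCommGroup A] [Module K A] [AddCommGroup B] [Module K B]

theorem sliceR_mem {X : Submodule K A} {Y : Submodule K B} {t : A ⊗[K] B}
    (ht : t ∈ Submodule.map₂ (TensorProduct.mk K A B) X Y) (g : B →ₗ[K] K) : sliceR g t ∈ X := by
  have : Submodule.map₂ (TensorProduct.mk K A B) X Y ≤ X.comap (sliceR g) := by
    rw [Submodule.map₂_le]
    intro x hx y _
    simpa using X.smul_mem _ hx
  exact this ht

theorem sliceL_mem {X : Submodule K A} {Y : Submodule K B} {t : A ⊗[K] B}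
    (ht : t ∈ Submodule.map₂ (TensorProduct.mk K A B) X Y) (g : A →ₗ[K] K) : sliceL g t ∈ Y := by
  have : Submodule.map₂ (TensorProduct.mk K A B) X Y ≤ Y.comap (sliceL g) := by
    rw [Submodule.map₂_le]
    intro x _ y hy
    simpa using Y.smul_mem _ hy
  exact this ht

theorem exists_projection (X : Submodule K A) :
    ∃ p : A →ₗ[K] A, (∀ x, p x ∈ X) ∧ ∀ x ∈ X, p x = x := by
  obtain ⟨p, hp⟩ := X.subtype.exists_leftInverse_of_injective X.ker_subtype
  exact ⟨X.subtype ∘ₗ p, fun x => (p x).2,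
    fun x hx => congr_arg Subtype.val (LinearMap.congr_fun hp ⟨x, hx⟩)⟩

end Slices

theorem eq_of_sliceL_eq {V : Type*} [AddCommGroup V] [Module K V] {s t : H ⊗[K] V}
    (h : ∀ g : H →ₗ[K] K, sliceL g s = sliceL g t) : s = t := by
  rw [eq_sum_finBasis_tmul s, eq_sum_finBasis_tmul t]
  simp only [h]

theorem eq_of_sliceR_eq {s t : H ⊗[K] H} (h : ∀ g : H →ₗ[K] K, sliceR g s = sliceR g t) : s = t := by
  apply (TensorProduct.comm K H H).injective
  rw [eq_sum_finBasis_tmul (TensorProduct.comm K H H s),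
    eq_sum_finBasis_tmul (TensorProduct.comm K H H t)]
  have (g : H →ₗ[K] K) (u : H ⊗[K] H) : sliceL g (TensorProduct.comm K H H u) = sliceR g u := by
    induction u with
    | zero => simp
    | tmul x y => simp
    | add x y hx hy => simp only [map_add, hx, hy]
  simp only [this, h]

theorem map_mem_map₂ {X Y : Submodule K H} {p q : H →ₗ[K] H} (hp : ∀ x, p x ∈ X)
    (hq : ∀ x, q x ∈ Y) (t : H ⊗[K] H) :
    TensorProduct.map p q t ∈ Submodule.map₂ (TensorProduct.mk K H H) X Y := by
  induction t with
  | zero => rw [map_zero]; exact Submodule.zero_mem _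
  | add x y hx hy => rw [map_add]; exact Submodule.add_mem _ hx hy
  | tmul x y => exact Submodule.apply_mem_map₂ (TensorProduct.mk K H H) (hp x) (hq y)

theorem mem_map₂_of_slices {X Y : Submodule K H} {t : H ⊗[K] H}
    (hX : ∀ g : H →ₗ[K] K, sliceR g t ∈ X) (hY : ∀ g : H →ₗ[K] K, sliceL g t ∈ Y) :
    t ∈ Submodule.map₂ (TensorProduct.mk K H H) X Y := by
  obtain ⟨p, hpX, hp⟩ := exists_projection (K := K) X
  obtain ⟨q, hqY, hq⟩ := exists_projection (K := K) Y
  have h1 : rTensor H p t = t :=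
    eq_of_sliceR_eq (K := K) fun g => by rw [← map_sliceR, hp _ (hX g)]
  have h2 : lTensor H q t = t :=
    eq_of_sliceL_eq (K := K) fun g => by rw [← map_sliceL, hq _ (hY g)]
  have h3 : TensorProduct.map p q t = t := by
    rw [← lTensor_comp_rTensor, LinearMap.comp_apply, h1, h2]
  rw [← h3]
  exact map_mem_map₂ hpX hqY t

theorem eq_zero_of_ad_invariant [IsAlgClosed K] (𝓱 : HaarData K H) {R : H ⊗[K] H} (d : RData R)
    {D : Submodule K H} (hD : IsMinimalAdjointStableSubcoalgebra K H R D) {z : H} (hz : z ∈ D)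
    (hinv : ∀ h, ad (K := K) h z = counit (R := K) h • z) (hε : counit (R := K) z = 0) : z = 0 := by
  by_contra hz0
  obtain ⟨f₀, hf₀⟩ : ∃ f₀ : H →ₗ[K] K, f₀ z ≠ 0 := by
    by_contra! h
    exact hz0 ((Module.forall_dual_apply_eq_zero_iff K z).1 h)
  set f : H →ₗ[K] K := f₀ ∘ₗ ad (K := K) 𝓱.Λ with hfdef
  have hf : ∀ h x, f (ad (K := K) h x) = counit (R := K) h * f x := by
    intro h x
    simp [hfdef, ← ad_mul, 𝓱.Λ_mul]
  have hfz : f z ≠ 0 := by simpa [hfdef, hinv, 𝓱.counit_Λ] using hf₀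
  obtain ⟨hbot, ⟨hstab, hco⟩, hmin⟩ := hD
  have hFD : ∀ x ∈ D, hitL f x ∈ D := fun x hx => by
    rw [hitL_eq_sliceR_deltaR d hf]
    exact sliceR_mem (hco x hx) f
  have : Nontrivial D := Submodule.nontrivial_iff_ne_bot.2 hbot
  obtain ⟨μ, hμ⟩ := Module.End.exists_eigenvalue ((hitL f).restrict hFD)
  obtain ⟨v, hv⟩ := hμ.exists_hasEigenvector
  set G : H →ₗ[K] H := hitL f - μ • LinearMap.id with hG
  have hGd : ∀ x, G x = hitL f x - μ • x := fun x => rfl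
  have hD' := hmin (D ⊓ ker G) inf_le_left ⟨fun h a ha => ⟨hstab h a ha.1, ?_⟩, fun a ha => ?_⟩
  · rcases hD' with h | h
    · have hvm : (v : H) ∈ D ⊓ ker G := by
        refine ⟨v.2, ?_⟩
        change G v = 0
        rw [hGd, sub_eq_zero]
        exact congr_arg Subtype.val hv.apply_eq_smul
      rw [h, Submodule.mem_bot] at hvm
      exact hv.2 (Subtype.ext hvm)
    · rw [← h] at hz
      have h1 : hitL f z = μ • z := sub_eq_zero.1 hz.2
      have h2 := congr_arg (counit (R := K)) h1
      rw [map_smul, hε, smul_zero, ← apply_hitR, hitR_counit] at h2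
      exact hfz h2
  · have h1 : hitL f a = μ • a := sub_eq_zero.1 ha.2
    change G _ = 0
    rw [hGd, ← ad_apply, hitL_ad hf, h1, map_smul, sub_self]
  · have h1 : hitL f a = μ • a := sub_eq_zero.1 ha.2
    have hr : rTensor H G (deltaR K H R a) = 0 := by
      rw [hG, LinearMap.rTensor_sub, LinearMap.rTensor_smul, LinearMap.rTensor_id,
        LinearMap.sub_apply, rTensor_hitL_deltaR 𝓱 d hf, h1]
      simp
    have hl : lTensor H G (deltaR K H R a) = 0 := by
      rw [hG, LinearMap.lTensor_sub, LinearMap.lTensor_smul, LinearMap.lTensor_id,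
        LinearMap.sub_apply, lTensor_hitL_deltaR d hf, h1]
      simp
    refine mem_map₂_of_slices (fun g => ⟨sliceR_mem (hco a ha.1) g, ?_⟩)
      fun g => ⟨sliceL_mem (hco a ha.1) g, ?_⟩
    · change G _ = 0
      rw [map_sliceR, hr, map_zero]
    · change G _ = 0
      rw [map_sliceL, hl, map_zero]

end

section

variable {K H}
variable [FiniteDimensional K H]

section

variable {R : H ⊗[K] H} {V : Type} [AddCommGroup V] [Module K V] (s : RModStr K H R V)

theorem apply_chi_trace (𝓱 : HaarData K H) (d : RData R)
    (hfree : ∀ g h, trace K V (coeff s g * s.act h) = 𝓱.lam h * trace K V (coeff s g)) (h : H) :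
    (toDRep d s).chi (trace K V) h = ∑ i, 𝓱.lam (h * d.a i) • (charElt s 1 * d.b i) := by
  refine eq_of_dual_eq (K := K) fun f => ?_
  rw [DRep.apply_chi]
  change trace K V (drepP d s f * s.act h) = _
  rw [drepP_apply, Finset.sum_mul, map_sum, map_sum]
  refine Finset.sum_congr rfl fun i _ => ?_
  have : f (charElt s 1 * d.b i) = (f ∘ₗ mulRight K (d.b i)) (charElt s 1) := rfl
  rw [map_smul, this, apply_charElt, mul_one, smul_eq_mul, ← hfree, LinearMap.trace_mul_comm,
    ← mul_assoc, ← map_mul s.act, LinearMap.trace_mul_comm]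

variable [FiniteDimensional K V]

theorem finrank_map_mulLeft_endHD (𝓱 : HaarData K H) (d : RData R)
    (hfree : ∀ g h, trace K V (coeff s g * s.act h) = 𝓱.lam h * trace K V (coeff s g))
    {e : Module.End K V} (he : e * e = e) (heS : e ∈ endHD K H R s) :
    (Module.finrank K H : K) *
      (Module.finrank K ((Subalgebra.toSubmodule (endHD K H R s)).map (mulLeft K e)) : K) =
      𝓱.lam (charElt s e * antipode K (charElt s 1)) := by
  rw [DRep.finrank_commutant 𝓱 (toDRep d s)
    (fun φ => (mem_endHD_iff_drepP s d φ)) he heS]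
  set X := toDRep d s with hX
  set θ := X.chi (trace K V ∘ₗ mulLeft K e)
  have h1 : (Module.finrank K H : K) •
      star θ (antipode K ∘ₗ X.chi (trace K V) ∘ₗ antipode K) 𝓱.Λ =
      ∑ i, θ (d.a i) * antipode K (charElt s 1 * d.b i) := by
    have h2 : star θ (antipode K ∘ₗ X.chi (trace K V) ∘ₗ antipode K) 𝓱.Λ =
        ∑ i, θ (sliceR (𝓱.lam ∘ₗ mulRight K (d.a i) ∘ₗ antipode K) (comul (R := K) 𝓱.Λ)) *
          antipode K (charElt s 1 * d.b i) := by
      rw [star, LinearMap.comp_apply, LinearMap.comp_apply]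
      induction comul (R := K) 𝓱.Λ with
      | zero => simp
      | add s t hs ht => simp only [map_add, add_mul, Finset.sum_add_distrib, hs, ht]
      | tmul u v =>
        simp only [TensorProduct.map_tmul, LinearMap.comp_apply, hX, apply_chi_trace s 𝓱 d hfree,
          mul'_apply, map_sum, map_smul, sliceR_tmul, Finset.mul_sum, mul_smul_comm, smul_mul_assoc,
          mulRight_apply]
    rw [h2, Finset.smul_sum]
    refine Finset.sum_congr rfl fun i _ => ?_
    rw [← smul_mul_assoc, ← map_smul, 𝓱.lam_slice_eq]
  rw [← smul_eq_mul, ← map_smul, h1, map_sum]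
  have h3 : 𝓱.lam (charElt s e * antipode K (charElt s 1)) =
    (𝓱.lam ∘ₗ mulRight K (antipode K (charElt s 1))) (charElt s e) := rfl
  rw [h3, apply_charElt, coeff_eq_sum_drepP s d, Finset.sum_mul, map_sum]
  refine Finset.sum_congr rfl fun i _ => ?_
  have h4 : 𝓱.lam (θ (d.a i) * antipode K (charElt s 1 * d.b i)) =
      ((𝓱.lam ∘ₗ mulRight K (antipode K (charElt s 1))) ∘ₗ mulRight K (antipode K (d.b i)))
        (θ (d.a i)) := by
    simp [antipode_mul_antidistrib, mul_assoc]
  rw [h4, DRep.apply_chi]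
  change trace K V (e * (drepP d s _ * s.act (d.a i))) = _
  rw [← mul_assoc, LinearMap.trace_mul_comm, ← mul_assoc, ((mem_endHD_iff s e).1 heS).1,
    mul_assoc, LinearMap.trace_mul_comm]

theorem finrank_mul_trace [IsAlgClosed K] [CharZero K] [Nontrivial H] [Nontrivial V]
    (𝓱 : HaarData K H) (d : RData R)
    {D : Submodule K H} (hD : IsMinimalAdjointStableSubcoalgebra K H R D)
    (hm : ∀ v, s.coact v ∈ Submodule.map₂ (TensorProduct.mk K H V) D ⊤)
    (hfree : ∀ g h, trace K V (coeff s g * s.act h) = 𝓱.lam h * trace K V (coeff s g))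
    {e : Module.End K V} (he : e * e = e) (heS : e ∈ endHD K H R s) :
    (Module.finrank K V : K) *
      (Module.finrank K ((Subalgebra.toSubmodule (endHD K H R s)).map (mulLeft K e)) : K) =
      trace K V e * (Module.finrank K (endHD K H R s) : K) := by
  have hn : (Module.finrank K H : K) ≠ 0 := Nat.cast_ne_zero.2 Module.finrank_pos.ne'
  have h1 := finrank_map_mulLeft_endHD s 𝓱 d hfree he heS
  have h2 := finrank_map_mulLeft_endHD s 𝓱 d hfree (one_mul 1) (one_mem _)
  have h3 : (Subalgebra.toSubmodule (endHD K H R s)).map (mulLeft K 1) =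
      Subalgebra.toSubmodule (endHD K H R s) := by
    rw [mulLeft_one, Submodule.map_id]
  rw [h3] at h2
  have hz : (Module.finrank K V : K) • charElt s e - trace K V e • charElt s 1 = 0 := by
    refine eq_zero_of_ad_invariant 𝓱 d hD (D.sub_mem (D.smul_mem _ (charElt_mem s hm e))
      (D.smul_mem _ (charElt_mem s hm 1))) (fun h => ?_) ?_
    · simp only [map_sub, map_smul, ad_charElt s 𝓱 heS, ad_charElt s 𝓱 (one_mem (endHD K H R s)),
        smul_sub, smul_comm (counit (R := K) h)]
    · simp [counit_charElt, mul_comm]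
  refine mul_left_cancel₀ hn ?_
  rw [mul_left_comm, h1, mul_left_comm]
  change _ = trace K V e * (_ * (Module.finrank K (Subalgebra.toSubmodule (endHD K H R s)) : K))
  rw [h2, ← smul_eq_mul, ← smul_eq_mul (a := trace K V e), ← map_smul, ← map_smul, ← smul_mul_assoc,
    ← smul_mul_assoc, sub_eq_zero.1 hz]

end

end

section

variable {K H}
variable [FiniteDimensional K H]

section

variable {R : H ⊗[K] H} {D : Submodule K H} {W : Type} [AddCommGroup W] [Module K W]
  (sW : DComodStr K H R D W)

theorem rhoHW_tmul_eq_sum (i j) (w : W) : rhoHW K H R sW (mc K H i j ⊗ₜ w) =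
    ∑ k, TensorProduct.map (ad (K := K) (mc K H i k)) (TensorProduct.mk K H W (mc K H k j))
      (sW.coact w) := by
  rw [rhoHW, LinearMap.comp_apply, LinearMap.comp_apply, TensorProduct.map_tmul, comul_mc, sum_tmul]
  simp only [map_sum]
  refine Finset.sum_congr rfl fun k _ => ?_
  induction sW.coact w with
  | zero => simp
  | add s t hs ht => simp only [map_add, tmul_add, hs, ht]
  | tmul u v => simp [ad_apply, adAct]

theorem rhoHW_mem (hD : ∀ (h : H), ∀ a ∈ D, adAct K H h a ∈ D) (v : H ⊗[K] W) :
    rhoHW K H R sW v ∈ Submodule.map₂ (TensorProduct.mk K H (H ⊗[K] W)) D ⊤ := by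
  have key : ∀ i j w, rhoHW K H R sW (mc K H i j ⊗ₜ w) ∈
      Submodule.map₂ (TensorProduct.mk K H (H ⊗[K] W)) D ⊤ := by
    intro i j w
    rw [rhoHW_tmul_eq_sum]
    refine Submodule.sum_mem _ fun k _ => ?_
    have : Submodule.map₂ (TensorProduct.mk K H W) D ⊤ ≤
        (Submodule.map₂ (TensorProduct.mk K H (H ⊗[K] W)) D ⊤).comap
          (TensorProduct.map (ad (K := K) (mc K H i k)) (TensorProduct.mk K H W (mc K H k j))) := by
      rw [Submodule.map₂_le]
      intro x hx y _
      exact Submodule.apply_mem_map₂ (TensorProduct.mk K H (H ⊗[K] W)) (hD _ x hx) Submodule.mem_top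
    exact this (sW.mem w)
  induction v with
  | zero => rw [map_zero]; exact Submodule.zero_mem _
  | add x y hx hy => rw [map_add]; exact Submodule.add_mem _ hx hy
  | tmul h w =>
    obtain ⟨c, hc⟩ : ∃ c : Fin _ → K, h = ∑ i, ∑ j, (c i * counit (R := K) (𝐛 j)) • mc K H i j := by
      refine ⟨(𝐛).repr h, ?_⟩
      conv_lhs => rw [← (𝐛).sum_repr h]
      refine Finset.sum_congr rfl fun i _ => ?_
      conv_lhs => rw [finBasis_eq_sum_mc]
      simp [Finset.smul_sum, smul_smul]
    rw [hc]
    simp only [sum_tmul, map_sum, ← smul_tmul', map_smul]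
    exact Submodule.sum_mem _ fun i _ => Submodule.sum_mem _ fun j _ =>
      Submodule.smul_mem _ _ (key i j w)

variable [FiniteDimensional K W]

theorem coeff_rhoHW (s : RModStr K H R (H ⊗[K] W)) (hs : s.coact = rhoHW K H R sW) (g : H →ₗ[K] K) :
    coeff s g = ∑ m, TensorProduct.map (hitR (g ∘ₗ (ad (K := K)).flip (𝐛 m)))
      (sliceL ((𝐛).coord m) ∘ₗ sW.coact) := by
  refine TensorProduct.ext (?_ : (TensorProduct.mk K H W).compr₂ _ = (TensorProduct.mk K H W).compr₂ _)
  refine ext_mc (K := K) (V := W →ₗ[K] H ⊗[K] W) fun i j => ?_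
  ext w
  simp only [compr₂_apply, mk_apply, LinearMap.id_coe, id_eq, coeff_apply, LinearMap.sum_apply, TensorProduct.map_tmul, hs,
    rhoHW_tmul_eq_sum, map_sum, hitR_mc, sum_tmul, LinearMap.comp_apply, flip_apply]
  rw [Finset.sum_comm]
  refine Finset.sum_congr rfl fun k _ => ?_
  conv_lhs => rw [eq_sum_finBasis_tmul (sW.coact w)]
  simp [sliceL_tmul, smul_tmul']

theorem trace_coeff_mul_act (𝓱 : HaarData K H) (s : RModStr K H R (H ⊗[K] W))
    (hact : ∀ h : H, (s.act h : H ⊗[K] W →ₗ[K] H ⊗[K] W) = rTensor W (mulLeft K h))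
    (hs : s.coact = rhoHW K H R sW) (g : H →ₗ[K] K) (h : H) :
    trace K (H ⊗[K] W) (coeff s g * s.act h) = 𝓱.lam h * trace K (H ⊗[K] W) (coeff s g) := by
  have key : ∀ h, trace K (H ⊗[K] W) (coeff s g * s.act h) = ∑ m, Module.finrank K H * 𝓱.lam h *
      g (ad (K := K) 𝓱.Λ (𝐛 m)) * trace K W (sliceL ((𝐛).coord m) ∘ₗ sW.coact) := by
    intro h
    rw [coeff_rhoHW sW s hs, Finset.sum_mul, map_sum]
    refine Finset.sum_congr rfl fun m _ => ?_
    rw [hact, LinearMap.rTensor]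
    change trace K _ (TensorProduct.map _ _ ∘ₗ TensorProduct.map _ _) = _
    rw [← TensorProduct.map_comp, LinearMap.comp_id, LinearMap.trace_tensorProduct',
      𝓱.trace_hitR_comp_mulLeft]
    rfl
  have h1 := key 1
  rw [map_one, mul_one] at h1
  rw [h1, key, Finset.mul_sum, 𝓱.lam_one]
  exact Finset.sum_congr rfl fun m _ => by ring

end

end

section

variable {K H}
variable [FiniteDimensional K H]

section

omit [FiniteDimensional K H]

theorem isSemisimpleRing_commutant {B V : Type} [Ring B] [Algebra K B] [IsSemisimpleRing B]
    [AddCommGroup V] [Module K V] [FiniteDimensional K V] (Φ : B →ₐ[K] Module.End K V)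
    (S : Subalgebra K (Module.End K V)) (hS : ∀ φ, φ ∈ S ↔ ∀ b, Φ b * φ = φ * Φ b) :
    IsSemisimpleRing S := by
  let _ : Module B V := Module.compHom V Φ.toRingHom
  have hsmul : ∀ (b : B) (v : V), b • v = Φ b v := fun _ _ => rfl
  have : IsScalarTower K B V := ⟨fun c b v => by rw [hsmul, map_smul]; rfl⟩
  have : Module.Finite B V := Module.Finite.of_restrictScalars_finite K B V
  have := IsSemisimpleRing.moduleEnd B V
  let F : Module.End B V ≃+* S :=
    { toFun := fun f => ⟨f.restrictScalars K, (hS _).2 fun b => LinearMap.ext fun v =>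
        (f.map_smul b v).symm⟩
      invFun := fun f =>
        { toFun := f.1
          map_add' := f.1.map_add
          map_smul' := fun b v => (LinearMap.congr_fun ((hS _).1 f.2 b) v).symm }
      left_inv := fun f => rfl
      right_inv := fun f => rfl
      map_mul' := fun f g => rfl
      map_add' := fun f g => rfl }
  exact F.isSemisimpleRing

theorem single_mul_eq_zero_or {r : ℕ} {d : Fin r → ℕ} (i : Fin r) (p : Fin (d i)) (x : MatProd K d)
    (hx : (Pi.single i (Matrix.single p p 1) : MatProd K d) * x ≠ 0) :
    ∃ y : MatProd K d, (Pi.single i (Matrix.single p p 1) : MatProd K d) * x * y =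
      Pi.single i (Matrix.single p p 1) := by
  obtain ⟨q, hq⟩ : ∃ q, x i p q ≠ 0 := by
    by_contra! h
    refine hx (funext fun j => ?_)
    by_cases hj : j = i
    · subst hj
      ext a b
      by_cases ha : p = a
      · subst ha; simp [h]
      · simp [Matrix.mul_apply, ha]
    · simp [hj]
  refine ⟨Pi.single i (Matrix.single q p (x i p q)⁻¹), funext fun j => ?_⟩
  by_cases hj : j = i
  · subst hj
    simp [hq]
  · simp [hj]

theorem single_mul_mul_single {r : ℕ} {d : Fin r → ℕ} (i : Fin r) (p : Fin (d i))
    (x : MatProd K d) : (Pi.single i (Matrix.single p p 1) : MatProd K d) * x *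
      Pi.single i (Matrix.single p p 1) = x i p p • Pi.single i (Matrix.single p p 1) := by
  refine funext fun j => ?_
  by_cases hj : j = i
  · subst hj
    simp
  · simp [hj]

theorem sum_single_single {r : ℕ} (d : Fin r → ℕ) :
    ∑ i, ∑ p, (Pi.single i (Matrix.single p p 1) : MatProd K d) = 1 := by
  refine funext fun j => ?_
  rw [Finset.sum_apply, Finset.sum_eq_single j]
  · ext a b
    simp only [Finset.sum_apply, Pi.single_eq_same, Matrix.sum_apply, Matrix.single_apply,
      Pi.one_apply, Matrix.one_apply]
    rw [Finset.sum_eq_single a (fun p _ hp => if_neg fun h => hp h.1) (by simp)]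
    simp
  · intro i _ hi
    simp [Finset.sum_apply, hi.symm]
  · simp

theorem exists_idempotent_of_irreducible [IsAlgClosed K] {N U : Type} [Ring N] [Algebra K N]
    [IsSemisimpleRing N] [FiniteDimensional K N] [AddCommGroup U] [Module K U]
    (τ : Nᵐᵒᵖ →ₐ[K] Module.End K U) (hU : Nontrivial U) (hirr : ∀ Y : Submodule K U,
      (∀ a : N, ∀ u ∈ Y, τ (MulOpposite.op a) u ∈ Y) → Y = ⊥ ∨ Y = ⊤) :
    ∃ e : N, e * e = e ∧ e ≠ 0 ∧ (∀ x, ∃ c : K, e * x * e = c • e) ∧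
      Module.finrank K U = Module.finrank K (LinearMap.range (mulLeft K e)) := by
  obtain ⟨r, d, hd, ⟨E⟩⟩ := IsSemisimpleRing.exists_algEquiv_pi_matrix_of_isAlgClosed K N
  obtain ⟨u, hu⟩ := exists_ne (0 : U)
  obtain ⟨i, p, hip⟩ : ∃ i p, τ (MulOpposite.op (E.symm (Pi.single i (Matrix.single p p 1)))) u ≠ 0 := by
    by_contra! h
    have h1 := congr_arg (fun x => τ (MulOpposite.op (E.symm x)) u) (sum_single_single (K := K) d)
    simp only [map_sum, Finset.op_sum, LinearMap.sum_apply, h, map_one, MulOpposite.op_one] at h1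
    simp at h1
    exact hu h1.symm
  set m : MatProd K d := Pi.single i (Matrix.single p p 1) with hm
  set e := E.symm m with he
  have hmm : m * m = m := by
    simpa using single_mul_mul_single (K := K) i p (1 : MatProd K d)
  have hee : e * e = e := by rw [he, ← map_mul, hmm]
  set v := τ (MulOpposite.op e) u with hv
  have hve : τ (MulOpposite.op e) v = v := by
    rw [hv, ← Module.End.mul_apply, ← map_mul, ← MulOpposite.op_mul, hee]
  have hdiv : ∀ x, e * x ≠ 0 → ∃ y, e * x * y = e := by
    intro x hx
    obtain ⟨y, hy⟩ := single_mul_eq_zero_or i p (E x) fun h => hx (by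
      apply E.injective
      rw [map_mul, he, E.apply_symm_apply, h, map_zero])
    refine ⟨E.symm y, E.injective ?_⟩
    rw [map_mul, map_mul, he, E.apply_symm_apply, E.apply_symm_apply, hy]
  refine ⟨e, hee, fun h => hip (by rw [hv, h]; simp), fun x => ⟨E x i p p, E.injective ?_⟩, ?_⟩
  · rw [map_mul, map_mul, map_smul, he, E.apply_symm_apply, single_mul_mul_single]
  let F : N →ₗ[K] U :=
    LinearMap.applyₗ v ∘ₗ τ.toLinearMap ∘ₗ (MulOpposite.opLinearEquiv K).toLinearMap
  have hF : ∀ x, F x = τ (MulOpposite.op x) v := fun _ => rfl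
  have hFmul : ∀ x y, F (x * y) = τ (MulOpposite.op y) (F x) := by
    intro x y
    rw [hF, hF, MulOpposite.op_mul, map_mul, Module.End.mul_apply]
  let G := F ∘ₗ (LinearMap.range (mulLeft K e)).subtype
  have hinj : Function.Injective G := by
    rw [← LinearMap.ker_eq_bot, LinearMap.ker_eq_bot']
    rintro ⟨_, x, rfl⟩ hx
    by_contra h0
    obtain ⟨y, hy⟩ := hdiv x fun h => h0 (Subtype.ext h)
    apply hip
    rw [← hve, ← hF, ← hy, hFmul]
    change τ _ (G ⟨mulLeft K e x, x, rfl⟩) = 0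
    rw [hx, map_zero]
  have hsurj : Function.Surjective G := by
    rw [← LinearMap.range_eq_top]
    refine (hirr (LinearMap.range G) ?_).resolve_left fun h => ?_
    · rintro a _ ⟨⟨_, x, rfl⟩, rfl⟩
      exact ⟨⟨e * (x * a), x * a, rfl⟩, by
        change F (e * (x * a)) = τ _ (F (e * x))
        rw [← hFmul, mul_assoc]⟩
    · have : G ⟨e, e, hee⟩ ∈ LinearMap.range G := ⟨_, rfl⟩
      rw [h, Submodule.mem_bot] at this
      exact hip (hve.symm.trans this)
  exact (LinearEquiv.ofBijective G ⟨hinj, hsurj⟩).finrank_eq.symm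

end

end

section

variable {K H}
variable [FiniteDimensional K H]

section

variable {R : H ⊗[K] H} {D : Submodule K H} {W : Type} [AddCommGroup W] [Module K W]

theorem coact_act_mc {V : Type} [AddCommGroup V] [Module K V] (s : RModStr K H R V) (i j) (v : V) :
    s.coact (s.act (mc K H i j) v) =
      ∑ k, TensorProduct.map (ad (K := K) (mc K H i k)) (s.act (mc K H k j)) (s.coact v) := by
  have hc := LinearMap.congr_fun s.compat (mc K H i j ⊗ₜ v)
  simp only [LinearMap.comp_apply, TensorProduct.lift.tmul, TensorProduct.map_tmul,
    LinearEquiv.coe_coe, comul_mc, sum_tmul, map_sum] at hc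
  refine hc.trans (Finset.sum_congr rfl fun k _ => ?_)
  induction s.coact v with
  | zero => simp
  | add x y hx hy => simp only [map_add, tmul_add, hx, hy]
  | tmul u v => simp [ad_apply, adAct]

theorem rhoHW_one_tmul (sW : DComodStr K H R D W) (w : W) : rhoHW K H R sW (1 ⊗ₜ w) =
    lTensor H (TensorProduct.mk K H W 1) (sW.coact w) := by
  rw [rhoHW, LinearMap.comp_apply, LinearMap.comp_apply, TensorProduct.map_tmul,
    Bialgebra.comul_one, Algebra.TensorProduct.one_def]
  induction sW.coact w with
  | zero => simp
  | add x y hx hy => simp only [map_add, tmul_add, hx, hy]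
  | tmul u v =>
    have : adMap K H ((1 : H) ⊗ₜ u) = u := by
      change ad (K := K) 1 u = u
      simp [ad_one]
    simp [this]

variable (s : RModStr K H R (H ⊗[K] W))

/-- The `H`-linear extension `h ⊗ w ↦ h φ(w)`. -/
noncomputable def extendHom : (W →ₗ[K] H ⊗[K] W) →ₗ[K] Module.End K (H ⊗[K] W) where
  toFun φ := TensorProduct.lift (LinearMap.lcomp K _ φ ∘ₗ s.act.toLinearMap)
  map_add' φ ψ := TensorProduct.ext' fun h w => by simp
  map_smul' c φ := TensorProduct.ext' fun h w => by simp

@[simp] theorem extendHom_tmul (φ : W →ₗ[K] H ⊗[K] W) (h : H) (w : W) :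
    extendHom s φ (h ⊗ₜ w) = s.act h (φ w) := rfl

theorem extendHom_one_tmul (φ : W →ₗ[K] H ⊗[K] W) (w : W) : extendHom s φ (1 ⊗ₜ w) = φ w := by
  simp

theorem extendHom_injective : Function.Injective (extendHom s) := fun φ ψ h =>
  LinearMap.ext fun w => by rw [← extendHom_one_tmul s, h, extendHom_one_tmul]

variable (hact : ∀ h : H, (s.act h : H ⊗[K] W →ₗ[K] H ⊗[K] W) = rTensor W (mulLeft K h))
include hact

theorem extendHom_apply_of_commute {ψ : Module.End K (H ⊗[K] W)}
    (hψ : ∀ h, s.act h * ψ = ψ * s.act h) :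
    extendHom s (ψ ∘ₗ TensorProduct.mk K H W 1) = ψ := by
  refine TensorProduct.ext' fun h w => ?_
  rw [extendHom_tmul, LinearMap.comp_apply, ← Module.End.mul_apply, hψ, Module.End.mul_apply, hact]
  simp

theorem extendHom_mem_iff (sW : DComodStr K H R D W) (hs : s.coact = rhoHW K H R sW)
    (φ : W →ₗ[K] H ⊗[K] W) :
    extendHom s φ ∈ endHD K H R s ↔ lTensor H φ ∘ₗ sW.coact = rhoHW K H R sW ∘ₗ φ := by
  have hcomp : extendHom s φ ∘ₗ TensorProduct.mk K H W 1 = φ :=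
    LinearMap.ext fun w => extendHom_one_tmul s φ w
  constructor
  · rintro ⟨-, h⟩
    ext w
    have := LinearMap.congr_fun h (1 ⊗ₜ w)
    rw [LinearMap.comp_apply, LinearMap.comp_apply, hs, rhoHW_one_tmul, extendHom_one_tmul,
      ← LinearMap.comp_apply, ← lTensor_comp, hcomp] at this
    exact this
  · intro h
    refine ⟨fun h' => TensorProduct.ext' fun x w => ?_, ?_⟩
    · change s.act h' (s.act x (φ w)) = extendHom s φ (s.act h' (x ⊗ₜ w))
      rw [← Module.End.mul_apply, ← map_mul s.act, hact h', rTensor_tmul, extendHom_tmul]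
      rfl
    · refine TensorProduct.ext (?_ : (TensorProduct.mk K H W).compr₂ _ =
        (TensorProduct.mk K H W).compr₂ _)
      refine ext_mc (K := K) (V := W →ₗ[K] H ⊗[K] (H ⊗[K] W)) fun i j => ?_
      ext w
      have hw := LinearMap.congr_fun h w
      simp only [LinearMap.comp_apply] at hw
      simp only [compr₂_apply, mk_apply, LinearMap.id_coe, id_eq, LinearMap.comp_apply, extendHom_tmul]
      rw [coact_act_mc, hs, ← hw, rhoHW_tmul_eq_sum, map_sum]
      refine Finset.sum_congr rfl fun k _ => ?_
      induction sW.coact w with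
      | zero => simp
      | add x y hx hy => simp only [map_add, hx, hy]
      | tmul a v => simp only [TensorProduct.map_tmul, lTensor_tmul, mk_apply, extendHom_tmul]

omit hact in
theorem mem_cotensor_iff [FiniteDimensional K W] (sW : DComodStr K H R D W)
    {ρstar : (W →ₗ[K] K) →ₗ[K] (W →ₗ[K] K) ⊗[K] H} (hρ : IsDualCoaction K H sW.coact ρstar)
    (t : (W →ₗ[K] K) ⊗[K] (H ⊗[K] W)) : t ∈ cotensor K H ρstar (rhoHW K H R sW) ↔
      lTensor H (dualTensorHom K W (H ⊗[K] W) t) ∘ₗ sW.coact =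
        rhoHW K H R sW ∘ₗ dualTensorHom K W (H ⊗[K] W) t := by
  have h4 (t : (W →ₗ[K] K) ⊗[K] (H ⊗[K] W)) : dualTensorHom K W _ (lTensor _ (rhoHW K H R sW) t) =
      rhoHW K H R sW ∘ₗ dualTensorHom K W (H ⊗[K] W) t := by
    induction t with
    | zero => simp
    | add x y hx hy => simp only [map_add, hx, hy, LinearMap.comp_add]
    | tmul f v => ext w; simp [dualTensorHom_apply]
  have h1 : dualTensorHom K W _ (TensorProduct.assoc K _ H (H ⊗[K] W) (rTensor _ ρstar t)) =
      lTensor H (dualTensorHom K W (H ⊗[K] W) t) ∘ₗ sW.coact := by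
    induction t with
    | zero => simp
    | add x y hx hy => simp only [map_add, hx, hy, lTensor_add, LinearMap.add_comp]
    | tmul f v =>
      ext w
      have h2 := congr_arg (fun x => x ⊗ₜ[K] v) (hρ f w)
      rw [rTensor_tmul]
      have h3 : ∀ u : (W →ₗ[K] K) ⊗[K] H,
          dualTensorHom K W _ (TensorProduct.assoc K _ H (H ⊗[K] W) (u ⊗ₜ v)) w =
          TensorProduct.lid K H (rTensor H (Module.Dual.eval K W w) u) ⊗ₜ v := by
        intro u
        induction u with
        | zero => simp
        | add x y hx hy => simp only [map_add, add_tmul, LinearMap.add_apply, hx, hy]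
        | tmul g h => simp [dualTensorHom_apply, smul_tmul']
      rw [h3, h2]
      simp only [LinearMap.comp_apply]
      induction sW.coact w with
      | zero => simp
      | add x y hx hy => simp only [map_add, add_tmul, hx, hy]
      | tmul g h => simp [dualTensorHom_apply, smul_tmul]
  rw [← h1, ← h4 t, cotensor, LinearMap.mem_ker]
  refine (sub_eq_zero (a := TensorProduct.assoc K (W →ₗ[K] K) H (H ⊗[K] W) (rTensor _ ρstar t))
    (b := lTensor _ (rhoHW K H R sW) t)).trans ⟨congr_arg _, fun h =>
    (dualTensorHom_bijective (R := K) (M := W) (N := H ⊗[K] (H ⊗[K] W))).injective h⟩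

theorem finrank_cotensor [FiniteDimensional K W] (sW : DComodStr K H R D W)
    (hs : s.coact = rhoHW K H R sW)
    {ρstar : (W →ₗ[K] K) →ₗ[K] (W →ₗ[K] K) ⊗[K] H} (hρ : IsDualCoaction K H sW.coact ρstar) :
    Module.finrank K (cotensor K H ρstar (rhoHW K H R sW)) = Module.finrank K (endHD K H R s) := by
  let L : (W →ₗ[K] K) ⊗[K] (H ⊗[K] W) →ₗ[K] Module.End K (H ⊗[K] W) :=
    extendHom s ∘ₗ dualTensorHom K W (H ⊗[K] W)
  have hL : Function.Injective L :=
    (extendHom_injective s).comp (dualTensorHom_bijective (R := K) (M := W) (N := H ⊗[K] W)).injective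
  have hmap : (cotensor K H ρstar (rhoHW K H R sW)).map L =
      Subalgebra.toSubmodule (endHD K H R s) := by
    ext ψ
    constructor
    · rintro ⟨t, ht, rfl⟩
      exact (extendHom_mem_iff s hact sW hs _).2 ((mem_cotensor_iff sW hρ t).1 ht)
    · intro hψ
      obtain ⟨t, ht⟩ := (dualTensorHom_bijective (R := K) (M := W) (N := H ⊗[K] W)).surjective
        (ψ ∘ₗ TensorProduct.mk K H W 1)
      have hLt : L t = ψ := by
        change extendHom s (dualTensorHom K W (H ⊗[K] W) t) = ψ
        rw [ht, extendHom_apply_of_commute s hact hψ.1]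
      refine ⟨t, (mem_cotensor_iff sW hρ t).2 ((extendHom_mem_iff s hact sW hs _).1 ?_), hLt⟩
      change L t ∈ _
      rw [hLt]
      exact hψ
  rw [(Submodule.equivMapOfInjective L hL _).finrank_eq, hmap]
  rfl

end

end

section

variable {K H}
variable [FiniteDimensional K H]

theorem isSemisimpleRing_endHD {R : H ⊗[K] H} {V : Type} [AddCommGroup V] [Module K V]
    [FiniteDimensional K V] (s : RModStr K H R V) (𝓱 : HaarData K H) (d : RData R) :
    IsSemisimpleRing (endHD K H R s) := by
  have := isSemisimpleRing_double 𝓱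
  refine isSemisimpleRing_commutant (B := DRep.double K H) (toDRep d s).Φ _ fun φ =>
    (mem_endHD_iff_drepP s d φ).trans ⟨fun h b => ?_, fun h => ⟨fun a => ?_, fun f => ?_⟩⟩
  · obtain ⟨θ, rfl⟩ := DRep.T_univ_bijective.2 b
    rw [DRep.Φ_T, DRep.T_apply]
    simp only [Finset.sum_mul, Finset.mul_sum, mul_assoc, h.2]
    simp only [← mul_assoc, h.1]
  · rw [← DRep.Φ_π, h]
  · rw [← DRep.Φ_P, h]

theorem finrank_range_mulLeft_subalgebra {A : Type} [Ring A] [Algebra K A] (N : Subalgebra K A)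
    (e : N) : Module.finrank K (LinearMap.range (mulLeft K e)) =
      Module.finrank K ((Subalgebra.toSubmodule N).map (mulLeft K (e : A))) := by
  have h : (LinearMap.range (mulLeft K e)).map N.val.toLinearMap =
      (Subalgebra.toSubmodule N).map (mulLeft K (e : A)) := by
    ext x
    constructor
    · rintro ⟨_, ⟨y, rfl⟩, rfl⟩
      exact ⟨y, y.2, rfl⟩
    · rintro ⟨y, hy, rfl⟩
      exact ⟨e * ⟨y, hy⟩, ⟨⟨y, hy⟩, rfl⟩, rfl⟩
  rw [(Submodule.equivMapOfInjective N.val.toLinearMap Subtype.val_injective _).finrank_eq, h]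

theorem exists_dvd_finrank_mul_eq [IsAlgClosed K] [CharZero K] [Nontrivial H]
    {R : H ⊗[K] H} {D : Submodule K H} (hD : IsMinimalAdjointStableSubcoalgebra K H R D)
    {V : Type} [AddCommGroup V] [Module K V] [FiniteDimensional K V] [Nontrivial V]
    (s : RModStr K H R V) (𝓱 : HaarData K H) (d : RData R)
    (hm : ∀ v, s.coact v ∈ Submodule.map₂ (TensorProduct.mk K H V) D ⊤)
    (hfree : ∀ g h, trace K V (coeff s g * s.act h) = 𝓱.lam h * trace K V (coeff s g))
    {U : Type} [AddCommGroup U] [Module K U] (τ : (endHD K H R s)ᵐᵒᵖ →ₐ[K] Module.End K U)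
    (hU : Nontrivial U) (hirr : ∀ Y : Submodule K U,
      (∀ a : endHD K H R s, ∀ u ∈ Y, τ (MulOpposite.op a) u ∈ Y) → Y = ⊥ ∨ Y = ⊤) :
    ∃ m : ℕ, m ∣ Module.finrank K H ∧
      Module.finrank K V * Module.finrank K U = m * Module.finrank K (endHD K H R s) := by
  have := isSemisimpleRing_endHD s 𝓱 d
  obtain ⟨e, he, he0, hprim, hdim⟩ := exists_idempotent_of_irreducible τ hU hirr
  have he' : (e : Module.End K V) * e = e := congr_arg Subtype.val he
  have hcomm := (mem_endHD_iff_drepP s d e).1 e.2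
  obtain ⟨m, htr, hdvd⟩ := DRep.exists_trace_eq_dvd 𝓱 (toDRep d s) he'
    (fun h => he0 (Subtype.ext h)) hcomm.1 hcomm.2 fun φ hπ hP => by
      obtain ⟨c, hc⟩ := hprim ⟨φ, (mem_endHD_iff_drepP s d φ).2 ⟨hπ, hP⟩⟩
      exact ⟨c, congr_arg Subtype.val hc⟩
  have h := finrank_mul_trace s 𝓱 d hD hm hfree he' e.2
  rw [htr, ← finrank_range_mulLeft_subalgebra, ← hdim] at h
  exact ⟨m, hdvd, by exact_mod_cast h⟩

theorem finrank_mul_finrank_dvd [IsAlgClosed K] [CharZero K] (hss : IsSemisimpleRing H)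
    {R : H ⊗[K] H} (hR : IsQuasiTriangular K H R)
    {D : Submodule K H} (hD : IsMinimalAdjointStableSubcoalgebra K H R D)
    {W : Type} [AddCommGroup W] [Module K W] [FiniteDimensional K W] [Nontrivial W]
    (sW : DComodStr K H R D W) (s : RModStr K H R (H ⊗[K] W))
    (hact : ∀ h : H, (s.act h : H ⊗[K] W →ₗ[K] H ⊗[K] W) = rTensor W (mulLeft K h))
    (hs : s.coact = rhoHW K H R sW)
    {U : Type} [AddCommGroup U] [Module K U] (τ : (endHD K H R s)ᵐᵒᵖ →ₐ[K] Module.End K U)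
    (hU : Nontrivial U) (hirr : ∀ Y : Submodule K U,
      (∀ a : endHD K H R s, ∀ u ∈ Y, τ (MulOpposite.op a) u ∈ Y) → Y = ⊥ ∨ Y = ⊤) :
    Module.finrank K U * Module.finrank K W ∣ Module.finrank K (endHD K H R s) := by
  have : Nontrivial H := by
    obtain ⟨x, -, hx⟩ := Submodule.exists_mem_ne_zero_of_ne_bot hD.1
    exact ⟨x, 0, hx⟩
  have : Nontrivial (H ⊗[K] W) := by
    rw [← Module.finrank_pos_iff (R := K), Module.finrank_tensorProduct]
    exact Nat.mul_pos Module.finrank_pos Module.finrank_pos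
  obtain ⟨𝓱⟩ := exists_haarData (K := K) hss
  obtain ⟨d⟩ := exists_rData hR
  obtain ⟨m, ⟨q, hq⟩, h⟩ := exists_dvd_finrank_mul_eq hD s 𝓱 d
    (fun v => by rw [hs]; exact rhoHW_mem sW hD.2.1.1 v)
    (trace_coeff_mul_act sW 𝓱 s hact hs) τ hU hirr
  rw [Module.finrank_tensorProduct, hq, mul_assoc, mul_assoc] at h
  have hm : 0 < m := Nat.pos_of_ne_zero fun h0 => by
    rw [h0, zero_mul] at hq
    exact Module.finrank_pos.ne' hq
  exact ⟨q, by rw [← Nat.eq_of_mul_eq_mul_left hm h]; ring⟩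

end

end HopfDim

/-- **Statement 19.** Let `k` be an algebraically closed field of characteristic zero,
`(H,R)` a finite dimensional semisimple quasi-triangular Hopf algebra over `k`, `D` a
minimal `H`-adjoint-stable subcoalgebra of `H_R` and `W` a finite dimensional nonzero
left `D`-comodule.  For every irreducible right module `U` over the `R`-adjoint-stable
algebra `N_W = W* □_D (H ⊗ W) ≅ Hom_H^D(H ⊗ W, H ⊗ W)`, the product
`dim U · dim W` divides `dim N_W`; in particular `dim U ∣ dim N_W`. -/
theorem dim_irreducible_NW_module_dvd
    [IsAlgClosed K] [CharZero K] [FiniteDimensional K H]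
    (R : H ⊗[K] H) (hR : IsQuasiTriangular K H R)
    (hss : IsSemisimpleRing H)
    (D : Submodule K H) (hD : IsMinimalAdjointStableSubcoalgebra K H R D)
    (W : Type) [AddCommGroup W] [Module K W] [FiniteDimensional K W] [Nontrivial W]
    (sW : DComodStr K H R D W)
    (ρstar : (W →ₗ[K] K) →ₗ[K] (W →ₗ[K] K) ⊗[K] H)
    (hρstar : IsDualCoaction K H sW.coact ρstar)
    (sHW : RModStr K H R (H ⊗[K] W))
    (hHWact : ∀ h' : H,
      (sHW.act h' : H ⊗[K] W →ₗ[K] H ⊗[K] W) = LinearMap.rTensor W (LinearMap.mulLeft K h'))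
    (hHWcoact : sHW.coact = rhoHW K H R sW)
    -- `U` is an irreducible right module over `N_W ≅ Hom_H^D(H ⊗ W, H ⊗ W)`
    (U : Type) [AddCommGroup U] [Module K U] [FiniteDimensional K U]
    (τ : (↥(endHD K H R sHW))ᵐᵒᵖ →ₐ[K] Module.End K U)
    (hUirr : Nontrivial U ∧ ∀ Y : Submodule K U,
      (∀ a : ↥(endHD K H R sHW), ∀ u ∈ Y, τ (MulOpposite.op a) u ∈ Y) → Y = ⊥ ∨ Y = ⊤) :
    (Module.finrank K U * Module.finrank K W ∣
      Module.finrank K ↥(cotensor K H ρstar (rhoHW K H R sW))) ∧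
    (Module.finrank K U ∣ Module.finrank K ↥(cotensor K H ρstar (rhoHW K H R sW))) := by
  have h := HopfDim.finrank_mul_finrank_dvd hss hR hD sW sHW hHWact hHWcoact τ hUirr.1 hUirr.2
  rw [← HopfDim.finrank_cotensor sHW hHWact sW hHWcoact hρstar] at h
  exact ⟨h, (dvd_mul_right _ _).trans h⟩
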